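/- Fix s > 1. For every μ > 0 and every 𝒞 > 0 there exist a Fourier-side solution a of the cubic defocusing NLS (the case v ≡ 0), defined for all t ∈ ℝ and with ‖a(t)‖_{H^s} < ∞ for all t, and a time T > 0 such that ‖a(0)‖_{H^s} ≤ μ and ‖a(T)‖_{H^s} ≥ 𝒞. -/

import Mathlib

noncomputable section

open scoped BigOperators

/-- We identify the two-torus side with the Fourier side: modes are indexed by `ℤ × ℤ`. -/
abbrev Z2 := ℤ × ℤ

/-- The squared Euclidean norm `|n|²` of a mode `n ∈ ℤ²`, as a real number. -/
def nsq (n : Z2) : ℝ := (n.1 : ℝ) ^ 2 + (n.2 : ℝ) ^ 2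

/-- Triples of modes. -/
abbrev Triple := Z2 × Z2 × Z2

/-- The cubic nonlinearity term `a_{n₁} ⋅ conj(a_{n₂}) ⋅ a_{n₃}` attached to a triple. -/
def cubicTerm (a : Z2 → ℂ) (p : Triple) : ℂ :=
  a p.1 * (starRingEnd ℂ) (a p.2.1) * a p.2.2

/-- A Fourier-side solution of the cubic defocusing NLS with convolution potential `V`,
whose (real) Fourier coefficients are `v`: for every `n` and `t`, the sum over triples
`n₁ - n₂ + n₃ = n` converges absolutely, `a_n` is differentiable in `t`, and
`-i a_n'(t) = (|n|² + v_n) a_n(t) + ∑_{n₁-n₂+n₃=n} a_{n₁} conj(a_{n₂}) a_{n₃}`. -/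
def IsSolutionV (v : Z2 → ℝ) (a : ℝ → Z2 → ℂ) : Prop :=
  ∀ (n : Z2) (t : ℝ),
    Summable (fun p : {p : Triple // p.1 - p.2.1 + p.2.2 = n} => ‖cubicTerm (a t) p.1‖) ∧
    ∃ d : ℂ, HasDerivAt (fun τ : ℝ => a τ n) d t ∧
      -Complex.I * d =
        ((nsq n + v n : ℝ) : ℂ) * a t n +
          ∑' p : {p : Triple // p.1 - p.2.1 + p.2.2 = n}, cubicTerm (a t) p.1

/-- The square of the `H^s` Sobolev norm `∑ (1+|n|²)^s |a_n|²`. -/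
def HsNormSq (s : ℝ) (a : Z2 → ℂ) : ℝ := ∑' n : Z2, (1 + nsq n) ^ s * ‖a n‖ ^ 2

/-- Finiteness of the `H^s` norm. -/
def HsFinite (s : ℝ) (a : Z2 → ℂ) : Prop :=
  Summable fun n : Z2 => (1 + nsq n) ^ s * ‖a n‖ ^ 2

/-- The `H^s` Sobolev norm. -/
def HsNorm (s : ℝ) (a : Z2 → ℂ) : ℝ := HsNormSq s a ^ (1 / 2 : ℝ)

/-- The `L²` (mass) norm. -/
def L2Norm (a : Z2 → ℂ) : ℝ := (∑' n : Z2, ‖a n‖ ^ 2) ^ (1 / 2 : ℝ)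

section SkewODE

open Set Metric

variable {E : Type*} [NormedAddCommGroup E] [InnerProductSpace ℝ E]

/-- A bounded Lipschitz vector field has a global integral curve through every point. -/
theorem exists_global_curve_of_lipschitz_bounded [CompleteSpace E] {g : E → E} {K C : NNReal}
    (hK : LipschitzWith K g) (hC : ∀ x, ‖g x‖ ≤ C) (x0 : E) :
    ∃ α : ℝ → E, α 0 = x0 ∧ ∀ t, HasDerivAt α (g (α t)) t := by
  have key : ∀ n : ℕ, ∃ α : ℝ → E, α 0 = x0 ∧
      ∀ t ∈ Ioo (-(n + 1 : ℝ)) (n + 1), HasDerivAt α (g (α t)) t := by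
    intro n
    have h0 : (0 : ℝ) ∈ Icc (-(n + 1 : ℝ)) (n + 1) := by
      constructor <;> linarith [(Nat.cast_nonneg n : (0 : ℝ) ≤ n)]
    have hp : IsPicardLindelof (fun _ : ℝ => g) (⟨0, h0⟩ : Icc (-(n + 1 : ℝ)) (n + 1)) x0
        (C * (n + 1)) 0 C K :=
      { lipschitzOnWith := fun t _ => hK.lipschitzOnWith
        continuousOn := fun x _ => continuousOn_const
        norm_le := fun t _ x _ => hC x
        mul_max_le := by simp }
    obtain ⟨α, h1, h2⟩ := hp.exists_eq_forall_mem_Icc_hasDerivWithinAt₀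
    exact ⟨α, h1, fun t ht => (h2 t (Ioo_subset_Icc_self ht)).hasDerivAt
      (Icc_mem_nhds ht.1 ht.2)⟩
  choose α hα0 hα using key
  have agree : ∀ m n : ℕ, m ≤ n → EqOn (α m) (α n) (Ioo (-(m + 1 : ℝ)) (m + 1)) := by
    intro m n hmn
    have hmn' : (m : ℝ) ≤ n := by exact_mod_cast hmn
    refine ODE_solution_unique_of_mem_Ioo (v := fun _ => g) (s := fun _ => univ) (K := K) (t₀ := 0)
      (fun t _ => hK.lipschitzOnWith) ?_ (fun t ht => ⟨hα m t ht, trivial⟩)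
      (fun t ht => ⟨hα n t ⟨by linarith [ht.1], by linarith [ht.2]⟩, trivial⟩) (by rw [hα0, hα0])
    constructor <;> linarith [(Nat.cast_nonneg m : (0 : ℝ) ≤ m)]
  refine ⟨fun t => α ⌈|t|⌉₊ t, by simpa using hα0 _, fun t => ?_⟩
  have hmem : ∀ u : ℝ, u ∈ Ioo (-((⌈|u|⌉₊ : ℝ) + 1)) ((⌈|u|⌉₊ : ℝ) + 1) := by
    intro u
    have h := Nat.le_ceil |u|
    constructor
    · linarith [neg_abs_le u]
    · linarith [le_abs_self u]
  set N := ⌈|t|⌉₊ + 1 with hN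
  have h1 : ∀ u ∈ Ioo (t - 1) (t + 1), α ⌈|u|⌉₊ u = α N u := by
    intro u hu
    refine agree _ _ ?_ (hmem u)
    have : |u| ≤ |t| + 1 := by
      rw [abs_le]; constructor
      · linarith [neg_abs_le t, hu.1]
      · linarith [le_abs_self t, hu.2]
    rw [hN]
    calc ⌈|u|⌉₊ ≤ ⌈|t| + 1⌉₊ := Nat.ceil_mono this
      _ = _ := Nat.ceil_add_one (abs_nonneg t)
  have htm : t ∈ Ioo (t - 1) (t + 1) := ⟨by linarith, by linarith⟩
  have h2 : HasDerivAt (α N) (g (α N t)) t := by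
    refine hα N t ?_
    have := hmem t
    rw [hN]; push_cast
    exact ⟨by linarith [this.1], by linarith [this.2]⟩
  beta_reduce
  rw [h1 t htm]
  refine h2.congr_of_eventuallyEq ?_
  filter_upwards [Ioo_mem_nhds htm.1 htm.2] with u hu using h1 u hu

/-- A `C¹` vector field everywhere orthogonal to the position vector has global integral curves,
and they stay on spheres. -/
theorem exists_global_curve_of_skew [FiniteDimensional ℝ E] {f : E → E} (hf : ContDiff ℝ 1 f)
    (hskew : ∀ x, inner ℝ x (f x) = 0) (x0 : E) :
    ∃ α : ℝ → E, α 0 = x0 ∧ (∀ t, HasDerivAt α (f (α t)) t) ∧ ∀ t, ‖α t‖ = ‖x0‖ := by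
  let φ : ContDiffBump (0 : E) := ⟨‖x0‖ + 1, ‖x0‖ + 2, by positivity, by linarith⟩
  have hsm : ContDiff ℝ 1 (fun x => φ x • f x) := φ.contDiff.smul hf
  have hcs : HasCompactSupport (fun x => φ x • f x) := φ.hasCompactSupport.smul_right
  obtain ⟨K, hK⟩ := hsm.lipschitzWith_of_hasCompactSupport hcs one_ne_zero
  obtain ⟨C, hC⟩ := hcs.exists_bound_of_continuous hsm.continuous
  obtain ⟨α, h0, hα⟩ := exists_global_curve_of_lipschitz_bounded hK
    (C := ⟨max C 0, le_max_right _ _⟩) (fun x => (hC x).trans (le_max_left _ _)) x0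
  have hd : ∀ t, HasDerivAt (fun t => ‖α t‖ ^ 2) 0 t := by
    intro t
    have := (hα t).norm_sq
    rwa [real_inner_smul_right, hskew, mul_zero, mul_zero] at this
  have hn : ∀ t, ‖α t‖ = ‖x0‖ := by
    intro t
    have h := is_const_of_deriv_eq_zero (fun t => (hd t).differentiableAt)
      (fun t => (hd t).deriv) t 0
    rw [h0] at h
    exact (sq_eq_sq₀ (norm_nonneg _) (norm_nonneg _)).1 h
  refine ⟨α, h0, fun t => ?_, hn⟩
  have h1 : φ (α t) = 1 := φ.one_of_mem_closedBall (by
    rw [mem_closedBall_zero_iff, hn t]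
    change ‖x0‖ ≤ ‖x0‖ + 1
    linarith)
  have := hα t
  rwa [h1, one_smul] at this

end SkewODE

section Gronwall

open Set

theorem gronwallBound_le_add_mul_exp {δ K ε x : ℝ} (hK : 0 ≤ K) (hε : 0 ≤ ε) :
    gronwallBound δ K ε x ≤ (δ + ε * x) * Real.exp (K * x) := by
  rcases eq_or_lt_of_le hK with rfl | hK'
  · simp [gronwallBound_K0]
  · rw [gronwallBound_of_K_ne_0 hK'.ne']
    have h1 : Real.exp (K * x) - 1 ≤ K * x * Real.exp (K * x) := by
      have h2 := Real.add_one_le_exp (-(K * x))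
      have h3 : Real.exp (-(K * x)) * Real.exp (K * x) = 1 := by
        rw [← Real.exp_add]; simp
      nlinarith [Real.exp_pos (K * x)]
    have h4 : ε / K * (Real.exp (K * x) - 1) ≤ ε / K * (K * x * Real.exp (K * x)) :=
      mul_le_mul_of_nonneg_left h1 (by positivity)
    have h5 : ε / K * (K * x * Real.exp (K * x)) = ε * x * Real.exp (K * x) := by
      field_simp
    rw [add_mul]; linarith

/-- Grönwall's inequality for a weighted `ℓ¹` norm of a finite family of complex functions. -/
theorem sum_weighted_norm_le_of_deriv {ι : Type*} (S : Finset ι) {w : ι → ℝ}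
    (hw : ∀ n ∈ S, 0 ≤ w n) {u v : ι → ℝ → ℂ} {δ K ε T : ℝ} (hK : 0 ≤ K) (hε : 0 ≤ ε)
    (hd : ∀ n ∈ S, ∀ t, HasDerivAt (u n) (v n t) t)
    (hb : ∀ t ∈ Ico 0 T, ∑ n ∈ S, w n * ‖v n t‖ ≤ K * ∑ n ∈ S, w n * ‖u n t‖ + ε)
    (h0 : ∑ n ∈ S, w n * ‖u n 0‖ ≤ δ) {t : ℝ} (ht : t ∈ Icc 0 T) :
    ∑ n ∈ S, w n * ‖u n t‖ ≤ (δ + ε * t) * Real.exp (K * t) := by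
  let F : ℝ → PiLp 1 (fun _ : S => ℂ) := fun t => WithLp.toLp 1 (fun n => (w n : ℂ) * u n t)
  let F' : ℝ → PiLp 1 (fun _ : S => ℂ) := fun t => WithLp.toLp 1 (fun n => (w n : ℂ) * v n t)
  have hn : ∀ z : ι → ℝ → ℂ, ∀ t,
      ‖(WithLp.toLp 1 (fun n : S => (w n : ℂ) * z n t) : PiLp 1 (fun _ : S => ℂ))‖
        = ∑ n ∈ S, w n * ‖z n t‖ := by
    intro z t
    rw [PiLp.norm_eq_of_nat 1 (by simp)]
    simp only [pow_one, Nat.cast_one, div_one, Real.rpow_one]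
    rw [← Finset.sum_coe_sort S]
    refine Finset.sum_congr rfl fun n _ => ?_
    rw [norm_mul, Complex.norm_real, Real.norm_of_nonneg (hw n n.2)]
  have hF : ∀ t, HasDerivAt F (F' t) t := by
    intro t
    have h : HasDerivAt (fun t => (fun n : S => (w n : ℂ) * u n t))
        (fun n : S => (w n : ℂ) * v n t) t :=
      hasDerivAt_pi.2 fun n => (hd n n.2 t).const_mul _
    exact ((PiLp.continuousLinearEquiv 1 ℝ (fun _ : S => ℂ)).symm.hasFDerivAt.comp_hasDerivAt t h)
  have h := norm_le_gronwallBound_of_norm_deriv_right_le (f := F) (f' := F') (δ := δ) (K := K)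
    (ε := ε) (a := 0) (b := T) (fun t _ => (hF t).continuousAt.continuousWithinAt)
    (fun t _ => (hF t).hasDerivWithinAt) (by rw [hn u]; exact h0)
    (fun t ht => by rw [hn u, hn v]; exact hb t ht) t ht
  rw [hn u, sub_zero] at h
  exact h.trans (gronwallBound_le_add_mul_exp hK hε)

/-- Continuity argument: a bound by `1` that self-improves to `1 / 2` propagates. -/
theorem le_half_of_bootstrap {φ : ℝ → ℝ} (hφ : Continuous φ) {T : ℝ} (h0 : φ 0 ≤ 1 / 2)
    (hstep : ∀ t ∈ Icc 0 T, (∀ u ∈ Icc 0 t, φ u ≤ 1) → φ t ≤ 1 / 2) {t : ℝ} (ht : t ∈ Icc 0 T) :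
    φ t ≤ 1 / 2 := by
  have key : ∀ u ∈ Icc 0 T, φ u < 3 / 4 := by
    by_contra! hcon
    have hcomp : IsCompact (Icc 0 T ∩ {u | 3 / 4 ≤ φ u}) :=
      isCompact_Icc.inter_right (isClosed_le continuous_const hφ)
    obtain ⟨c, hc, hmin⟩ := hcomp.exists_isLeast (by
      obtain ⟨u, hu, hu'⟩ := hcon
      exact ⟨u, hu, hu'⟩)
    obtain ⟨u, hu, hu'⟩ : ∃ u ∈ Icc 0 c, φ u = 3 / 4 :=
      intermediate_value_Icc hc.1.1 hφ.continuousOn ⟨by linarith, hc.2⟩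
    have huc : c ≤ u := hmin ⟨⟨hu.1, hu.2.trans hc.1.2⟩, hu'.ge⟩
    have hceq : u = c := le_antisymm hu.2 huc
    have h1 : φ c ≤ 1 / 2 := by
      refine hstep c hc.1 fun v hv => ?_
      by_contra! hv1
      have : c ≤ v := hmin ⟨⟨hv.1, hv.2.trans hc.1.2⟩, show 3 / 4 ≤ φ v by linarith⟩
      have : v = c := le_antisymm hv.2 this
      rw [this, ← hceq, hu'] at hv1
      norm_num at hv1
    have h2 := hc.2
    simp only [mem_ofPred_eq] at h2
    linarith
  exact hstep t ht fun u hu => by linarith [key u ⟨hu.1, hu.2.trans ht.2⟩]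

end Gronwall

section Volterra

open Set Filter Topology

/-- If `f` and `f'` both converge at infinity then `f'` converges to zero. -/
theorem eq_zero_of_tendsto_of_tendsto_deriv {f f' : ℝ → ℝ} {l L : ℝ}
    (hf : ∀ t, HasDerivAt f (f' t) t) (h : Tendsto f atTop (𝓝 l)) (h' : Tendsto f' atTop (𝓝 L)) :
    L = 0 := by
  have hm : ∀ t : ℝ, ∃ c ∈ Ioo t (t + 1), f' c = f (t + 1) - f t := by
    intro t
    obtain ⟨c, hc, hc'⟩ := exists_hasDerivAt_eq_slope f f' (by linarith : t < t + 1)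
      (fun u _ => (hf u).continuousAt.continuousWithinAt) (fun u _ => hf u)
    exact ⟨c, hc, by rw [hc']; simp⟩
  choose c hc hc' using hm
  have h1 : Tendsto c atTop atTop :=
    tendsto_atTop_mono (fun t => (hc t).1.le) tendsto_id
  have h2 : Tendsto (fun t => f (t + 1) - f t) atTop (𝓝 L) := by
    simpa [Function.comp_def, hc'] using h'.comp h1
  have h3 : Tendsto (fun t => f (t + 1) - f t) atTop (𝓝 (l - l)) :=
    (h.comp (tendsto_atTop_add_const_right _ _ tendsto_id)).sub h
  rw [sub_self] at h3
  exact tendsto_nhds_unique h2 h3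

/-- Solutions of a scalar linear equation keep their sign. -/
theorem pos_of_hasDerivAt_mul {f q : ℝ → ℝ} (hq : Continuous q)
    (hf : ∀ t, HasDerivAt f (f t * q t) t) (h0 : 0 < f 0) (t : ℝ) : 0 < f t := by
  have hI : ∀ t, HasDerivAt (fun t => ∫ u in (0 : ℝ)..t, q u) (q t) t := fun t =>
    (hq.integral_hasStrictDerivAt 0 t).hasDerivAt
  have hd : ∀ t, HasDerivAt (fun t => f t * Real.exp (-∫ u in (0 : ℝ)..t, q u)) 0 t := by
    intro t
    refine ((hf t).fun_mul (hI t).fun_neg.exp).congr_deriv ?_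
    ring
  have hc := is_const_of_deriv_eq_zero (fun t => (hd t).differentiableAt)
      (fun t => (hd t).deriv) t 0
  simp only [intervalIntegral.integral_same, neg_zero, Real.exp_zero, mul_one] at hc
  have : 0 < f t * Real.exp (-∫ u in (0 : ℝ)..t, q u) := by rw [hc]; exact h0
  exact (pos_iff_pos_of_mul_pos this).2 (Real.exp_pos _)

/-- Extension by zero of a vector, shifted so that its entries occupy the places `1, …, m`. -/
def zeroExtend {m : ℕ} (v : EuclideanSpace ℝ (Fin m)) : ℕ → ℝ
  | 0 => 0
  | k + 1 => if h : k < m then v ⟨k, h⟩ else 0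

theorem contDiff_zeroExtend {m : ℕ} (k : ℕ) :
    ContDiff ℝ 1 (fun v : EuclideanSpace ℝ (Fin m) => zeroExtend v k) := by
  cases k with
  | zero => exact contDiff_const
  | succ k =>
    by_cases h : k < m
    · simp only [zeroExtend, h, dif_pos]
      fun_prop
    · simp only [zeroExtend, h, dif_neg, not_false_eq_true]
      exact contDiff_const

/-- Global solutions of the Volterra lattice written in amplitude form. -/
theorem exists_volterra_flow (m : ℕ) (r0 : ℕ → ℝ) :
    ∃ r : ℕ → ℝ → ℝ, (∀ t, r 0 t = 0) ∧ (∀ k, m < k → ∀ t, r k t = 0) ∧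
      (∀ k, k < m → r (k + 1) 0 = r0 k) ∧
      ∀ k t, HasDerivAt (r (k + 1)) (2 * r (k + 1) t * (r k t ^ 2 - r (k + 2) t ^ 2)) t := by
  let f : EuclideanSpace ℝ (Fin m) → EuclideanSpace ℝ (Fin m) := fun v =>
    WithLp.toLp 2 fun i => 2 * v i * (zeroExtend v i ^ 2 - zeroExtend v (i + 2) ^ 2)
  have hval : ∀ (v : EuclideanSpace ℝ (Fin m)) (i : Fin m), zeroExtend v (i + 1) = v i := by
    intro v i
    simp [zeroExtend]
  have hf : ContDiff ℝ 1 f := by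
    rw [contDiff_euclidean]
    intro i
    have h1 := contDiff_zeroExtend (m := m) i
    have h2 := contDiff_zeroExtend (m := m) (i + 2)
    have h3 : ContDiff ℝ 1 (fun v : EuclideanSpace ℝ (Fin m) => v i) := by fun_prop
    exact (contDiff_const.mul h3).mul ((h1.pow 2).sub (h2.pow 2))
  have hskew : ∀ v, inner ℝ v (f v) = 0 := by
    intro v
    rw [PiLp.inner_apply]
    have h1 : ∀ i : Fin m, inner ℝ (v i) (f v i) =
        (fun j : ℕ => 2 * (zeroExtend v j ^ 2 * zeroExtend v (j + 1) ^ 2)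
          - 2 * (zeroExtend v (j + 1) ^ 2 * zeroExtend v (j + 1 + 1) ^ 2)) i := by
      intro i
      simp only [hval, f, RCLike.inner_apply, conj_trivial]
      ring
    rw [Finset.sum_congr rfl fun i _ => h1 i, Fin.sum_univ_eq_sum_range
      (fun j : ℕ => 2 * (zeroExtend v j ^ 2 * zeroExtend v (j + 1) ^ 2)
          - 2 * (zeroExtend v (j + 1) ^ 2 * zeroExtend v (j + 1 + 1) ^ 2)) m,
      Finset.sum_range_sub' (fun j => 2 * (zeroExtend v j ^ 2 * zeroExtend v (j + 1) ^ 2))]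
    simp [zeroExtend]
  obtain ⟨α, h0, hα, -⟩ := exists_global_curve_of_skew hf hskew (WithLp.toLp 2 fun i => r0 i)
  have hα' : ∀ t (i : Fin m), HasDerivAt (fun t => α t i) (f (α t) i) t := fun t i =>
    (EuclideanSpace.proj (𝕜 := ℝ) i).hasFDerivAt.comp_hasDerivAt t (hα t)
  refine ⟨fun k t => zeroExtend (α t) k, fun t => rfl, ?_, ?_, ?_⟩
  · intro k hk t
    obtain ⟨k, rfl⟩ : ∃ j, k = j + 1 := ⟨k - 1, by omega⟩
    simp [zeroExtend, show ¬ k < m by omega]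
  · intro k hk
    simp [zeroExtend, hk, h0]
  · intro k t
    by_cases h : k < m
    · have := hα' t ⟨k, h⟩
      simp only [f] at this
      convert this using 1
      · funext t; simp [zeroExtend, h]
      · simp [zeroExtend, h]
    · simp only [zeroExtend, h, dif_neg, not_false_eq_true, mul_zero, zero_mul]
      exact hasDerivAt_const _ _

/-- For every `δ` there is a Volterra orbit of unit mass starting with all but `δ` of its mass in
the first site and later carrying half of its mass in the last one. -/
theorem exists_volterra_transfer (M : ℕ) {δ : ℝ} (hδ : 0 < δ) (hδ' : δ ≤ 1 / 8) :
    ∃ (r : ℕ → ℝ → ℝ) (T : ℝ), 0 < T ∧ (∀ t, r 0 t = 0) ∧ (∀ k, M + 1 < k → ∀ t, r k t = 0) ∧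
      (∀ k t, HasDerivAt (r (k + 1)) (2 * r (k + 1) t * (r k t ^ 2 - r (k + 2) t ^ 2)) t) ∧
      (∀ t, ∑ k ∈ Finset.range (M + 1), r (k + 1) t ^ 2 = 1) ∧
      (∀ k, 1 ≤ k → r (k + 1) 0 ^ 2 ≤ δ) ∧ 1 / 2 ≤ r (M + 1) T ^ 2 := by
  set c : ℝ := δ / (M + 1) with hc
  have hc0 : 0 < c := by positivity
  have hMc : M * c ≤ δ := by
    rw [hc, mul_div_assoc', div_le_iff₀ (by positivity)]
    nlinarith
  have hcδ : c ≤ δ := by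
    rw [hc, div_le_iff₀ (by positivity)]
    nlinarith [(Nat.cast_nonneg M : (0 : ℝ) ≤ M)]
  obtain ⟨r, hr0, hrM, hinit, hr⟩ := exists_volterra_flow (M + 1)
    (fun k => if k = 0 then √(1 - M * c) else √c)
  have hrc : ∀ k, Continuous (r k) := by
    intro k
    cases k with
    | zero => rw [show r 0 = fun _ => 0 from funext hr0]; exact continuous_const
    | succ k => exact continuous_iff_continuousAt.2 fun t => (hr k t).continuousAt
  have hpos : ∀ k, k < M + 1 → ∀ t, 0 < r (k + 1) t := by
    intro k hk t
    refine pos_of_hasDerivAt_mul (q := fun t => 2 * (r k t ^ 2 - r (k + 2) t ^ 2)) ?_ ?_ ?_ t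
    · exact continuous_const.mul (((hrc _).pow 2).sub ((hrc _).pow 2))
    · intro t
      convert hr k t using 1
      ring
    · rw [hinit k hk]
      split_ifs
      · exact Real.sqrt_pos.2 (by linarith)
      · exact Real.sqrt_pos.2 hc0
  -- the masses of the sites
  set x : ℕ → ℝ → ℝ := fun k t => r k t ^ 2 with hx
  have hx0 : ∀ k t, 0 ≤ x k t := fun k t => sq_nonneg _
  have hxz : ∀ t, x 0 t = 0 := fun t => by simp [hx, hr0]
  have hxM : ∀ t, x (M + 2) t = 0 := fun t => by simp [hx, hrM (M + 2) (by omega)]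
  have hxd : ∀ k t, HasDerivAt (x (k + 1)) (4 * x (k + 1) t * (x k t - x (k + 2) t)) t := by
    intro k t
    refine ((hr k t).fun_pow 2).congr_deriv ?_
    simp only [hx]; push_cast; ring
  have hP : ∀ k t, HasDerivAt (fun t => ∑ j ∈ Finset.range k, x (j + 1) t)
      (-(4 * x k t * x (k + 1) t)) t := by
    intro k t
    induction k with
    | zero => simpa [hxz] using hasDerivAt_const t (0 : ℝ)
    | succ k ih =>
      simp only [Finset.sum_range_succ]
      refine (ih.fun_add (hxd k t)).congr_deriv ?_
      ring
  have hH : ∀ k t, HasDerivAt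
      (fun t => ∑ j ∈ Finset.range k, (x (j + 1) t ^ 2 + 2 * (x (j + 1) t * x (j + 2) t)))
      (-(8 * x k t * x (k + 1) t * (x (k + 1) t + x (k + 2) t))) t := by
    intro k t
    induction k with
    | zero => simpa [hxz] using hasDerivAt_const t (0 : ℝ)
    | succ k ih =>
      simp only [Finset.sum_range_succ]
      refine (ih.fun_add (((hxd k t).fun_pow 2).fun_add
        (((hxd k t).fun_mul (hxd (k + 1) t)).const_mul 2))).congr_deriv ?_
      push_cast; ring
  have hconst : ∀ {F : ℝ → ℝ}, (∀ t, HasDerivAt F 0 t) → ∀ t, F t = F 0 := fun hF t =>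
    is_const_of_deriv_eq_zero (fun t => (hF t).differentiableAt) (fun t => (hF t).deriv) t 0
  have hsum0 : ∑ k ∈ Finset.range (M + 1), x (k + 1) 0 = 1 := by
    rw [Finset.sum_range_succ']
    have h1 : ∀ k ∈ Finset.range M, x (k + 1 + 1) 0 = c := by
      intro k hk
      have : k + 1 < M + 1 := by simpa using hk
      simp only [hx]
      rw [hinit (k + 1) this]
      simp [Real.sq_sqrt hc0.le]
    have h2 : x (0 + 1) 0 = 1 - M * c := by
      simp only [hx]
      rw [hinit 0 (by omega)]
      simp [Real.sq_sqrt (by linarith : (0 : ℝ) ≤ 1 - M * c)]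
    rw [Finset.sum_congr rfl h1, h2]
    simp
  have hsum : ∀ t, ∑ k ∈ Finset.range (M + 1), x (k + 1) t = 1 := by
    intro t
    rw [← hsum0]
    refine hconst (F := fun t => ∑ k ∈ Finset.range (M + 1), x (k + 1) t) (fun t => ?_) t
    simpa [hxM] using hP (M + 1) t
  have hener : ∀ t, 1 - 2 * δ ≤ ∑ j ∈ Finset.range (M + 1),
      (x (j + 1) t ^ 2 + 2 * (x (j + 1) t * x (j + 2) t)) := by
    intro t
    rw [hconst (F := fun t => ∑ j ∈ Finset.range (M + 1),
      (x (j + 1) t ^ 2 + 2 * (x (j + 1) t * x (j + 2) t))) (fun t => by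
        simpa [hxM] using hH (M + 1) t) t]
    have h1 : x 1 0 ^ 2 + 2 * (x 1 0 * x 2 0) ≤ ∑ j ∈ Finset.range (M + 1),
        (x (j + 1) 0 ^ 2 + 2 * (x (j + 1) 0 * x (j + 2) 0)) :=
      Finset.single_le_sum (f := fun j => x (j + 1) 0 ^ 2 + 2 * (x (j + 1) 0 * x (j + 2) 0))
        (fun j _ => by have := hx0 (j + 1) 0; have := hx0 (j + 2) 0; positivity)
        (Finset.mem_range.2 (Nat.succ_pos M))
    have h2 : x 1 0 = 1 - M * c := by
      simp only [hx]
      rw [hinit 0 (by omega)]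
      simp [Real.sq_sqrt (by linarith : (0 : ℝ) ≤ 1 - M * c)]
    have h3 := mul_nonneg (hx0 1 0) (hx0 2 0)
    nlinarith
  -- long-time limits
  have hPlim : ∀ k, ∃ l, Tendsto (fun t => ∑ j ∈ Finset.range k, x (j + 1) t) atTop (𝓝 l) := by
    intro k
    have hanti : Antitone (fun t => ∑ j ∈ Finset.range k, x (j + 1) t) :=
      antitone_of_deriv_nonpos (fun t => (hP k t).differentiableAt) (fun t => by
        rw [(hP k t).deriv]
        have := mul_nonneg (hx0 k t) (hx0 (k + 1) t)
        nlinarith)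
    exact ⟨_, tendsto_atTop_ciInf hanti ⟨0, by
      rintro _ ⟨t, rfl⟩
      exact Finset.sum_nonneg fun j _ => hx0 _ _⟩⟩
  have hxlim : ∀ k, ∃ l, Tendsto (x (k + 1)) atTop (𝓝 l) := by
    intro k
    obtain ⟨l, hl⟩ := hPlim k
    obtain ⟨l', hl'⟩ := hPlim (k + 1)
    refine ⟨l' - l, (hl'.sub hl).congr fun t => ?_⟩
    rw [Finset.sum_range_succ]; ring
  choose y hy using hxlim
  have hy0 : ∀ k, 0 ≤ y k := fun k => ge_of_tendsto' (hy k) fun t => hx0 _ _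
  have hyM : y (M + 1) = 0 := by
    refine tendsto_nhds_unique (hy (M + 1)) ?_
    rw [show x (M + 1 + 1) = fun _ => 0 from funext hxM]
    exact tendsto_const_nhds
  have hyy : ∀ k, y k * y (k + 1) = 0 := by
    intro k
    obtain ⟨l, hl⟩ := hPlim (k + 1)
    have := eq_zero_of_tendsto_of_tendsto_deriv (hP (k + 1)) hl
      (((tendsto_const_nhds (x := (4 : ℝ))).mul (hy k)).mul (hy (k + 1))).neg
    linarith
  have hyle : ∀ k, k + 1 < M + 1 → y (k + 1) = 0 → y k ≤ y (k + 2) := by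
    intro k hk hz
    by_contra! hlt
    have h1 : ∀ᶠ t in atTop, 0 < x (k + 1) t - x (k + 3) t :=
      ((hy k).sub (hy (k + 2))).eventually_const_lt (by linarith)
    obtain ⟨t0, ht0⟩ := eventually_atTop.1 h1
    have hmono : MonotoneOn (x (k + 2)) (Ici t0) :=
      monotoneOn_of_deriv_nonneg (convex_Ici t0)
        (fun t _ => (hxd (k + 1) t).continuousAt.continuousWithinAt)
        (fun t _ => (hxd (k + 1) t).differentiableAt.differentiableWithinAt)
        (fun t ht => by
          rw [interior_Ici] at ht
          rw [(hxd (k + 1) t).deriv]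
          have := ht0 t (le_of_lt ht)
          have := hx0 (k + 2) t
          positivity)
    have h2 : x (k + 2) t0 ≤ y (k + 1) :=
      ge_of_tendsto (hy (k + 1)) (eventually_atTop.2 ⟨t0, fun t ht =>
        hmono self_mem_Ici ht ht⟩)
    have h3 : 0 < x (k + 2) t0 := pow_pos (hpos (k + 1) hk t0) 2
    linarith
  have hmax : ∀ d k, k + d = M → y k ≤ y M := by
    intro d
    induction d using Nat.strong_induction_on with
    | _ d ih =>
      intro k hk
      rcases d with _ | _ | d
      · rw [show k = M by omega]
      · rcases mul_eq_zero.1 (hyy k) with h | h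
        · rw [h]; exact hy0 M
        · have := hyle k (by omega) h
          rw [show k + 2 = M + 1 by omega, hyM] at this
          exact this.trans (hy0 M)
      · rcases mul_eq_zero.1 (hyy k) with h | h
        · rw [h]; exact hy0 M
        · exact (hyle k (by omega) h).trans (ih d (by omega) (k + 2) (by omega))
  have hysum : ∑ k ∈ Finset.range (M + 1), y k = 1 := by
    refine tendsto_nhds_unique (tendsto_finsetSum _ fun k _ => hy k) ?_
    simp only [hsum]
    exact tendsto_const_nhds
  have hyener : 1 - 2 * δ ≤ ∑ k ∈ Finset.range (M + 1), y k ^ 2 := by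
    have h1 : Tendsto (fun t => ∑ j ∈ Finset.range (M + 1),
        (x (j + 1) t ^ 2 + 2 * (x (j + 1) t * x (j + 2) t))) atTop
        (𝓝 (∑ j ∈ Finset.range (M + 1), (y j ^ 2 + 2 * (y j * y (j + 1))))) :=
      tendsto_finsetSum _ fun j _ => ((hy j).pow 2).add
        (tendsto_const_nhds.mul ((hy j).mul (hy (j + 1))))
    have h2 := ge_of_tendsto' h1 hener
    simpa [hyy] using h2
  have hyMbig : 3 / 4 ≤ y M := by
    have : ∑ k ∈ Finset.range (M + 1), y k ^ 2 ≤ ∑ k ∈ Finset.range (M + 1), y M * y k := by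
      refine Finset.sum_le_sum fun k hk => ?_
      have hk' : k < M + 1 := Finset.mem_range.1 hk
      rw [sq]
      exact mul_le_mul_of_nonneg_right (hmax (M - k) k (by omega)) (hy0 k)
    rw [← Finset.mul_sum, hysum] at this
    linarith
  have hev : ∀ᶠ t in atTop, 1 / 2 < x (M + 1) t := (hy M).eventually_const_lt (by linarith)
  obtain ⟨T, hT, hT0⟩ := (hev.and (eventually_gt_atTop 0)).exists
  refine ⟨r, T, hT0, hr0, hrM, hr, hsum, ?_, hT.le⟩
  intro k hk
  by_cases hkM : k < M + 1
  · rw [hinit k hkM, if_neg (by omega), Real.sq_sqrt hc0.le]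
    exact hcδ
  · rw [hrM (k + 1) (by omega)]
    simpa using hδ.le

end Volterra

section Galerkin

open Set

/-- The cubic nonlinearity restricted to modes in a finite set. -/
def cubicSum (S : Finset Z2) (a : Z2 → ℂ) (n : Z2) : ℂ :=
  ∑ p ∈ S ×ˢ S ×ˢ S with p.1 - p.2.1 + p.2.2 = n, cubicTerm a p

/-- The quadrilinear form `∑ a_{n₁} conj(b_{n₂}) c_{n₃} conj(d_{n₄})` over `n₁ - n₂ + n₃ = n₄`. -/
def quarticForm (S : Finset Z2) (a b c d : Z2 → ℂ) : ℂ :=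
  ∑ q ∈ S ×ˢ S ×ˢ S ×ˢ S with q.1 - q.2.1 + q.2.2.1 = q.2.2.2,
    a q.1 * (starRingEnd ℂ) (b q.2.1) * c q.2.2.1 * (starRingEnd ℂ) (d q.2.2.2)

theorem quarticForm_swap_odd (S : Finset Z2) (a b c d : Z2 → ℂ) :
    quarticForm S a b c d = quarticForm S c b a d := by
  unfold quarticForm
  refine Finset.sum_nbij' (fun q => (q.2.2.1, q.2.1, q.1, q.2.2.2))
    (fun q => (q.2.2.1, q.2.1, q.1, q.2.2.2)) ?_ ?_ ?_ ?_ ?_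
  · rintro ⟨n1, n2, n3, n4⟩ h
    simp only [Finset.mem_filter, Finset.mem_product] at h ⊢
    refine ⟨by tauto, ?_⟩
    rw [← h.2]; abel
  · rintro ⟨n1, n2, n3, n4⟩ h
    simp only [Finset.mem_filter, Finset.mem_product] at h ⊢
    refine ⟨by tauto, ?_⟩
    rw [← h.2]; abel
  · rintro ⟨n1, n2, n3, n4⟩ _; rfl
  · rintro ⟨n1, n2, n3, n4⟩ _; rfl
  · rintro ⟨n1, n2, n3, n4⟩ _; simp only; ring

theorem conj_quarticForm (S : Finset Z2) (a b c d : Z2 → ℂ) :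
    (starRingEnd ℂ) (quarticForm S a b c d) = quarticForm S b a d c := by
  unfold quarticForm
  rw [map_sum]
  refine Finset.sum_nbij' (fun q => (q.2.1, q.1, q.2.2.2, q.2.2.1))
    (fun q => (q.2.1, q.1, q.2.2.2, q.2.2.1)) ?_ ?_ ?_ ?_ ?_
  · rintro ⟨n1, n2, n3, n4⟩ h
    simp only [Finset.mem_filter, Finset.mem_product] at h ⊢
    refine ⟨by tauto, ?_⟩
    rw [← h.2]; abel
  · rintro ⟨n1, n2, n3, n4⟩ h
    simp only [Finset.mem_filter, Finset.mem_product] at h ⊢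
    refine ⟨by tauto, ?_⟩
    rw [← h.2]; abel
  · rintro ⟨n1, n2, n3, n4⟩ _; rfl
  · rintro ⟨n1, n2, n3, n4⟩ _; rfl
  · rintro ⟨n1, n2, n3, n4⟩ _
    simp only [map_mul, Complex.conj_conj]; ring

theorem quarticForm_swap_even (S : Finset Z2) (a b c d : Z2 → ℂ) :
    quarticForm S a b c d = quarticForm S a d c b := by
  rw [← conj_quarticForm S b a d c, quarticForm_swap_odd, conj_quarticForm]

theorem quarticForm_self_im (S : Finset Z2) (a : Z2 → ℂ) : (quarticForm S a a a a).im = 0 :=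
  Complex.conj_eq_iff_im.1 (conj_quarticForm S a a a a)

theorem quarticForm_eq_sum_conj_mul (S : Finset Z2) (a b : Z2 → ℂ) :
    quarticForm S a a a b = ∑ n ∈ S, (starRingEnd ℂ) (b n) * cubicSum S a n := by
  simp only [quarticForm, cubicSum, Finset.mul_sum, Finset.sum_filter, Finset.sum_product]
  symm
  rw [Finset.sum_comm]
  refine Finset.sum_congr rfl fun n1 _ => ?_
  rw [Finset.sum_comm]
  refine Finset.sum_congr rfl fun n2 _ => ?_
  rw [Finset.sum_comm]
  refine Finset.sum_congr rfl fun n3 _ => Finset.sum_congr rfl fun n4 _ => ?_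
  simp only [cubicTerm]
  split_ifs <;> ring

/-- A Hermitian sum over pairs of points in the same fibre is nonnegative. -/
theorem re_sum_fiber_nonneg {ι κ : Type*} [DecidableEq κ] (P : Finset ι) (σ : ι → κ) (f : ι → ℂ) :
    0 ≤ (∑ x ∈ P, ∑ y ∈ P, if σ x = σ y then f x * (starRingEnd ℂ) (f y) else 0).re := by
  have h : ∑ x ∈ P, ∑ y ∈ P, (if σ x = σ y then f x * (starRingEnd ℂ) (f y) else 0)
      = ∑ k ∈ P.image σ, (∑ x ∈ P with σ x = k, f x) *
          (starRingEnd ℂ) (∑ x ∈ P with σ x = k, f x) := by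
    rw [← Finset.sum_fiberwise_of_maps_to (fun x hx => Finset.mem_image_of_mem σ hx)]
    refine Finset.sum_congr rfl fun k _ => ?_
    rw [map_sum, Finset.sum_mul_sum]
    refine Finset.sum_congr rfl fun x hx => ?_
    rw [Finset.sum_filter]
    refine Finset.sum_congr rfl fun y _ => ?_
    rw [(Finset.mem_filter.1 hx).2]
    simp only [eq_comm]
  rw [h, Complex.re_sum]
  refine Finset.sum_nonneg fun k _ => ?_
  rw [Complex.mul_conj, Complex.ofReal_re]
  exact Complex.normSq_nonneg _

theorem quarticForm_self_re_nonneg (S : Finset Z2) (a : Z2 → ℂ) :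
    0 ≤ (quarticForm S a a a a).re := by
  have h := re_sum_fiber_nonneg (S ×ˢ S) (fun p : Z2 × Z2 => p.1 + p.2) (fun p => a p.1 * a p.2)
  convert h using 2
  simp only [quarticForm, Finset.sum_filter, Finset.sum_product]
  refine Finset.sum_congr rfl fun n1 _ => ?_
  rw [Finset.sum_comm]
  refine Finset.sum_congr rfl fun n3 _ => Finset.sum_congr rfl fun n2 _ =>
    Finset.sum_congr rfl fun n4 _ => ?_
  have : n1 - n2 + n3 = n4 ↔ n1 + n3 = n2 + n4 := by
    constructor <;> intro h
    · rw [← h]; abel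
    · rw [sub_add_eq_add_sub, h]; abel
  simp only [this, map_mul]
  split_ifs <;> ring

end Galerkin

section GalerkinFlow

open Set

/-- Solutions of the Galerkin truncation of the Fourier-side equation to a finite set of modes. -/
structure IsGalerkin (S : Finset Z2) (a : ℝ → Z2 → ℂ) : Prop where
  eq_zero : ∀ t n, n ∉ S → a t n = 0
  hasDerivAt : ∀ t, ∀ n ∈ S, HasDerivAt (fun τ => a τ n)
    (Complex.I * ((nsq n : ℂ) * a t n + cubicSum S (a t) n)) t

theorem exists_isGalerkin (S : Finset Z2) (a0 : Z2 → ℂ) (h0 : ∀ n, n ∉ S → a0 n = 0) :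
    ∃ a, IsGalerkin S a ∧ a 0 = a0 := by
  let ext : PiLp 2 (fun _ : S => ℂ) → Z2 → ℂ := fun v n => if h : n ∈ S then v ⟨n, h⟩ else 0
  have hext : ∀ v (i : S), ext v i = v i := fun v i => by simp [ext]
  have hextd : ∀ n, ContDiff ℝ 1 (fun v => ext v n) := by
    intro n
    by_cases h : n ∈ S
    · simp only [ext, h, dif_pos]
      exact (PiLp.proj 2 (𝕜 := ℝ) (fun _ : S => ℂ) ⟨n, h⟩).contDiff
    · simp only [ext, h, dif_neg, not_false_eq_true]
      exact contDiff_const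
  let f : PiLp 2 (fun _ : S => ℂ) → PiLp 2 (fun _ : S => ℂ) := fun v =>
    WithLp.toLp 2 fun i : S => Complex.I * ((nsq i : ℂ) * ext v i + cubicSum S (ext v) i)
  have hf : ContDiff ℝ 1 f := by
    refine (PiLp.continuousLinearEquiv 2 ℝ (fun _ : S => ℂ)).symm.contDiff.comp
      (contDiff_pi.2 fun i => ?_)
    refine contDiff_const.mul ((contDiff_const.mul (hextd i)).add ?_)
    exact ContDiff.sum fun p _ => ((hextd _).mul (Complex.conjCLE.contDiff.comp (hextd _))).mul
      (hextd _)
  have hskew : ∀ v, inner ℝ v (f v) = 0 := by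
    intro v
    have h1 : inner ℝ v (f v) = (Complex.I * (((∑ n ∈ S, nsq n * Complex.normSq (ext v n) : ℝ) : ℂ)
        + quarticForm S (ext v) (ext v) (ext v) (ext v))).re := by
      rw [PiLp.inner_apply, quarticForm_eq_sum_conj_mul]
      push_cast
      rw [← Finset.sum_add_distrib, Finset.mul_sum, Complex.re_sum,
        ← Finset.sum_coe_sort S]
      refine Finset.sum_congr rfl fun i _ => ?_
      rw [Complex.inner, ← hext v i, ← Complex.mul_conj]
      congr 1
      simp only [f]
      ring
    rw [h1, Complex.mul_re, Complex.add_im, quarticForm_self_im]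
    simp
  obtain ⟨α, hα0, hα, -⟩ := exists_global_curve_of_skew hf hskew (WithLp.toLp 2 fun i : S => a0 i)
  refine ⟨fun t => ext (α t), ⟨fun t n hn => by simp [ext, hn], fun t n hn => ?_⟩, ?_⟩
  · have := (PiLp.proj 2 (𝕜 := ℝ) (fun _ : S => ℂ) ⟨n, hn⟩).hasFDerivAt.comp_hasDerivAt t (hα t)
    simp only [ext, hn, dif_pos]
    refine HasDerivAt.congr_deriv this ?_
    simp [f, ext]
  · funext n
    by_cases h : n ∈ S
    · simp [ext, h, hα0]
    · simp [ext, h, h0 n h]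

namespace IsGalerkin

variable {S : Finset Z2} {a : ℝ → Z2 → ℂ}

theorem hasDerivAt_all (h : IsGalerkin S a) (n : Z2) (t : ℝ) :
    ∃ d : ℂ, HasDerivAt (fun τ => a τ n) d t ∧ (n ∉ S → d = 0) ∧
      (n ∈ S → d = Complex.I * ((nsq n : ℂ) * a t n + cubicSum S (a t) n)) := by
  by_cases hn : n ∈ S
  · exact ⟨_, h.hasDerivAt t n hn, fun h' => absurd hn h', fun _ => rfl⟩
  · refine ⟨0, ?_, fun _ => rfl, fun h' => absurd h' hn⟩
    simp only [h.eq_zero _ n hn]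
    exact hasDerivAt_const _ _

theorem continuous (h : IsGalerkin S a) (n : Z2) : Continuous fun t => a t n :=
  continuous_iff_continuousAt.2 fun t => by
    obtain ⟨d, hd, -⟩ := h.hasDerivAt_all n t
    exact hd.continuousAt

theorem translate (h : IsGalerkin S a) (t0 : ℝ) : IsGalerkin S (fun t => a (t0 + t)) where
  eq_zero t n hn := h.eq_zero _ n hn
  hasDerivAt t n hn := by
    simpa using (h.hasDerivAt (t0 + t) n hn).comp_const_add t0 t

theorem reverse (h : IsGalerkin S a) :
    IsGalerkin S (fun t n => (starRingEnd ℂ) (a (-t) n)) where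
  eq_zero t n hn := by simp [h.eq_zero _ n hn]
  hasDerivAt t n hn := by
    have h1 := (h.hasDerivAt (-t) n hn).scomp t (hasDerivAt_neg t)
    have h2 := Complex.conjCLE.toContinuousLinearMap.hasFDerivAt.comp_hasDerivAt t h1
    refine HasDerivAt.congr_deriv h2 ?_
    have h3 : cubicSum S (fun n => (starRingEnd ℂ) (a (-t) n)) n
        = (starRingEnd ℂ) (cubicSum S (a (-t)) n) := by
      simp only [cubicSum, map_sum, cubicTerm, map_mul]
    rw [h3]
    simp

/-- Conservation of mass and energy gives a uniform `H¹` bound. -/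
theorem sum_one_add_nsq_le (h : IsGalerkin S a) (t : ℝ) :
    ∑ n ∈ S, (1 + nsq n) * ‖a t n‖ ^ 2 ≤
      ∑ n ∈ S, (1 + nsq n) * ‖a 0 n‖ ^ 2
        + (1 / 2) * (quarticForm S (a 0) (a 0) (a 0) (a 0)).re := by
  choose d hd hd0 hdS using h.hasDerivAt_all
  have hnorm : ∀ n t, HasDerivAt (fun τ => ‖a τ n‖ ^ 2)
      (2 * ((starRingEnd ℂ) (a t n) * d n t).re) t := by
    intro n t
    have := (hd n t).norm_sq
    rwa [Complex.inner, mul_comm (d n t)] at this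
  have hconj : ∀ n t, HasDerivAt (fun τ => (starRingEnd ℂ) (a τ n)) ((starRingEnd ℂ) (d n t)) t :=
    fun n t => Complex.conjCLE.toContinuousLinearMap.hasFDerivAt.comp_hasDerivAt t (hd n t)
  have hQ : ∀ t, HasDerivAt (fun τ => quarticForm S (a τ) (a τ) (a τ) (a τ))
      (quarticForm S (fun n => d n t) (a t) (a t) (a t)
        + quarticForm S (a t) (fun n => d n t) (a t) (a t)
        + quarticForm S (a t) (a t) (fun n => d n t) (a t)
        + quarticForm S (a t) (a t) (a t) (fun n => d n t)) t := by
    intro t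
    simp only [quarticForm, ← Finset.sum_add_distrib]
    refine HasDerivAt.fun_sum fun q _ => ?_
    refine ((((hd q.1 t).fun_mul (hconj q.2.1 t)).fun_mul (hd q.2.2.1 t)).fun_mul
      (hconj q.2.2.2 t)).congr_deriv ?_
    ring
  have hQre : ∀ t, HasDerivAt (fun τ => (quarticForm S (a τ) (a τ) (a τ) (a τ)).re)
      (4 * (quarticForm S (a t) (a t) (a t) (fun n => d n t)).re) t := by
    intro t
    have h1 := Complex.reCLM.hasFDerivAt.comp_hasDerivAt t (hQ t)
    refine HasDerivAt.congr_deriv h1 ?_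
    have e1 : quarticForm S (a t) (a t) (fun n => d n t) (a t)
        = quarticForm S (fun n => d n t) (a t) (a t) (a t) := quarticForm_swap_odd ..
    have e2 : quarticForm S (a t) (fun n => d n t) (a t) (a t)
        = quarticForm S (a t) (a t) (a t) (fun n => d n t) := quarticForm_swap_even ..
    have e3 : quarticForm S (fun n => d n t) (a t) (a t) (a t)
        = (starRingEnd ℂ) (quarticForm S (a t) (a t) (a t) (fun n => d n t)) := by
      rw [conj_quarticForm, quarticForm_swap_odd]
    rw [e1, e2, e3]
    simp only [Complex.reCLM_apply, Complex.add_re, Complex.conj_re]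
    ring
  have hE : ∀ t, HasDerivAt (fun τ => ∑ n ∈ S, (1 + nsq n) * ‖a τ n‖ ^ 2
      + (1 / 2) * (quarticForm S (a τ) (a τ) (a τ) (a τ)).re) 0 t := by
    intro t
    have h1 := (HasDerivAt.fun_sum fun n (_ : n ∈ S) =>
      (hnorm n t).const_mul (1 + nsq n)).fun_add ((hQre t).const_mul (1 / 2))
    refine h1.congr_deriv ?_
    have e1 : ∀ n ∈ S, (1 + nsq n) * (2 * ((starRingEnd ℂ) (a t n) * d n t).re)
        = 2 * ((starRingEnd ℂ) (a t n) * d n t).re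
          + 2 * ((starRingEnd ℂ) (d n t) * ((nsq n : ℂ) * a t n)).re := by
      intro n _
      simp only [Complex.mul_re, Complex.conj_re, Complex.conj_im, Complex.ofReal_re,
        Complex.ofReal_im, Complex.mul_im]
      ring
    have e2 : ∑ n ∈ S, 2 * ((starRingEnd ℂ) (a t n) * d n t).re = 0 := by
      rw [← Finset.mul_sum, ← Complex.re_sum]
      have : ∑ n ∈ S, (starRingEnd ℂ) (a t n) * d n t = Complex.I *
          (((∑ n ∈ S, nsq n * Complex.normSq (a t n) : ℝ) : ℂ)
            + quarticForm S (a t) (a t) (a t) (a t)) := by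
        rw [quarticForm_eq_sum_conj_mul]
        push_cast
        rw [← Finset.sum_add_distrib, Finset.mul_sum]
        refine Finset.sum_congr rfl fun n hn => ?_
        rw [hdS n t hn, ← Complex.mul_conj]
        ring
      rw [this, Complex.mul_re, Complex.add_im, quarticForm_self_im]
      simp
    have e3 : ∑ n ∈ S, ((starRingEnd ℂ) (d n t) * ((nsq n : ℂ) * a t n)).re
        + (quarticForm S (a t) (a t) (a t) (fun n => d n t)).re = 0 := by
      rw [quarticForm_eq_sum_conj_mul, Complex.re_sum, ← Finset.sum_add_distrib]
      refine Finset.sum_eq_zero fun n hn => ?_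
      rw [← Complex.add_re, ← mul_add]
      have : (nsq n : ℂ) * a t n + cubicSum S (a t) n = -Complex.I * d n t := by
        rw [hdS n t hn, ← mul_assoc]
        simp
      rw [this, show (starRingEnd ℂ) (d n t) * (-Complex.I * d n t)
        = -Complex.I * (d n t * (starRingEnd ℂ) (d n t)) by ring, Complex.mul_conj]
      simp
    rw [Finset.sum_congr rfl e1, Finset.sum_add_distrib, e2, ← Finset.mul_sum]
    linarith
  have hc := is_const_of_deriv_eq_zero (fun t => (hE t).differentiableAt)
    (fun t => (hE t).deriv) t 0
  have := quarticForm_self_re_nonneg S (a t)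
  linarith

end IsGalerkin

end GalerkinFlow

section CubicEstimates

theorem sum_weighted_norm_fiber_le {ι κ : Type*} [DecidableEq κ] (P : Finset ι) (σ : ι → κ)
    (R : Finset κ) (c : ι → ℂ) {w : κ → ℝ} (hw : ∀ k, 0 ≤ w k) :
    ∑ k ∈ R, w k * ‖∑ p ∈ P with σ p = k, c p‖ ≤ ∑ p ∈ P, w (σ p) * ‖c p‖ := by
  calc ∑ k ∈ R, w k * ‖∑ p ∈ P with σ p = k, c p‖
      ≤ ∑ k ∈ R, ∑ p ∈ P with σ p = k, w (σ p) * ‖c p‖ := by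
        refine Finset.sum_le_sum fun k _ => ?_
        calc w k * ‖∑ p ∈ P with σ p = k, c p‖
            ≤ w k * ∑ p ∈ P with σ p = k, ‖c p‖ :=
              mul_le_mul_of_nonneg_left (norm_sum_le _ _) (hw k)
          _ = _ := by
              rw [Finset.mul_sum]
              refine Finset.sum_congr rfl fun p hp => ?_
              rw [(Finset.mem_filter.1 hp).2]
    _ ≤ _ := Finset.sum_fiberwise_le_sum_of_sum_fiber_nonneg fun k _ =>
        Finset.sum_nonneg fun p _ => mul_nonneg (hw _) (norm_nonneg _)

theorem sum_triple_mul {ι : Type*} (S : Finset ι) (f g h : ι → ℝ) :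
    ∑ p ∈ S ×ˢ S ×ˢ S, f p.1 * g p.2.1 * h p.2.2
      = (∑ n ∈ S, f n) * (∑ n ∈ S, g n) * ∑ n ∈ S, h n := by
  rw [Finset.sum_product, mul_assoc, Finset.sum_mul_sum, Finset.sum_mul_sum, Finset.sum_congr rfl]
  intro n _
  rw [Finset.sum_product]
  simp only [Finset.mul_sum]
  refine Finset.sum_congr rfl fun m _ => ?_
  refine Finset.sum_congr rfl fun k _ => ?_
  ring

theorem norm_cubicTerm (a : Z2 → ℂ) (p : Triple) :
    ‖cubicTerm a p‖ = ‖a p.1‖ * ‖a p.2.1‖ * ‖a p.2.2‖ := by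
  simp [cubicTerm]

theorem norm_cubicTerm_sub_le (a b : Z2 → ℂ) (p : Triple) :
    ‖cubicTerm a p - cubicTerm b p‖ ≤ ‖a p.1 - b p.1‖ * ‖a p.2.1‖ * ‖a p.2.2‖
      + ‖b p.1‖ * ‖a p.2.1 - b p.2.1‖ * ‖a p.2.2‖
      + ‖b p.1‖ * ‖b p.2.1‖ * ‖a p.2.2 - b p.2.2‖ := by
  have h : cubicTerm a p - cubicTerm b p
      = (a p.1 - b p.1) * (starRingEnd ℂ) (a p.2.1) * a p.2.2
        + b p.1 * (starRingEnd ℂ) (a p.2.1 - b p.2.1) * a p.2.2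
        + b p.1 * (starRingEnd ℂ) (b p.2.1) * (a p.2.2 - b p.2.2) := by
    simp only [cubicTerm, map_sub]
    ring
  rw [h]
  refine (norm_add₃_le).trans (le_of_eq ?_)
  simp only [norm_mul, RCLike.norm_conj]

/-- A weight on modes which is quasi-subadditive along the interactions `n₁ - n₂ + n₃`. -/
def IsCubicWeight (w : Z2 → ℝ) (C : ℝ) : Prop :=
  (∀ n, 0 ≤ w n) ∧ ∀ p : Triple, w (p.1 - p.2.1 + p.2.2) ≤ C * (w p.1 + w p.2.1 + w p.2.2)

theorem sum_weight_mul_norm_cubicSum_le {w : Z2 → ℝ} {C : ℝ} (hw : IsCubicWeight w C)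
    (S R : Finset Z2) (a : Z2 → ℂ) :
    ∑ n ∈ R, w n * ‖cubicSum S a n‖
      ≤ 3 * C * (∑ n ∈ S, ‖a n‖) ^ 2 * ∑ n ∈ S, w n * ‖a n‖ := by
  refine (sum_weighted_norm_fiber_le _ (fun p : Triple => p.1 - p.2.1 + p.2.2) R _ hw.1).trans ?_
  calc ∑ p ∈ S ×ˢ S ×ˢ S, w (p.1 - p.2.1 + p.2.2) * ‖cubicTerm a p‖
      ≤ ∑ p ∈ S ×ˢ S ×ˢ S, (C * ((w p.1 * ‖a p.1‖) * ‖a p.2.1‖ * ‖a p.2.2‖)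
          + C * (‖a p.1‖ * (w p.2.1 * ‖a p.2.1‖) * ‖a p.2.2‖)
          + C * (‖a p.1‖ * ‖a p.2.1‖ * (w p.2.2 * ‖a p.2.2‖))) := by
        refine Finset.sum_le_sum fun p _ => ?_
        refine (mul_le_mul_of_nonneg_right (hw.2 p) (norm_nonneg _)).trans (le_of_eq ?_)
        rw [norm_cubicTerm]
        ring
    _ = _ := by
        rw [Finset.sum_add_distrib, Finset.sum_add_distrib, ← Finset.mul_sum, ← Finset.mul_sum,
          ← Finset.mul_sum,
          sum_triple_mul S (fun n => w n * ‖a n‖) (fun n => ‖a n‖) (fun n => ‖a n‖),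
          sum_triple_mul S (fun n => ‖a n‖) (fun n => w n * ‖a n‖) (fun n => ‖a n‖),
          sum_triple_mul S (fun n => ‖a n‖) (fun n => ‖a n‖) (fun n => w n * ‖a n‖)]
        ring

theorem sum_norm_cubicSum_sub_le (S R : Finset Z2) (a b : Z2 → ℂ) {A : ℝ}
    (ha : ∑ n ∈ S, ‖a n‖ ≤ A) (hb : ∑ n ∈ S, ‖b n‖ ≤ A) :
    ∑ n ∈ R, ‖cubicSum S a n - cubicSum S b n‖ ≤ 3 * A ^ 2 * ∑ n ∈ S, ‖a n - b n‖ := by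
  have h0 : ∀ n, cubicSum S a n - cubicSum S b n =
      ∑ p ∈ S ×ˢ S ×ˢ S with p.1 - p.2.1 + p.2.2 = n, (cubicTerm a p - cubicTerm b p) := by
    intro n
    rw [cubicSum, cubicSum, Finset.sum_sub_distrib]
  have h1 := sum_weighted_norm_fiber_le (S ×ˢ S ×ˢ S) (fun p : Triple => p.1 - p.2.1 + p.2.2) R
    (fun p => cubicTerm a p - cubicTerm b p) (w := fun _ => 1) (fun _ => zero_le_one)
  simp only [one_mul] at h1
  simp only [h0]
  refine h1.trans ((Finset.sum_le_sum fun p _ => norm_cubicTerm_sub_le a b p).trans ?_)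
  rw [Finset.sum_add_distrib, Finset.sum_add_distrib,
    sum_triple_mul S (fun n => ‖a n - b n‖) (fun n => ‖a n‖) (fun n => ‖a n‖),
    sum_triple_mul S (fun n => ‖b n‖) (fun n => ‖a n - b n‖) (fun n => ‖a n‖),
    sum_triple_mul S (fun n => ‖b n‖) (fun n => ‖b n‖) (fun n => ‖a n - b n‖)]
  set D := ∑ n ∈ S, ‖a n - b n‖
  set α := ∑ n ∈ S, ‖a n‖
  set β := ∑ n ∈ S, ‖b n‖
  have hD : 0 ≤ D := Finset.sum_nonneg fun _ _ => norm_nonneg _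
  have hα : 0 ≤ α := Finset.sum_nonneg fun _ _ => norm_nonneg _
  have hβ : 0 ≤ β := Finset.sum_nonneg fun _ _ => norm_nonneg _
  have e1 : α * α ≤ A * A := mul_le_mul ha ha hα (hα.trans ha)
  have e2 : β * α ≤ A * A := mul_le_mul hb ha hα (hα.trans ha)
  have e3 : β * β ≤ A * A := mul_le_mul hb hb hβ (hα.trans ha)
  calc D * α * α + β * D * α + β * β * D = D * (α * α + β * α + β * β) := by ring
    _ ≤ D * (A * A + A * A + A * A) := mul_le_mul_of_nonneg_left (by linarith) hD
    _ = 3 * A ^ 2 * D := by ring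

theorem nsq_nonneg (n : Z2) : 0 ≤ nsq n := add_nonneg (sq_nonneg _) (sq_nonneg _)

/-- The Sobolev weight `(1 + |n|²)^{s/2}`. -/
def sobolevWeight (s : ℝ) (n : Z2) : ℝ := (1 + nsq n) ^ (s / 2)

theorem isCubicWeight_sobolevWeight {s : ℝ} (hs : 0 ≤ s) :
    IsCubicWeight (sobolevWeight s) (9 ^ (s / 2)) := by
  have hw : ∀ n, 0 ≤ sobolevWeight s n := fun n =>
    Real.rpow_nonneg (by linarith [nsq_nonneg n]) _
  refine ⟨hw, fun p => ?_⟩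
  obtain ⟨m, hm, hmw⟩ : ∃ m, 1 + nsq (p.1 - p.2.1 + p.2.2) ≤ 9 * (1 + nsq m) ∧
      sobolevWeight s m ≤ sobolevWeight s p.1 + sobolevWeight s p.2.1 + sobolevWeight s p.2.2 := by
    have h3 : nsq (p.1 - p.2.1 + p.2.2) ≤ 3 * (nsq p.1 + nsq p.2.1 + nsq p.2.2) := by
      simp only [nsq, Prod.fst_add, Prod.snd_add, Prod.fst_sub, Prod.snd_sub]
      push_cast
      nlinarith [sq_nonneg ((p.1.1 : ℝ) + p.2.1.1), sq_nonneg ((p.1.1 : ℝ) - p.2.2.1),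
        sq_nonneg ((p.2.1.1 : ℝ) + p.2.2.1), sq_nonneg ((p.1.2 : ℝ) + p.2.1.2),
        sq_nonneg ((p.1.2 : ℝ) - p.2.2.2), sq_nonneg ((p.2.1.2 : ℝ) + p.2.2.2)]
    have := hw p.1
    have := hw p.2.1
    have := hw p.2.2
    rcases le_total (nsq p.1) (nsq p.2.1) with h | h
    · rcases le_total (nsq p.2.1) (nsq p.2.2) with h' | h'
      · exact ⟨p.2.2, by linarith, by linarith⟩
      · exact ⟨p.2.1, by linarith, by linarith⟩
    · rcases le_total (nsq p.1) (nsq p.2.2) with h' | h'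
      · exact ⟨p.2.2, by linarith, by linarith⟩
      · exact ⟨p.1, by linarith, by linarith⟩
  calc sobolevWeight s (p.1 - p.2.1 + p.2.2) ≤ (9 * (1 + nsq m)) ^ (s / 2) :=
        Real.rpow_le_rpow (by linarith [nsq_nonneg (p.1 - p.2.1 + p.2.2)]) hm (by positivity)
    _ = 9 ^ (s / 2) * sobolevWeight s m :=
        Real.mul_rpow (by norm_num) (by linarith [nsq_nonneg m])
    _ ≤ _ := mul_le_mul_of_nonneg_left hmw (by positivity)

end CubicEstimates

section LatticeSum

/-- The square box of modes with both coordinates at most `N` in absolute value. -/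
def box (N : ℕ) : Finset Z2 := Finset.Icc (-(N : ℤ)) N ×ˢ Finset.Icc (-(N : ℤ)) N

theorem mem_box {N : ℕ} {n : Z2} : n ∈ box N ↔ n.1.natAbs ≤ N ∧ n.2.natAbs ≤ N := by
  simp only [box, Finset.mem_product, Finset.mem_Icc]
  omega

theorem box_mono {K L : ℕ} (h : K ≤ L) : box K ⊆ box L := fun n hn => by
  rw [mem_box] at hn ⊢
  omega

theorem sq_lt_nsq_of_notMem_box {N : ℕ} {n : Z2} (h : n ∉ box N) : (N : ℝ) ^ 2 ≤ nsq n := by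
  rw [mem_box, not_and_or] at h
  have key : ∀ z : ℤ, ¬ z.natAbs ≤ N → (N : ℝ) ^ 2 ≤ (z : ℝ) ^ 2 := by
    intro z hz
    have : (N : ℝ) ≤ (z.natAbs : ℝ) := by exact_mod_cast (not_le.1 hz).le
    rw [Nat.cast_natAbs, Int.cast_abs] at this
    rw [← sq_abs (z : ℝ)]
    gcongr
  unfold nsq
  rcases h with h | h
  · linarith [key _ h, sq_nonneg (n.2 : ℝ)]
  · linarith [key _ h, sq_nonneg (n.1 : ℝ)]

theorem sum_Icc_natAbs_le (N : ℕ) {f : ℕ → ℝ} (hf : ∀ k, 0 ≤ f k) :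
    ∑ x ∈ Finset.Icc (-(N : ℤ)) N, f x.natAbs ≤ 2 * ∑ k ∈ Finset.range (N + 1), f k := by
  have hsub : Finset.Icc (-(N : ℤ)) N ⊆
      (Finset.range (N + 1)).image (fun k : ℕ => (k : ℤ)) ∪
        (Finset.range (N + 1)).image (fun k : ℕ => -(k : ℤ)) := by
    intro x hx
    rw [Finset.mem_Icc] at hx
    simp only [Finset.mem_union, Finset.mem_image, Finset.mem_range]
    rcases le_total 0 x with h | h
    · exact Or.inl ⟨x.natAbs, by omega, by omega⟩
    · exact Or.inr ⟨x.natAbs, by omega, by omega⟩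
  have hnn : ∀ A : Finset ℤ, 0 ≤ ∑ x ∈ A, f x.natAbs := fun A => Finset.sum_nonneg fun _ _ => hf _
  refine (Finset.sum_le_sum_of_subset_of_nonneg hsub fun _ _ _ => hf _).trans ?_
  have h1 := Finset.sum_union_inter (s₁ := (Finset.range (N + 1)).image (fun k : ℕ => (k : ℤ)))
    (s₂ := (Finset.range (N + 1)).image (fun k : ℕ => -(k : ℤ))) (f := fun x => f x.natAbs)
  have h2 : ∑ x ∈ (Finset.range (N + 1)).image (fun k : ℕ => (k : ℤ)), f x.natAbs
      = ∑ k ∈ Finset.range (N + 1), f k := by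
    rw [Finset.sum_image (fun a _ b _ h => by simpa using h)]
    simp
  have h3 : ∑ x ∈ (Finset.range (N + 1)).image (fun k : ℕ => -(k : ℤ)), f x.natAbs
      = ∑ k ∈ Finset.range (N + 1), f k := by
    rw [Finset.sum_image (fun a _ b _ h => by simpa using h)]
    simp
  have h4 := hnn ((Finset.range (N + 1)).image (fun k : ℕ => (k : ℤ)) ∩
    (Finset.range (N + 1)).image (fun k : ℕ => -(k : ℤ)))
  linarith

theorem sum_range_inv_sq_le (k N : ℕ) :
    ∑ y ∈ Finset.range N, 1 / (1 + (k : ℝ) + y) ^ 2 ≤ 2 / (1 + (k : ℝ)) := by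
  have h : ∑ y ∈ Finset.range N, 1 / (1 + (k : ℝ) + y) ^ 2
      ≤ 2 / (1 + (k : ℝ)) - 2 / (1 + (k : ℝ) + N) := by
    induction N with
    | zero => simp
    | succ N ih =>
      rw [Finset.sum_range_succ]
      have h1 : 1 / (1 + (k : ℝ) + N) ^ 2 ≤ 2 / (1 + k + N) - 2 / (1 + k + (N + 1 : ℕ)) := by
        have hm : (1 : ℝ) ≤ 1 + k + N := by
          linarith [(Nat.cast_nonneg k : (0 : ℝ) ≤ k), (Nat.cast_nonneg N : (0 : ℝ) ≤ N)]
        push_cast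
        rw [← add_assoc]
        set m := 1 + (k : ℝ) + N
        rw [div_sub_div _ _ (by positivity) (by positivity),
          div_le_div_iff₀ (by positivity) (by positivity)]
        nlinarith
      linarith
  have : (0 : ℝ) ≤ 2 / (1 + k + N) := by positivity
  linarith

/-- Logarithmic growth of the sum of `1 / (1 + |n|²)` over boxes. -/
theorem sum_box_inv_le (N : ℕ) :
    ∑ n ∈ box N, 1 / (1 + nsq n) ≤ 24 * (1 + Real.log (N + 1)) := by
  calc ∑ n ∈ box N, 1 / (1 + nsq n)
      ≤ ∑ n ∈ box N, 3 * (1 / (1 + (n.1.natAbs : ℝ) + n.2.natAbs) ^ 2) := by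
        refine Finset.sum_le_sum fun n _ => ?_
        have hz : ∀ z : ℤ, ((z : ℝ)) ^ 2 = (z.natAbs : ℝ) ^ 2 := by
          intro z
          rw [Nat.cast_natAbs, Int.cast_abs, sq_abs]
        rw [nsq, hz, hz, mul_one_div, div_le_div_iff₀ (by positivity) (by positivity)]
        set x := (n.1.natAbs : ℝ)
        set y := (n.2.natAbs : ℝ)
        nlinarith [sq_nonneg (x - y), sq_nonneg (x - 1), sq_nonneg (y - 1)]
    _ = ∑ x ∈ Finset.Icc (-(N : ℤ)) N, ∑ y ∈ Finset.Icc (-(N : ℤ)) N,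
          3 * (1 / (1 + (x.natAbs : ℝ) + y.natAbs) ^ 2) := by
        rw [box, Finset.sum_product]
    _ ≤ ∑ x ∈ Finset.Icc (-(N : ℤ)) N, 12 * (1 / (1 + (x.natAbs : ℝ))) := by
        refine Finset.sum_le_sum fun x _ => ?_
        rw [← Finset.mul_sum]
        have h1 := sum_Icc_natAbs_le N (f := fun k => 1 / (1 + (x.natAbs : ℝ) + k) ^ 2)
          (fun k => by positivity)
        have h2 := sum_range_inv_sq_le x.natAbs (N + 1)
        have h3 : 2 / (1 + (x.natAbs : ℝ)) = 2 * (1 / (1 + (x.natAbs : ℝ))) := by ring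
        linarith
    _ ≤ 24 * ∑ k ∈ Finset.range (N + 1), 1 / (1 + (k : ℝ)) := by
        rw [← Finset.mul_sum]
        have := sum_Icc_natAbs_le N (f := fun k => 1 / (1 + (k : ℝ))) (fun k => by positivity)
        linarith
    _ ≤ _ := by
        have := harmonic_le_one_add_log (N + 1)
        rw [harmonic] at this
        push_cast at this
        simp only [one_div, add_comm (1 : ℝ)] at this ⊢
        linarith

end LatticeSum

section APriori

open Set

/-- Logarithmic interpolation of `ℓ¹` between `H¹` and the weighted `ℓ¹` norm. -/
theorem sum_norm_sq_le_log {s : ℝ} (hs : 1 ≤ s) (S : Finset Z2) (a : Z2 → ℂ) {E M : ℝ}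
    (hE : ∑ n ∈ S, (1 + nsq n) * ‖a n‖ ^ 2 ≤ E)
    (hM : ∑ n ∈ S, sobolevWeight s n * ‖a n‖ ≤ M) (hM0 : 0 ≤ M) :
    (∑ n ∈ S, ‖a n‖) ^ 2 ≤ (48 * E + 2) * (1 + Real.log (M + 3)) := by
  set N : ℕ := ⌈M⌉₊ + 1 with hN
  have hNM : M ≤ N := by
    rw [hN]; push_cast; linarith [Nat.le_ceil M]
  have hNM' : (N : ℝ) + 1 ≤ M + 3 := by
    rw [hN]; push_cast; linarith [Nat.ceil_lt_add_one hM0]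
  have hN1 : (1 : ℝ) ≤ N := by rw [hN]; push_cast; linarith [(Nat.cast_nonneg ⌈M⌉₊ : (0:ℝ) ≤ _)]
  have hE0 : 0 ≤ E := le_trans (Finset.sum_nonneg fun n _ =>
    mul_nonneg (by linarith [nsq_nonneg n]) (sq_nonneg _)) hE
  have hlog : 0 ≤ Real.log (M + 3) := Real.log_nonneg (by linarith)
  have hlow : (∑ n ∈ S with n ∈ box N, ‖a n‖) ^ 2 ≤ 24 * (1 + Real.log (M + 3)) * E := by
    have h1 := Finset.sum_sq_le_sum_mul_sum_of_sq_le_mul (S.filter (· ∈ box N))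
      (r := fun n => ‖a n‖) (f := fun n => 1 / (1 + nsq n)) (g := fun n => (1 + nsq n) * ‖a n‖ ^ 2)
      (fun n _ => by have := nsq_nonneg n; positivity)
      (fun n _ => by have := nsq_nonneg n; positivity)
      (fun n _ => le_of_eq (by have := nsq_nonneg n; field_simp))
    have h2 : ∑ n ∈ S with n ∈ box N, 1 / (1 + nsq n) ≤ 24 * (1 + Real.log (M + 3)) := by
      refine (Finset.sum_le_sum_of_subset_of_nonneg (t := box N)
        (fun n hn => (Finset.mem_filter.1 hn).2)
        (fun n _ _ => by have := nsq_nonneg n; positivity)).trans ((sum_box_inv_le N).trans ?_)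
      have := Real.log_le_log (by linarith) hNM'
      linarith
    have h3 : ∑ n ∈ S with n ∈ box N, (1 + nsq n) * ‖a n‖ ^ 2 ≤ E :=
      (Finset.sum_le_sum_of_subset_of_nonneg (Finset.filter_subset _ _)
        (fun n _ _ => by have := nsq_nonneg n; positivity)).trans hE
    exact h1.trans (mul_le_mul h2 h3 (Finset.sum_nonneg fun n _ => by
      have := nsq_nonneg n; positivity) (by positivity))
  have hhigh : ∑ n ∈ S with n ∉ box N, ‖a n‖ ≤ 1 := by
    have h1 : N * ∑ n ∈ S with n ∉ box N, ‖a n‖ ≤ N := by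
      refine le_trans ?_ hNM
      refine le_trans ?_ hM
      rw [Finset.mul_sum]
      refine le_trans (Finset.sum_le_sum (g := fun n => sobolevWeight s n * ‖a n‖)
        fun n hn => ?_) (Finset.sum_le_sum_of_subset_of_nonneg (Finset.filter_subset _ _)
        (fun n _ _ => mul_nonneg ((isCubicWeight_sobolevWeight (by linarith)).1 n)
          (norm_nonneg _)))
      refine mul_le_mul_of_nonneg_right ?_ (norm_nonneg _)
      have h2 := sq_lt_nsq_of_notMem_box (Finset.mem_filter.1 hn).2
      calc (N : ℝ) = ((N : ℝ) ^ (2 : ℝ)) ^ ((1 : ℝ) / 2) := by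
            rw [← Real.rpow_mul (by positivity)]; norm_num
        _ ≤ ((N : ℝ) ^ (2 : ℝ)) ^ (s / 2) := by
            refine Real.rpow_le_rpow_of_exponent_le ?_ (by linarith)
            exact Real.one_le_rpow hN1 (by norm_num)
        _ ≤ (1 + nsq n) ^ (s / 2) := by
            refine Real.rpow_le_rpow (by positivity) ?_ (by linarith)
            rw [Real.rpow_two]; linarith
    by_contra! hcon
    nlinarith
  rw [← Finset.sum_filter_add_sum_filter_not S (· ∈ box N)]
  set y := ∑ n ∈ S with n ∈ box N, ‖a n‖
  set z := ∑ n ∈ S with n ∉ box N, ‖a n‖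
  have hz : 0 ≤ z := Finset.sum_nonneg fun _ _ => norm_nonneg _
  nlinarith [sq_nonneg (y - z)]

namespace IsGalerkin

variable {S : Finset Z2} {a : ℝ → Z2 → ℂ}

theorem hasDerivAt_rotate (h : IsGalerkin S a) {n : Z2} (hn : n ∈ S) (t : ℝ) :
    HasDerivAt (fun τ : ℝ => Complex.exp (-(nsq n * τ : ℝ) * Complex.I) * a τ n)
      (Complex.exp (-(nsq n * t : ℝ) * Complex.I) * (Complex.I * cubicSum S (a t) n)) t := by
  have h1 : HasDerivAt (fun τ : ℝ => (-(nsq n * τ : ℝ) * Complex.I : ℂ))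
      (-(nsq n : ℂ) * Complex.I) t := by
    have := ((hasDerivAt_id t).const_mul (nsq n)).ofReal_comp.fun_neg.mul_const Complex.I
    simpa using this
  refine (h1.cexp.fun_mul (h.hasDerivAt t n hn)).congr_deriv ?_
  ring

theorem norm_rotate (x : ℝ) (z : ℂ) : ‖Complex.exp (-(x : ℝ) * Complex.I) * z‖ = ‖z‖ := by
  rw [norm_mul, ← Complex.ofReal_neg, Complex.norm_exp_ofReal_mul_I, one_mul]

theorem sum_weight_le_exp {w : Z2 → ℝ} {C : ℝ} (hw : IsCubicWeight w C) (hC : 0 ≤ C)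
    (h : IsGalerkin S a) {Q T : ℝ} (hQ : ∀ t ∈ Icc 0 T, (∑ n ∈ S, ‖a t n‖) ^ 2 ≤ Q)
    {t : ℝ} (ht : t ∈ Icc 0 T) :
    ∑ n ∈ S, w n * ‖a t n‖ ≤ (∑ n ∈ S, w n * ‖a 0 n‖) * Real.exp (3 * C * Q * t) := by
  have hQ0 : 0 ≤ Q := (sq_nonneg _).trans (hQ t ht)
  have := sum_weighted_norm_le_of_deriv S (w := w) (fun n _ => hw.1 n) (δ := ∑ n ∈ S, w n * ‖a 0 n‖)
    (K := 3 * C * Q) (ε := 0) (T := T) (by positivity) le_rfl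
    (fun n hn t => h.hasDerivAt_rotate hn t)
    (fun t ht => by
      simp only [norm_rotate]
      simp only [norm_mul, Complex.norm_I, one_mul, add_zero]
      refine (sum_weight_mul_norm_cubicSum_le hw S S (a t)).trans ?_
      refine mul_le_mul_of_nonneg_right ?_ (Finset.sum_nonneg fun n _ =>
        mul_nonneg (hw.1 n) (norm_nonneg _))
      exact mul_le_mul_of_nonneg_left (hQ t ⟨ht.1, ht.2.le⟩) (by positivity))
    (by simp only [norm_rotate]; exact le_rfl) ht
  simpa only [norm_rotate, zero_mul, add_zero] using this

theorem continuous_sum_weight (h : IsGalerkin S a) (w : Z2 → ℝ) :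
    Continuous fun t => ∑ n ∈ S, w n * ‖a t n‖ :=
  continuous_finsetSum _ fun n _ => continuous_const.mul (h.continuous n).norm

/-- The weighted norm is controlled on a time step depending only on the `H¹` bound. -/
theorem sum_weight_le_short {s : ℝ} (hs : 1 ≤ s) {E : ℝ} (hE0 : 0 ≤ E) (h : IsGalerkin S a)
    (hE : ∀ t, ∑ n ∈ S, (1 + nsq n) * ‖a t n‖ ^ 2 ≤ E) {t : ℝ}
    (ht : t ∈ Icc 0 (1 / (6 * 9 ^ (s / 2) * (48 * E + 2)))) :
    ∑ n ∈ S, sobolevWeight s n * ‖a t n‖ ≤ 3 * (∑ n ∈ S, sobolevWeight s n * ‖a 0 n‖) ^ 2 + 3 := by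
  set τ := 1 / (6 * 9 ^ (s / 2) * (48 * E + 2)) with hτ
  have hw := isCubicWeight_sobolevWeight (s := s) (by linarith)
  have hc9 : (0 : ℝ) < 9 ^ (s / 2) := by positivity
  have hX0 : ∀ t, 0 ≤ ∑ n ∈ S, sobolevWeight s n * ‖a t n‖ := fun t =>
    Finset.sum_nonneg fun n _ => mul_nonneg (hw.1 n) (norm_nonneg _)
  obtain ⟨tm, htm, hmax⟩ := isCompact_Icc.exists_isMaxOn (⟨t, ht⟩ : (Icc 0 τ).Nonempty)
    (h.continuous_sum_weight (sobolevWeight s)).continuousOn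
  set X : ℝ → ℝ := fun t => ∑ n ∈ S, sobolevWeight s n * ‖a t n‖ with hX
  have hM : ∀ u ∈ Icc 0 τ, X u ≤ X tm := fun u hu => hmax hu
  have hlog : 0 ≤ Real.log (X tm + 3) := Real.log_nonneg (by linarith [hX0 tm])
  have h1 : X tm ≤ X 0 * Real.exp (3 * 9 ^ (s / 2) *
      ((48 * E + 2) * (1 + Real.log (X tm + 3))) * tm) :=
    sum_weight_le_exp hw hc9.le h (T := τ) (fun u hu =>
      sum_norm_sq_le_log hs S (a u) (hE u) (hM u hu) (hX0 tm)) htm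
  have h2 : 3 * 9 ^ (s / 2) * ((48 * E + 2) * (1 + Real.log (X tm + 3))) * tm
      ≤ (1 + Real.log (X tm + 3)) / 2 := by
    have h3 : 3 * 9 ^ (s / 2) * (48 * E + 2) * tm ≤ 1 / 2 := by
      calc 3 * 9 ^ (s / 2) * (48 * E + 2) * tm ≤ 3 * 9 ^ (s / 2) * (48 * E + 2) * τ :=
            mul_le_mul_of_nonneg_left htm.2 (by positivity)
        _ = 1 / 2 := by rw [hτ]; field_simp; norm_num
    nlinarith
  set Z := Real.exp ((1 + Real.log (X tm + 3)) / 2) with hZ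
  have hZ2 : Z ^ 2 = Real.exp 1 * (X tm + 3) := by
    rw [hZ, ← Real.exp_nat_mul, ← Real.exp_log (show 0 < X tm + 3 by linarith [hX0 tm]),
      ← Real.exp_add]
    congr 1
    push_cast
    rw [Real.log_exp]
    ring
  have h4 : X tm ≤ X 0 * Z :=
    h1.trans (mul_le_mul_of_nonneg_left (Real.exp_le_exp.2 h2) (hX0 0))
  have he : Real.exp 1 < 3 := Real.exp_one_lt_three
  have he0 := Real.exp_pos 1
  have h5 : 2 * Real.exp 1 * (X 0 * Z) ≤ Real.exp 1 * (Real.exp 1 * X 0 ^ 2 + (X tm + 3)) := by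
    nlinarith [sq_nonneg (Real.exp 1 * X 0 - Z)]
  have h6 : 2 * (X 0 * Z) ≤ Real.exp 1 * X 0 ^ 2 + (X tm + 3) := by
    by_contra! hcon
    nlinarith
  have h7 := hM t ht
  nlinarith [sq_nonneg (X 0)]

/-- A bound for the weighted norm on `[0, T]`, uniform in the truncation. -/
theorem exists_bound_forward {s : ℝ} (hs : 1 ≤ s) {E : ℝ} (hE0 : 0 ≤ E) (X0 T : ℝ) :
    ∃ B, ∀ (S : Finset Z2) (a : ℝ → Z2 → ℂ), IsGalerkin S a →
      (∀ t, ∑ n ∈ S, (1 + nsq n) * ‖a t n‖ ^ 2 ≤ E) →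
      ∑ n ∈ S, sobolevWeight s n * ‖a 0 n‖ ≤ X0 →
      ∀ t ∈ Icc 0 T, ∑ n ∈ S, sobolevWeight s n * ‖a t n‖ ≤ B := by
  set τ := 1 / (6 * 9 ^ (s / 2) * (48 * E + 2)) with hτ
  have hτ0 : 0 < τ := by positivity
  have key : ∀ k : ℕ, ∃ B, ∀ (S : Finset Z2) (a : ℝ → Z2 → ℂ), IsGalerkin S a →
      (∀ t, ∑ n ∈ S, (1 + nsq n) * ‖a t n‖ ^ 2 ≤ E) →
      ∑ n ∈ S, sobolevWeight s n * ‖a 0 n‖ ≤ X0 →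
      ∀ t ∈ Icc 0 (k * τ), ∑ n ∈ S, sobolevWeight s n * ‖a t n‖ ≤ B := by
    intro k
    induction k with
    | zero =>
      refine ⟨X0, fun S a _ _ h0 t ht => ?_⟩
      have : t = 0 := by simpa using ht
      rw [this]; exact h0
    | succ k ih =>
      obtain ⟨B, hB⟩ := ih
      refine ⟨3 * B ^ 2 + 3 + |B|, fun S a h hE h0 t ht => ?_⟩
      rcases le_total t (k * τ) with hk | hk
      · have := hB S a h hE h0 t ⟨ht.1, hk⟩
        nlinarith [le_abs_self B, sq_nonneg B]
      · have h1 := hB S a h hE h0 (k * τ) ⟨by positivity, le_rfl⟩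
        have h2 := (h.translate (k * τ)).sum_weight_le_short hs hE0 (fun u => hE _)
          (t := t - k * τ) ⟨by linarith, by
            have := ht.2
            push_cast at this
            linarith⟩
        simp only [add_zero, add_sub_cancel] at h2
        have h3 : 0 ≤ ∑ n ∈ S, sobolevWeight s n * ‖a (k * τ) n‖ :=
          Finset.sum_nonneg fun n _ => mul_nonneg
            ((isCubicWeight_sobolevWeight (s := s) (by linarith)).1 n) (norm_nonneg _)
        nlinarith [abs_nonneg B]
  obtain ⟨B, hB⟩ := key ⌈T / τ⌉₊
  refine ⟨B, fun S a h hE h0 t ht => hB S a h hE h0 t ⟨ht.1, ht.2.trans ?_⟩⟩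
  rw [← div_le_iff₀ hτ0]
  exact Nat.le_ceil _

theorem exists_bound {s : ℝ} (hs : 1 ≤ s) {E : ℝ} (hE0 : 0 ≤ E) (X0 T : ℝ) :
    ∃ B, ∀ (S : Finset Z2) (a : ℝ → Z2 → ℂ), IsGalerkin S a →
      (∀ t, ∑ n ∈ S, (1 + nsq n) * ‖a t n‖ ^ 2 ≤ E) →
      ∑ n ∈ S, sobolevWeight s n * ‖a 0 n‖ ≤ X0 →
      ∀ t ∈ Icc (-T) T, ∑ n ∈ S, sobolevWeight s n * ‖a t n‖ ≤ B := by
  obtain ⟨B, hB⟩ := exists_bound_forward hs hE0 X0 T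
  refine ⟨B, fun S a h hE h0 t ht => ?_⟩
  rcases le_total 0 t with h' | h'
  · exact hB S a h hE h0 t ⟨h', ht.2⟩
  · have := hB S _ h.reverse (fun u => by simpa using hE (-u)) (by simpa using h0) (-t)
      ⟨by linarith, by linarith [ht.1]⟩
    simpa using this

end IsGalerkin

end APriori

section GlobalSolution

open Set Filter Topology

theorem cubicSum_eq_of_subset {S S' : Finset Z2} (hS : S ⊆ S') {a : Z2 → ℂ}
    (ha : ∀ n, n ∉ S → a n = 0) (n : Z2) : cubicSum S' a n = cubicSum S a n := by
  symm
  refine Finset.sum_subset (Finset.filter_subset_filter _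
    (Finset.product_subset_product hS (Finset.product_subset_product hS hS))) fun p hp hp' => ?_
  have h1 : ¬ (p.1 ∈ S ∧ p.2.1 ∈ S ∧ p.2.2 ∈ S) := fun h => hp'
    (Finset.mem_filter.2 ⟨by simpa [Finset.mem_product] using h, (Finset.mem_filter.1 hp).2⟩)
  by_cases e1 : p.1 ∈ S
  · by_cases e2 : p.2.1 ∈ S
    · have e3 : p.2.2 ∉ S := fun e3 => h1 ⟨e1, e2, e3⟩
      simp [cubicTerm, ha _ e3]
    · simp [cubicTerm, ha _ e2]
  · simp [cubicTerm, ha _ e1]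

theorem quarticForm_eq_of_subset {S S' : Finset Z2} (hS : S ⊆ S') {a : Z2 → ℂ}
    (ha : ∀ n, n ∉ S → a n = 0) : quarticForm S' a a a a = quarticForm S a a a a := by
  rw [quarticForm_eq_sum_conj_mul, quarticForm_eq_sum_conj_mul]
  simp only [cubicSum_eq_of_subset hS ha]
  exact (Finset.sum_subset hS fun n _ hn => by simp [ha n hn]).symm

theorem sum_norm_le_sum_sobolevWeight {s : ℝ} (hs : 0 ≤ s) (S : Finset Z2) (a : Z2 → ℂ) :
    ∑ n ∈ S, ‖a n‖ ≤ ∑ n ∈ S, sobolevWeight s n * ‖a n‖ :=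
  Finset.sum_le_sum fun n _ => le_mul_of_one_le_left (norm_nonneg _)
    (Real.one_le_rpow (by linarith [nsq_nonneg n]) (by linarith))

theorem sum_norm_cubicSum_tail_le {s : ℝ} (hs : 1 ≤ s) {K : ℕ} (hK : 1 ≤ K) (S R : Finset Z2)
    (hR : ∀ n ∈ R, n ∉ box K) (a : Z2 → ℂ) {B : ℝ}
    (hB : ∑ n ∈ S, sobolevWeight s n * ‖a n‖ ≤ B) :
    ∑ n ∈ R, ‖cubicSum S a n‖ ≤ 3 * 9 ^ (s / 2) * B ^ 3 / K := by
  have hw := isCubicWeight_sobolevWeight (s := s) (by linarith)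
  have hK1 : (1 : ℝ) ≤ K := by exact_mod_cast hK
  have hX : 0 ≤ ∑ n ∈ S, ‖a n‖ := Finset.sum_nonneg fun _ _ => norm_nonneg _
  have hXB := (sum_norm_le_sum_sobolevWeight (by linarith : 0 ≤ s) S a).trans hB
  have hB0 := hX.trans hXB
  rw [le_div_iff₀ (by linarith), mul_comm, Finset.mul_sum]
  calc ∑ n ∈ R, (K : ℝ) * ‖cubicSum S a n‖
      ≤ ∑ n ∈ R, sobolevWeight s n * ‖cubicSum S a n‖ := by
        refine Finset.sum_le_sum fun n hn => mul_le_mul_of_nonneg_right ?_ (norm_nonneg _)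
        have h2 := sq_lt_nsq_of_notMem_box (hR n hn)
        calc (K : ℝ) = ((K : ℝ) ^ (2 : ℝ)) ^ ((1 : ℝ) / 2) := by
              rw [← Real.rpow_mul (by positivity)]; norm_num
          _ ≤ ((K : ℝ) ^ (2 : ℝ)) ^ (s / 2) :=
              Real.rpow_le_rpow_of_exponent_le (Real.one_le_rpow hK1 (by norm_num)) (by linarith)
          _ ≤ (1 + nsq n) ^ (s / 2) := by
              refine Real.rpow_le_rpow (by positivity) ?_ (by linarith)
              rw [Real.rpow_two]; linarith
    _ ≤ 3 * 9 ^ (s / 2) * (∑ n ∈ S, ‖a n‖) ^ 2 * ∑ n ∈ S, sobolevWeight s n * ‖a n‖ :=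
        sum_weight_mul_norm_cubicSum_le hw S R a
    _ ≤ 3 * 9 ^ (s / 2) * B ^ 2 * B := by
        refine mul_le_mul ?_ hB ?_ (by positivity)
        · gcongr
        · exact Finset.sum_nonneg fun n _ => mul_nonneg (hw.1 n) (norm_nonneg _)
    _ = 3 * 9 ^ (s / 2) * B ^ 3 := by ring

namespace IsGalerkin

theorem sum_norm_sub_le {S S' : Finset Z2} (hS : S ⊆ S') {a b : ℝ → Z2 → ℂ} (ha : IsGalerkin S a)
    (hb : IsGalerkin S' b) (h0 : a 0 = b 0) {T B ε : ℝ} (hε : 0 ≤ ε)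
    (haB : ∀ t ∈ Icc 0 T, ∑ n ∈ S, ‖a t n‖ ≤ B) (hbB : ∀ t ∈ Icc 0 T, ∑ n ∈ S', ‖b t n‖ ≤ B)
    (htail : ∀ t ∈ Icc 0 T, ∑ n ∈ S' \ S, ‖cubicSum S (a t) n‖ ≤ ε) {t : ℝ} (ht : t ∈ Icc 0 T) :
    ∑ n ∈ S', ‖b t n - a t n‖ ≤ ε * t * Real.exp (3 * B ^ 2 * t) := by
  classical
  have hsub : ∀ t, ∑ n ∈ S', ‖a t n‖ = ∑ n ∈ S, ‖a t n‖ := fun t =>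
    (Finset.sum_subset hS fun n _ hn => by simp [ha.eq_zero t n hn]).symm
  have hd : ∀ n ∈ S', ∀ t, HasDerivAt
      (fun τ : ℝ => Complex.exp (-(nsq n * τ : ℝ) * Complex.I) * (b τ n - a τ n))
      (Complex.exp (-(nsq n * t : ℝ) * Complex.I) * (Complex.I * (cubicSum S' (b t) n
        - if n ∈ S then cubicSum S (a t) n else 0))) t := by
    intro n hn t
    have h1 := hb.hasDerivAt_rotate hn t
    by_cases hnS : n ∈ S
    · simp only [mul_sub, hnS, if_true]
      exact h1.sub (ha.hasDerivAt_rotate hnS t)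
    · simp only [ha.eq_zero _ n hnS, hnS, if_false, sub_zero]
      exact h1
  have := sum_weighted_norm_le_of_deriv S' (w := fun _ => 1) (fun _ _ => zero_le_one) (δ := 0)
    (K := 3 * B ^ 2) (ε := ε) (T := T) (by positivity) hε hd
    (fun t ht => by
      simp only [norm_rotate]
      simp only [norm_mul, Complex.norm_I, one_mul]
      have ht' : t ∈ Icc 0 T := ⟨ht.1, ht.2.le⟩
      calc ∑ n ∈ S', ‖cubicSum S' (b t) n - if n ∈ S then cubicSum S (a t) n else 0‖
          ≤ ∑ n ∈ S', (‖cubicSum S' (b t) n - cubicSum S' (a t) n‖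
              + if n ∉ S then ‖cubicSum S (a t) n‖ else 0) := by
            refine Finset.sum_le_sum fun n _ => ?_
            rw [cubicSum_eq_of_subset hS (ha.eq_zero t) n]
            by_cases hnS : n ∈ S
            · simp [hnS]
            · simp only [hnS, if_false, not_false_eq_true, if_true, sub_zero]
              simpa using norm_add_le (cubicSum S' (b t) n - cubicSum S (a t) n)
                (cubicSum S (a t) n)
        _ ≤ 3 * B ^ 2 * ∑ n ∈ S', ‖b t n - a t n‖ + ε := by
            rw [Finset.sum_add_distrib, ← Finset.sum_filter]
            refine add_le_add (sum_norm_cubicSum_sub_le S' S' (b t) (a t) (hbB t ht')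
              ((hsub t).trans_le (haB t ht'))) ?_
            rw [← Finset.sdiff_eq_filter]
            exact htail t ht')
    (by simp [h0]) ht
  simpa only [norm_rotate, one_mul, zero_add] using this

end IsGalerkin

set_option maxHeartbeats 1000000 in
theorem exists_isSolution {s : ℝ} (hs : 1 ≤ s) (a0 : Z2 → ℂ) (K0 : ℕ)
    (h0 : ∀ n, n ∉ box K0 → a0 n = 0) :
    ∃ (a : ℝ → Z2 → ℂ) (A : ℕ → ℝ → Z2 → ℂ), IsSolutionV (fun _ => 0) a ∧
      (∀ t, HsFinite s (a t)) ∧ a 0 = a0 ∧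
      (∀ k, IsGalerkin (box (K0 + k + 1)) (A k) ∧ A k 0 = a0) ∧
      ∀ t n, Tendsto (fun k => A k t n) atTop (𝓝 (a t n)) := by
  have hmono : ∀ {k l : ℕ}, k ≤ l → box (K0 + k + 1) ⊆ box (K0 + l + 1) := fun h =>
    box_mono (by omega)
  have hsub0 : ∀ k, box K0 ⊆ box (K0 + k + 1) := fun k => box_mono (by omega)
  choose A hA hA0 using fun k : ℕ => exists_isGalerkin (box (K0 + k + 1)) a0
    (fun n hn => h0 n fun h => hn (hsub0 k h))
  have hext : ∀ k (f : Z2 → ℝ), ∑ n ∈ box (K0 + k + 1), f n * ‖a0 n‖ = ∑ n ∈ box K0, f n * ‖a0 n‖ :=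
    fun k f => (Finset.sum_subset (hsub0 k) fun n _ hn => by simp [h0 n hn]).symm
  obtain ⟨E, hE0, hE⟩ : ∃ E, 0 ≤ E ∧
      ∀ k t, ∑ n ∈ box (K0 + k + 1), (1 + nsq n) * ‖A k t n‖ ^ 2 ≤ E := by
    refine ⟨∑ n ∈ box K0, (1 + nsq n) * ‖a0 n‖ ^ 2
      + (1 / 2) * (quarticForm (box K0) a0 a0 a0 a0).re, ?_, fun k t => ?_⟩
    · have h1 := quarticForm_self_re_nonneg (box K0) a0
      have h2 : 0 ≤ ∑ n ∈ box K0, (1 + nsq n) * ‖a0 n‖ ^ 2 := Finset.sum_nonneg fun n _ => by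
        have := nsq_nonneg n; positivity
      linarith
    · have h1 := (hA k).sum_one_add_nsq_le t
      have h2 : ∑ n ∈ box (K0 + k + 1), (1 + nsq n) * ‖a0 n‖ ^ 2
          = ∑ n ∈ box K0, (1 + nsq n) * ‖a0 n‖ ^ 2 :=
        (Finset.sum_subset (hsub0 k) fun n _ hn => by simp [h0 n hn]).symm
      rw [hA0 k, h2, quarticForm_eq_of_subset (hsub0 k) h0] at h1
      exact h1
  choose B hB using fun T : ℝ => IsGalerkin.exists_bound hs hE0
    (∑ n ∈ box K0, sobolevWeight s n * ‖a0 n‖) T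
  have hwB : ∀ T k, ∀ t ∈ Icc (-T) T,
      ∑ n ∈ box (K0 + k + 1), sobolevWeight s n * ‖A k t n‖ ≤ B T := fun T k t ht =>
    hB T _ _ (hA k) (hE k) (by rw [hA0 k, hext]) t ht
  have hlB : ∀ T k, ∀ t ∈ Icc (-T) T, ∑ n ∈ box (K0 + k + 1), ‖A k t n‖ ≤ B T := fun T k t ht =>
    (sum_norm_le_sum_sobolevWeight (by linarith) _ _).trans (hwB T k t ht)
  set D : ℝ → ℝ := fun T => 3 * 9 ^ (s / 2) * B T ^ 3 * T * Real.exp (3 * B T ^ 2 * T) with hD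
  have hB0 : ∀ T, 0 ≤ T → 0 ≤ B T := fun T hT =>
    (Finset.sum_nonneg fun _ _ => norm_nonneg _).trans (hlB T 0 0 ⟨by linarith, hT⟩)
  have hcauchy : ∀ T, 0 ≤ T → ∀ k l, k ≤ l → ∀ t ∈ Icc (-T) T,
      ∑ n ∈ box (K0 + l + 1), ‖A l t n - A k t n‖ ≤ D T / (k + 1) := by
    intro T hT k l hkl
    have hBT := hB0 T hT
    have hkey : ∀ (a b : ℝ → Z2 → ℂ), IsGalerkin (box (K0 + k + 1)) a →
        IsGalerkin (box (K0 + l + 1)) b → a 0 = b 0 →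
        (∀ t ∈ Icc 0 T, ∑ n ∈ box (K0 + k + 1), sobolevWeight s n * ‖a t n‖ ≤ B T) →
        (∀ t ∈ Icc 0 T, ∑ n ∈ box (K0 + l + 1), ‖b t n‖ ≤ B T) →
        ∀ t ∈ Icc 0 T, ∑ n ∈ box (K0 + l + 1), ‖b t n - a t n‖ ≤ D T / (k + 1) := by
      intro a b ha hb hab hwa hlb t ht
      refine (ha.sum_norm_sub_le (hmono hkl) hb hab (B := B T)
        (ε := 3 * 9 ^ (s / 2) * B T ^ 3 / (K0 + k + 1 : ℕ)) (by positivity)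
        (fun u hu => (sum_norm_le_sum_sobolevWeight (by linarith) _ _).trans (hwa u hu)) hlb
        (fun u hu => sum_norm_cubicSum_tail_le hs (by omega) _ _
          (fun n hn => (Finset.mem_sdiff.1 hn).2) _ (hwa u hu)) ht).trans ?_
      have h1 : 3 * 9 ^ (s / 2) * B T ^ 3 / (K0 + k + 1 : ℕ)
          ≤ 3 * 9 ^ (s / 2) * B T ^ 3 / (k + 1) := by
        refine div_le_div_of_nonneg_left (by positivity) (by positivity) ?_
        push_cast
        linarith [(Nat.cast_nonneg K0 : (0 : ℝ) ≤ _)]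
      have ht0 := ht.1
      have ht1 := ht.2
      calc _ ≤ 3 * 9 ^ (s / 2) * B T ^ 3 / (k + 1) * T * Real.exp (3 * B T ^ 2 * T) := by gcongr
        _ = D T / (k + 1) := by rw [hD]; ring
    intro t ht
    rcases le_total 0 t with h' | h'
    · exact hkey _ _ (hA k) (hA l) (by rw [hA0, hA0])
        (fun u hu => hwB T k u ⟨by linarith [hu.1], hu.2⟩)
        (fun u hu => hlB T l u ⟨by linarith [hu.1], hu.2⟩) t ⟨h', ht.2⟩
    · have := hkey _ _ (hA k).reverse (hA l).reverse (by simp [hA0])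
        (fun u hu => by simpa using hwB T k (-u) ⟨by linarith [hu.2], by linarith [hu.1]⟩)
        (fun u hu => by simpa using hlB T l (-u) ⟨by linarith [hu.2], by linarith [hu.1]⟩) (-t)
        ⟨by linarith, by linarith [ht.1]⟩
      refine le_trans (le_of_eq (Finset.sum_congr rfl fun n _ => ?_)) this
      rw [← map_sub, RCLike.norm_conj, neg_neg]
  have hDk : ∀ T, Tendsto (fun k : ℕ => D T / ((k : ℝ) + 1)) atTop (𝓝 0) := fun T =>
    tendsto_const_div_atTop_nhds_zero_nat (D T) |>.comp (tendsto_add_atTop_nat 1) |>.congr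
      fun k => by simp
  have hlim : ∀ t n, ∃ z, Tendsto (fun k => A k t n) atTop (𝓝 z) := by
    intro t n
    refine cauchySeq_tendsto_of_complete (cauchySeq_of_le_tendsto_0' (fun k : ℕ => D |t| / (k + 1))
      (fun k l hkl => ?_) (hDk _))
    have ht : t ∈ Icc (-|t|) |t| := ⟨neg_abs_le t, le_abs_self t⟩
    have h1 := hcauchy |t| (abs_nonneg t) k l hkl t ht
    rw [dist_comm, dist_eq_norm]
    by_cases hn : n ∈ box (K0 + l + 1)
    · exact (Finset.single_le_sum (f := fun n => ‖A l t n - A k t n‖)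
        (fun _ _ => norm_nonneg _) hn).trans h1
    · rw [(hA l).eq_zero t n hn, (hA k).eq_zero t n fun h => hn (hmono hkl h)]
      simpa using (Finset.sum_nonneg fun _ _ => norm_nonneg _).trans h1
  choose a ha using hlim
  have hexh : ∀ F : Finset Z2, ∀ᶠ l : ℕ in atTop, F ⊆ box (K0 + l + 1) := by
    intro F
    induction F using Finset.induction_on with
    | empty => simp
    | insert n F _ ih =>
      filter_upwards [ih, eventually_ge_atTop (n.1.natAbs + n.2.natAbs)] with l hl hn
      exact Finset.insert_subset (mem_box.2 ⟨by omega, by omega⟩) hl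
  have hdiff : ∀ T, 0 ≤ T → ∀ t ∈ Icc (-T) T, ∀ k (F : Finset Z2),
      ∑ n ∈ F, ‖A k t n - a t n‖ ≤ D T / (k + 1) := by
    intro T hT t ht k F
    refine le_of_tendsto (tendsto_finsetSum F fun n _ =>
      (tendsto_const_nhds.sub (ha t n)).norm) ?_
    filter_upwards [hexh F, eventually_ge_atTop k] with l hl hkl
    refine le_trans (Finset.sum_le_sum_of_subset_of_nonneg hl fun _ _ _ => norm_nonneg _) ?_
    simpa only [norm_sub_rev] using hcauchy T hT k l hkl t ht
  have hwa : ∀ T, ∀ t ∈ Icc (-T) T, ∀ F : Finset Z2,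
      ∑ n ∈ F, sobolevWeight s n * ‖a t n‖ ≤ B T := by
    intro T t ht F
    refine le_of_tendsto (tendsto_finsetSum F fun n _ => (ha t n).norm.const_mul _) ?_
    filter_upwards [hexh F] with l hl
    exact (Finset.sum_le_sum_of_subset_of_nonneg hl fun n _ _ => mul_nonneg
      ((isCubicWeight_sobolevWeight (by linarith)).1 n) (norm_nonneg _)).trans (hwB T l t ht)
  have hla : ∀ T, ∀ t ∈ Icc (-T) T, ∀ F : Finset Z2, ∑ n ∈ F, ‖a t n‖ ≤ B T := fun T t ht F =>
    (sum_norm_le_sum_sobolevWeight (by linarith) _ _).trans (hwa T t ht F)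
  have habs : ∀ t : ℝ, t ∈ Icc (-|t|) |t| := fun t => ⟨neg_abs_le t, le_abs_self t⟩
  have hsum : ∀ t, Summable fun n => ‖a t n‖ := fun t =>
    summable_of_sum_le (fun _ => norm_nonneg _) (hla |t| t (habs t))
  have hsum3 : ∀ t, Summable fun p : Triple => ‖cubicTerm (a t) p‖ := by
    intro t
    have h1 := (hsum t).mul_of_nonneg ((hsum t).mul_of_nonneg (hsum t) (fun _ => norm_nonneg _)
      (fun _ => norm_nonneg _)) (fun _ => norm_nonneg _) (fun _ => by positivity)
    refine h1.congr fun p => ?_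
    rw [norm_cubicTerm]
    ring
  have htriple : ∀ n t, Tendsto (fun l : ℕ => cubicSum (box (K0 + l + 1)) (a t) n) atTop
      (𝓝 (∑' p : {p : Triple // p.1 - p.2.1 + p.2.2 = n}, cubicTerm (a t) p.1)) := by
    intro n t
    have h1 : HasSum (fun p : {p : Triple // p.1 - p.2.1 + p.2.2 = n} => cubicTerm (a t) p.1)
        (∑' p : {p : Triple // p.1 - p.2.1 + p.2.2 = n}, cubicTerm (a t) p.1) :=
      ((hsum3 t).of_norm.subtype _).hasSum
    have h2 : Tendsto (fun l : ℕ => Finset.subtype (fun p : Triple => p.1 - p.2.1 + p.2.2 = n)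
        (box (K0 + l + 1) ×ˢ box (K0 + l + 1) ×ˢ box (K0 + l + 1))) atTop atTop := by
      refine tendsto_atTop_finset_of_monotone (fun k l hkl => Finset.subtype_mono
        (Finset.product_subset_product (hmono hkl) (Finset.product_subset_product (hmono hkl)
          (hmono hkl)))) fun p => ?_
      obtain ⟨l, hl⟩ := (hexh {p.1.1, p.1.2.1, p.1.2.2}).exists
      refine ⟨l, ?_⟩
      simp only [Finset.mem_subtype, Finset.mem_product]
      exact ⟨hl (by simp), hl (by simp), hl (by simp)⟩
    refine (h1.comp h2).congr fun l => ?_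
    simp only [Function.comp, cubicSum]
    exact Finset.sum_subtype_eq_sum_filter (cubicTerm (a t))
  have hcub : ∀ T, 0 ≤ T → ∀ t ∈ Icc (-T) T, ∀ n k,
      ‖cubicSum (box (K0 + k + 1)) (A k t) n
        - ∑' p : {p : Triple // p.1 - p.2.1 + p.2.2 = n}, cubicTerm (a t) p.1‖
        ≤ 3 * B T ^ 2 * (D T / (k + 1)) := by
    intro T hT t ht n k
    refine le_of_tendsto (tendsto_const_nhds.sub (htriple n t)).norm ?_
    filter_upwards [eventually_ge_atTop k] with l hkl
    rw [← cubicSum_eq_of_subset (hmono hkl) ((hA k).eq_zero t) n]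
    have h1 := sum_norm_cubicSum_sub_le (box (K0 + l + 1)) {n} (A k t) (a t) (A := B T)
      (le_trans (le_of_eq (Finset.sum_subset (hmono hkl) fun n _ hn => by
        simp [(hA k).eq_zero t n hn]).symm) (hlB T k t ht)) (hla T t ht _)
    rw [Finset.sum_singleton] at h1
    exact h1.trans (mul_le_mul_of_nonneg_left (hdiff T hT t ht k _) (by positivity))
  refine ⟨a, A, fun n t => ⟨(hsum3 t).subtype _, Complex.I * ((nsq n : ℂ) * a t n
    + ∑' p : {p : Triple // p.1 - p.2.1 + p.2.2 = n}, cubicTerm (a t) p.1), ?_, ?_⟩, fun t => ?_, ?_,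
    fun k => ⟨hA k, hA0 k⟩, ha⟩
  · set T := |t| + 1 with hT
    have hT0 : 0 ≤ T := by positivity
    refine hasDerivAt_of_tendstoUniformlyOn (l := atTop) (s := Ioo (-T) T) isOpen_Ioo
      (f := fun k τ => A k τ n) (f' := fun (k : ℕ) τ => Complex.I * ((nsq n : ℂ) * A k τ n
        + cubicSum (box (K0 + k + 1)) (A k τ) n))
      (g' := fun τ => Complex.I * ((nsq n : ℂ) * a τ n
        + ∑' p : {p : Triple // p.1 - p.2.1 + p.2.2 = n}, cubicTerm (a τ) p.1))
      ?_ ?_ (fun τ _ => ha τ n) ⟨by linarith [neg_abs_le t], by linarith [le_abs_self t]⟩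
    · have hlim0 : Tendsto (fun k : ℕ => (nsq n + 3 * B T ^ 2) * (D T / ((k : ℝ) + 1))) atTop
          (𝓝 0) := by simpa using (hDk T).const_mul (nsq n + 3 * B T ^ 2)
      rw [Metric.tendstoUniformlyOn_iff]
      intro ε hε
      filter_upwards [hlim0.eventually (gt_mem_nhds hε)] with k hk τ hτ
      refine lt_of_le_of_lt ?_ hk
      have hτ' : τ ∈ Icc (-T) T := ⟨hτ.1.le, hτ.2.le⟩
      rw [dist_comm, dist_eq_norm, ← mul_sub, norm_mul, Complex.norm_I, one_mul,
        add_sub_add_comm, ← mul_sub, add_mul]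
      refine (norm_add_le _ _).trans (add_le_add ?_ (hcub T hT0 τ hτ' n k))
      rw [norm_mul, Complex.norm_real, Real.norm_of_nonneg (nsq_nonneg n)]
      refine mul_le_mul_of_nonneg_left ?_ (nsq_nonneg n)
      simpa using hdiff T hT0 τ hτ' k {n}
    · filter_upwards [(hexh {n})] with k hk τ _
      exact (hA k).hasDerivAt τ n (hk (by simp))
  · rw [neg_mul, ← mul_assoc, Complex.I_mul_I]
    simp
  · have hw0 : ∀ n, 0 ≤ sobolevWeight s n * ‖a t n‖ := fun n => mul_nonneg
      ((isCubicWeight_sobolevWeight (by linarith)).1 n) (norm_nonneg _)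
    have h1 : Summable fun n => sobolevWeight s n * ‖a t n‖ :=
      summable_of_sum_le hw0 (hwa |t| t (habs t))
    refine Summable.of_nonneg_of_le (fun n => ?_) (fun n => ?_) (h1.mul_left (B |t|))
    · have := nsq_nonneg n; positivity
    · have h2 : sobolevWeight s n * ‖a t n‖ ≤ B |t| := by
        simpa using hwa |t| t (habs t) {n}
      calc (1 + nsq n) ^ s * ‖a t n‖ ^ 2
          = (sobolevWeight s n * ‖a t n‖) * (sobolevWeight s n * ‖a t n‖) := by
            rw [sobolevWeight, mul_mul_mul_comm, ← Real.rpow_add (by linarith [nsq_nonneg n])]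
            ring_nf
        _ ≤ B |t| * (sobolevWeight s n * ‖a t n‖) := mul_le_mul_of_nonneg_right h2 (hw0 n)
  · funext n
    refine tendsto_nhds_unique (ha 0 n) ?_
    simp [hA0]

end GlobalSolution

section Approximation

open Set

/-- The resonance function of a triple of modes. -/
def resonance (p : Triple) : ℤ :=
  (p.1.1 - p.2.1.1) * (p.2.2.1 - p.2.1.1) + (p.1.2 - p.2.1.2) * (p.2.2.2 - p.2.1.2)

/-- The resonant part of the cubic nonlinearity. -/
def resonantSum (S : Finset Z2) (a : Z2 → ℂ) (n : Z2) : ℂ :=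
  ∑ p ∈ S ×ˢ S ×ˢ S with p.1 - p.2.1 + p.2.2 = n, if resonance p = 0 then cubicTerm a p else 0

theorem nsq_add_nsq_sub (p : Triple) :
    nsq p.1 - nsq p.2.1 + nsq p.2.2 - nsq (p.1 - p.2.1 + p.2.2) = -2 * resonance p := by
  simp only [nsq, resonance, Prod.fst_add, Prod.fst_sub, Prod.snd_add, Prod.snd_sub]
  push_cast
  ring

theorem exp_mul_cubicTerm_exp (t : ℝ) (y : Z2 → ℂ) (p : Triple) :
    Complex.exp (-(nsq (p.1 - p.2.1 + p.2.2) * t : ℝ) * Complex.I)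
        * cubicTerm (fun n => Complex.exp ((nsq n * t : ℝ) * Complex.I) * y n) p
      = Complex.exp (-2 * resonance p * t * Complex.I) * cubicTerm y p := by
  have h1 : (starRingEnd ℂ) (Complex.exp ((nsq p.2.1 * t : ℝ) * Complex.I))
      = Complex.exp (-(nsq p.2.1 * t : ℝ) * Complex.I) := by
    rw [← Complex.exp_conj, map_mul, Complex.conj_I, Complex.conj_ofReal]
    ring_nf
  have h2 : Complex.exp (-2 * resonance p * t * Complex.I)
      = Complex.exp (-(nsq (p.1 - p.2.1 + p.2.2) * t : ℝ) * Complex.I)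
        * (Complex.exp ((nsq p.1 * t : ℝ) * Complex.I)
          * Complex.exp (-(nsq p.2.1 * t : ℝ) * Complex.I)
          * Complex.exp ((nsq p.2.2 * t : ℝ) * Complex.I)) := by
    rw [← Complex.exp_add, ← Complex.exp_add, ← Complex.exp_add]
    congr 1
    have h3 : (-2 * resonance p : ℂ) = ((-2 * resonance p : ℝ) : ℂ) := by push_cast; ring
    rw [h3, ← nsq_add_nsq_sub]
    push_cast
    ring
  rw [h2, cubicTerm, cubicTerm, map_mul, h1]
  ring

theorem norm_exp_resonance (p : Triple) (t : ℝ) :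
    ‖Complex.exp (-2 * resonance p * t * Complex.I)‖ = 1 := by
  have : (-2 * resonance p * t * Complex.I : ℂ) = ((-2 * resonance p * t : ℝ) : ℂ) * Complex.I := by
    push_cast; ring
  rw [this, Complex.norm_exp_ofReal_mul_I]

theorem norm_resonance_div_le {p : Triple} (hp : resonance p ≠ 0) (t : ℝ) :
    ‖Complex.exp (-2 * resonance p * t * Complex.I) / (-2 * resonance p)‖ ≤ 1 := by
  rw [norm_div, norm_exp_resonance, norm_mul, norm_neg, Complex.norm_two, Complex.norm_intCast]
  have : (1 : ℝ) ≤ |(resonance p : ℝ)| := by exact_mod_cast Int.one_le_abs hp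
  rw [div_le_one (by positivity)]
  linarith

theorem hasDerivAt_resonance_div {p : Triple} (hp : resonance p ≠ 0) (t : ℝ) :
    HasDerivAt (fun τ : ℝ => Complex.exp (-2 * resonance p * τ * Complex.I) / (-2 * resonance p))
      (Complex.I * Complex.exp (-2 * resonance p * t * Complex.I)) t := by
  have hp' : (resonance p : ℂ) ≠ 0 := by exact_mod_cast hp
  have h1 : HasDerivAt (fun τ : ℝ => (-2 * resonance p * τ * Complex.I : ℂ))
      (-2 * resonance p * Complex.I) t := by
    simpa using ((hasDerivAt_id t).ofReal_comp.const_mul (-2 * resonance p : ℂ)).mul_const Complex.I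
  refine (h1.cexp.div_const _).congr_deriv ?_
  field_simp

theorem hasDerivAt_cubicTerm {y : ℝ → Z2 → ℂ} {y' : Z2 → ℂ} {t : ℝ}
    (h : ∀ n, HasDerivAt (fun τ => y τ n) (y' n) t) (p : Triple) :
    HasDerivAt (fun τ => cubicTerm (y τ) p)
      (y' p.1 * (starRingEnd ℂ) (y t p.2.1) * y t p.2.2
        + y t p.1 * (starRingEnd ℂ) (y' p.2.1) * y t p.2.2
        + y t p.1 * (starRingEnd ℂ) (y t p.2.1) * y' p.2.2) t := by
  have hconj : HasDerivAt (fun τ => (starRingEnd ℂ) (y τ p.2.1)) ((starRingEnd ℂ) (y' p.2.1)) t :=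
    Complex.conjCLE.toContinuousLinearMap.hasFDerivAt.comp_hasDerivAt t (h p.2.1)
  refine (((h p.1).fun_mul hconj).fun_mul (h p.2.2)).congr_deriv ?_
  ring

theorem sum_norm_resonantSum_le (S R : Finset Z2) (a : Z2 → ℂ) :
    ∑ n ∈ R, ‖resonantSum S a n‖ ≤ (∑ n ∈ S, ‖a n‖) ^ 3 := by
  have h1 := sum_weighted_norm_fiber_le (S ×ˢ S ×ˢ S) (fun p : Triple => p.1 - p.2.1 + p.2.2) R
    (fun p => if resonance p = 0 then cubicTerm a p else 0) (w := fun _ => 1)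
    (fun _ => zero_le_one)
  simp only [one_mul] at h1
  refine h1.trans ?_
  calc _ ≤ ∑ p ∈ S ×ˢ S ×ˢ S, ‖a p.1‖ * ‖a p.2.1‖ * ‖a p.2.2‖ := by
        refine Finset.sum_le_sum fun p _ => ?_
        split_ifs
        · rw [norm_cubicTerm]
        · simp only [norm_zero]; positivity
    _ = _ := by
        rw [sum_triple_mul S (fun n => ‖a n‖) (fun n => ‖a n‖) (fun n => ‖a n‖)]
        ring

/-- The first normal form correction. -/
def normalFormTerm (S : Finset Z2) (y : Z2 → ℂ) (t : ℝ) (n : Z2) : ℂ :=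
  ∑ p ∈ S ×ˢ S ×ˢ S with p.1 - p.2.1 + p.2.2 = n, if resonance p = 0 then 0 else
    Complex.exp (-2 * resonance p * t * Complex.I) / (-2 * resonance p) * cubicTerm y p

theorem sum_norm_normalFormTerm_le (S R : Finset Z2) (y : Z2 → ℂ) (t : ℝ) :
    ∑ n ∈ R, ‖normalFormTerm S y t n‖ ≤ (∑ n ∈ S, ‖y n‖) ^ 3 := by
  have h1 := sum_weighted_norm_fiber_le (S ×ˢ S ×ˢ S) (fun p : Triple => p.1 - p.2.1 + p.2.2) R
    (fun p => if resonance p = 0 then 0 else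
      Complex.exp (-2 * resonance p * t * Complex.I) / (-2 * resonance p) * cubicTerm y p)
    (w := fun _ => 1) (fun _ => zero_le_one)
  simp only [one_mul] at h1
  refine h1.trans ?_
  calc _ ≤ ∑ p ∈ S ×ˢ S ×ˢ S, ‖y p.1‖ * ‖y p.2.1‖ * ‖y p.2.2‖ := by
        refine Finset.sum_le_sum fun p _ => ?_
        split_ifs with h
        · simp only [norm_zero]; positivity
        · rw [norm_mul, norm_cubicTerm]
          exact mul_le_of_le_one_left (by positivity) (norm_resonance_div_le h t)
    _ = _ := by
        rw [sum_triple_mul S (fun n => ‖y n‖) (fun n => ‖y n‖) (fun n => ‖y n‖)]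
        ring

/-- The derivative of the oscillating correction removes the nonresonant interactions. -/
theorem exists_hasDerivAt_normalFormTerm (S : Finset Z2) {y : ℝ → Z2 → ℂ} {y' : ℝ → Z2 → ℂ}
    (h : ∀ t n, HasDerivAt (fun τ => y τ n) (y' t n) t) :
    ∃ e : ℝ → Z2 → ℂ, (∀ t n, HasDerivAt (fun τ => normalFormTerm S (y τ) τ n)
        (Complex.I * (Complex.exp (-(nsq n * t : ℝ) * Complex.I)
          * cubicSum S (fun m => Complex.exp ((nsq m * t : ℝ) * Complex.I) * y t m) n
          - resonantSum S (y t) n) + e t n) t) ∧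
      ∀ t R, ∑ n ∈ R, ‖e t n‖ ≤ 3 * (∑ n ∈ S, ‖y t n‖) ^ 2 * ∑ n ∈ S, ‖y' t n‖ := by
  set g : ℝ → Triple → ℂ := fun t p => y' t p.1 * (starRingEnd ℂ) (y t p.2.1) * y t p.2.2
        + y t p.1 * (starRingEnd ℂ) (y' t p.2.1) * y t p.2.2
        + y t p.1 * (starRingEnd ℂ) (y t p.2.1) * y' t p.2.2 with hg
  set f : ℝ → Triple → ℂ := fun t p => if resonance p = 0 then 0 else
    Complex.exp (-2 * resonance p * t * Complex.I) / (-2 * resonance p) * g t p with hf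
  refine ⟨fun t n => ∑ p ∈ S ×ˢ S ×ˢ S with p.1 - p.2.1 + p.2.2 = n, f t p, fun t n => ?_,
    fun t R => ?_⟩
  · have h1 : ∀ p : Triple, HasDerivAt (fun τ : ℝ => if resonance p = 0 then (0 : ℂ) else
        Complex.exp (-2 * resonance p * τ * Complex.I) / (-2 * resonance p) * cubicTerm (y τ) p)
        (if resonance p = 0 then 0 else
          Complex.I * Complex.exp (-2 * resonance p * t * Complex.I) * cubicTerm (y t) p
          + Complex.exp (-2 * resonance p * t * Complex.I) / (-2 * resonance p) * g t p) t := by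
      intro p
      by_cases hp : resonance p = 0
      · simp only [hp, if_true]
        exact hasDerivAt_const _ _
      · simp only [hp, if_false]
        exact (hasDerivAt_resonance_div hp t).fun_mul (hasDerivAt_cubicTerm (h t) p)
    refine (HasDerivAt.fun_sum fun p _ => h1 p).congr_deriv ?_
    rw [cubicSum, resonantSum, Finset.mul_sum, ← Finset.sum_sub_distrib, Finset.mul_sum,
      ← Finset.sum_add_distrib]
    refine Finset.sum_congr rfl fun p hp => ?_
    rw [← (Finset.mem_filter.1 hp).2, exp_mul_cubicTerm_exp]
    by_cases hp : resonance p = 0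
    · simp [hp, hf]
    · simp only [hp, if_false, hf]
      ring
  · have h1 := sum_weighted_norm_fiber_le (S ×ˢ S ×ˢ S) (fun p : Triple => p.1 - p.2.1 + p.2.2) R
      (f t) (w := fun _ => 1) (fun _ => zero_le_one)
    simp only [one_mul] at h1
    refine h1.trans ?_
    calc _ ≤ ∑ p ∈ S ×ˢ S ×ˢ S, (‖y' t p.1‖ * ‖y t p.2.1‖ * ‖y t p.2.2‖
          + ‖y t p.1‖ * ‖y' t p.2.1‖ * ‖y t p.2.2‖ + ‖y t p.1‖ * ‖y t p.2.1‖ * ‖y' t p.2.2‖) := by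
          refine Finset.sum_le_sum fun p _ => ?_
          simp only [hf]
          split_ifs with hp
          · simp only [norm_zero]; positivity
          · rw [norm_mul]
            refine (mul_le_of_le_one_left (norm_nonneg _) (norm_resonance_div_le hp t)).trans ?_
            refine norm_add₃_le.trans (le_of_eq ?_)
            simp only [norm_mul, RCLike.norm_conj]
      _ = _ := by
          rw [Finset.sum_add_distrib, Finset.sum_add_distrib,
            sum_triple_mul S (fun n => ‖y' t n‖) (fun n => ‖y t n‖) (fun n => ‖y t n‖),
            sum_triple_mul S (fun n => ‖y t n‖) (fun n => ‖y' t n‖) (fun n => ‖y t n‖),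
            sum_triple_mul S (fun n => ‖y t n‖) (fun n => ‖y t n‖) (fun n => ‖y' t n‖)]
          ring

/-- Solutions of the resonant system approximate rescaled solutions of the full equation. -/
theorem exists_approximation_constant {G T : ℝ} (hG : 0 ≤ G) (hT : 0 ≤ T) :
    ∃ C, 1 ≤ C ∧ ∀ lam : ℝ, C ≤ lam → ∀ (Λ S : Finset Z2) (γ a : ℝ → Z2 → ℂ), Λ ⊆ S →
      (∀ t n, n ∉ Λ → γ t n = 0) →
      (∀ t n, HasDerivAt (fun τ => γ τ n) (Complex.I * resonantSum Λ (γ t) n) t) →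
      (∀ t ∈ Icc 0 T, ∑ n ∈ Λ, ‖γ t n‖ ≤ G) →
      IsGalerkin S a → (∀ n, a 0 n = lam⁻¹ * γ 0 n) →
      ∀ t ∈ Icc 0 (lam ^ 2 * T), ∑ n ∈ S,
        ‖Complex.exp (-(nsq n * t : ℝ) * Complex.I) * a t n - lam⁻¹ * γ (t / lam ^ 2) n‖
          ≤ C / lam ^ 3 := by
  set A : ℝ := 1 + G + G ^ 3 with hA
  set C2 : ℝ := (G ^ 3 + (3 * A ^ 2 * G ^ 3 + 3 * G ^ 5) * T) * Real.exp (3 * A ^ 2 * T) with hC2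
  have hA0 : 0 ≤ A := by positivity
  have hC20 : 0 ≤ C2 := by positivity
  refine ⟨1 + 2 * C2 + G ^ 3, by nlinarith [pow_nonneg hG 3], ?_⟩
  intro lam hlam Λ S γ a hΛS hsupp hγ hGb ha ha0
  have hlam1 : 1 ≤ lam := by nlinarith [pow_nonneg hG 3]
  have hlam0 : 0 < lam := by linarith
  set y : ℝ → Z2 → ℂ := fun t n => lam⁻¹ * γ (t / lam ^ 2) n with hy
  set y' : ℝ → Z2 → ℂ := fun t n => Complex.I * resonantSum Λ (y t) n with hy'
  have hyd : ∀ t n, HasDerivAt (fun τ => y τ n) (y' t n) t := by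
    intro t n
    have h1 := ((hγ (t / lam ^ 2) n).scomp t ((hasDerivAt_id t).div_const (lam ^ 2))).const_mul
      ((lam⁻¹ : ℝ) : ℂ)
    refine h1.congr_deriv ?_
    have h2 : resonantSum Λ (y t) n
        = ((lam⁻¹ : ℝ) : ℂ) ^ 3 * resonantSum Λ (γ (t / lam ^ 2)) n := by
      rw [resonantSum, resonantSum, Finset.mul_sum]
      refine Finset.sum_congr rfl fun p _ => ?_
      split_ifs
      · simp only [cubicTerm, hy, map_mul, Complex.conj_ofReal]
        ring
      · simp
    simp only [hy', h2, Complex.real_smul]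
    push_cast
    field_simp
  have hysupp : ∀ t n, n ∉ Λ → y t n = 0 := fun t n hn => by simp [hy, hsupp _ n hn]
  have hyΛ : ∀ t ∈ Icc 0 (lam ^ 2 * T), ∑ n ∈ Λ, ‖y t n‖ ≤ G / lam := by
    intro t ht
    have h1 := hGb (t / lam ^ 2) ⟨div_nonneg ht.1 (by positivity), by
      rw [div_le_iff₀ (by positivity), mul_comm]; exact ht.2⟩
    simp only [hy, norm_mul, Complex.norm_real, norm_inv, Real.norm_of_nonneg hlam0.le]
    rw [← Finset.mul_sum, div_eq_inv_mul G]
    exact mul_le_mul_of_nonneg_left h1 (by positivity)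
  have hy'Λ : ∀ t ∈ Icc 0 (lam ^ 2 * T), ∑ n ∈ Λ, ‖y' t n‖ ≤ (G / lam) ^ 3 := by
    intro t ht
    simp only [hy', norm_mul, Complex.norm_I, one_mul]
    exact (sum_norm_resonantSum_le Λ Λ (y t)).trans (pow_le_pow_left₀
      (Finset.sum_nonneg fun _ _ => norm_nonneg _) (hyΛ t ht) 3)
  have hyS : ∀ t, ∑ n ∈ S, ‖y t n‖ = ∑ n ∈ Λ, ‖y t n‖ := fun t =>
    (Finset.sum_subset hΛS fun n _ hn => by simp [hysupp t n hn]).symm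
  obtain ⟨e, he, hebound⟩ := exists_hasDerivAt_normalFormTerm Λ hyd
  set b : ℝ → Z2 → ℂ := fun t n => Complex.exp (-(nsq n * t : ℝ) * Complex.I) * a t n with hb
  set Y : ℝ → Z2 → ℂ := fun t n => Complex.exp ((nsq n * t : ℝ) * Complex.I) * y t n with hY
  set d : Z2 → ℝ → ℂ := fun n t => b t n - y t n - normalFormTerm Λ (y t) t n with hd
  have hYn : ∀ t n, ‖Y t n‖ = ‖y t n‖ := fun t n => by
    rw [hY, norm_mul, Complex.norm_exp_ofReal_mul_I, one_mul]
  have haY : ∀ t n, ‖a t n - Y t n‖ = ‖b t n - y t n‖ := by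
    intro t n
    rw [← IsGalerkin.norm_rotate (nsq n * t) (a t n - Y t n), mul_sub]
    congr 2
    simp only [hY]
    rw [← mul_assoc, ← Complex.exp_add, neg_mul, neg_add_cancel, Complex.exp_zero, one_mul]
  have hdd : ∀ n ∈ S, ∀ t, HasDerivAt (d n) (Complex.exp (-(nsq n * t : ℝ) * Complex.I)
      * (Complex.I * (cubicSum S (a t) n - cubicSum S (Y t) n)) - e t n) t := by
    intro n hn t
    refine (((ha.hasDerivAt_rotate hn t).sub (hyd t n)).sub (he t n)).congr_deriv ?_
    rw [← cubicSum_eq_of_subset hΛS (a := Y t) (fun n hn => by simp [hY, hysupp t n hn])]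
    simp only [hy', hY]
    ring
  have hosc : ∀ t ∈ Icc 0 (lam ^ 2 * T), ∑ n ∈ S, ‖normalFormTerm Λ (y t) t n‖ ≤ (G / lam) ^ 3 :=
    fun t ht => (sum_norm_normalFormTerm_le Λ S (y t) t).trans (pow_le_pow_left₀
      (Finset.sum_nonneg fun _ _ => norm_nonneg _) (hyΛ t ht) 3)
  have hby : ∀ t ∈ Icc 0 (lam ^ 2 * T),
      ∑ n ∈ S, ‖b t n - y t n‖ ≤ ∑ n ∈ S, ‖d n t‖ + (G / lam) ^ 3 := by
    intro t ht
    refine le_trans ?_ (add_le_add_right (hosc t ht) _)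
    rw [← Finset.sum_add_distrib]
    refine Finset.sum_le_sum fun n _ => ?_
    simpa [hd] using norm_add_le (d n t) (normalFormTerm Λ (y t) t n)
  have hlamG : (G / lam) ^ 3 ≤ G ^ 3 / lam := by
    rw [div_pow]
    exact div_le_div_of_nonneg_left (by positivity) hlam0 (le_self_pow₀ hlam1 (by norm_num))
  have h00 : (0 : ℝ) ∈ Icc 0 (lam ^ 2 * T) := ⟨le_rfl, by positivity⟩
  have hd0 : ∑ n ∈ S, ‖d n 0‖ ≤ (G / lam) ^ 3 := by
    refine le_trans (le_of_eq (Finset.sum_congr rfl fun n _ => ?_)) (hosc 0 h00)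
    simp [hd, hb, hy, ha0]
  have hcont : Continuous fun t => lam * ∑ n ∈ S, ‖d n t‖ :=
    continuous_const.mul (continuous_finsetSum _ fun n hn =>
      (continuous_iff_continuousAt.2 fun t => (hdd n hn t).continuousAt).norm)
  have hstep : ∀ t ∈ Icc 0 (lam ^ 2 * T), (∀ u ∈ Icc 0 t, lam * ∑ n ∈ S, ‖d n u‖ ≤ 1) →
      ∑ n ∈ S, ‖d n t‖ ≤ C2 / lam ^ 3 := by
    intro t ht hboot
    have h1 := sum_weighted_norm_le_of_deriv S (w := fun _ => 1) (fun _ _ => zero_le_one)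
      (u := d) (δ := (G / lam) ^ 3) (K := 3 * (A / lam) ^ 2)
      (ε := 3 * (A / lam) ^ 2 * (G / lam) ^ 3 + 3 * (G / lam) ^ 2 * (G / lam) ^ 3)
      (T := t) (by positivity) (by positivity) hdd (fun u hu => by
        have hu' : u ∈ Icc 0 t := ⟨hu.1, hu.2.le⟩
        have hu'' : u ∈ Icc 0 (lam ^ 2 * T) := ⟨hu.1, hu.2.le.trans ht.2⟩
        have hdu : ∑ n ∈ S, ‖d n u‖ ≤ 1 / lam := by
          rw [le_div_iff₀ hlam0, mul_comm]; exact hboot u hu'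
        have hbyu := hby u hu''
        have hYu : ∑ n ∈ S, ‖Y u n‖ ≤ G / lam := by
          simp only [hYn, hyS]; exact hyΛ u hu''
        have hAl : A / lam = 1 / lam + G / lam + G ^ 3 / lam := by rw [hA]; ring
        have hau : ∑ n ∈ S, ‖a u n‖ ≤ A / lam := by
          have : ∑ n ∈ S, ‖a u n‖ ≤ ∑ n ∈ S, ‖a u n - Y u n‖ + ∑ n ∈ S, ‖Y u n‖ := by
            rw [← Finset.sum_add_distrib]
            exact Finset.sum_le_sum fun n _ => by
              simpa using norm_add_le (a u n - Y u n) (Y u n)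
          simp only [haY] at this
          linarith
        have hYu' : ∑ n ∈ S, ‖Y u n‖ ≤ A / lam := by
          have : 0 ≤ 1 / lam := by positivity
          have : 0 ≤ G ^ 3 / lam := by positivity
          linarith
        have h2 := sum_norm_cubicSum_sub_le S S (a u) (Y u) hau hYu'
        simp only [haY] at h2
        have h3 : ∑ n ∈ S, ‖e u n‖ ≤ 3 * (G / lam) ^ 2 * (G / lam) ^ 3 := by
          refine (hebound u S).trans ?_
          have e1 := hyΛ u hu''
          have e2 := hy'Λ u hu''
          have e3 : 0 ≤ ∑ n ∈ Λ, ‖y u n‖ := Finset.sum_nonneg fun _ _ => norm_nonneg _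
          have e4 : 0 ≤ ∑ n ∈ Λ, ‖y' u n‖ := Finset.sum_nonneg fun _ _ => norm_nonneg _
          gcongr
        simp only [one_mul]
        calc _ ≤ ∑ n ∈ S, (‖cubicSum S (a u) n - cubicSum S (Y u) n‖ + ‖e u n‖) := by
              refine Finset.sum_le_sum fun n _ => (norm_sub_le _ _).trans (le_of_eq ?_)
              rw [IsGalerkin.norm_rotate, norm_mul, Complex.norm_I, one_mul]
          _ ≤ _ := by
              rw [Finset.sum_add_distrib]
              have h4 : 0 ≤ 3 * (A / lam) ^ 2 := by positivity
              nlinarith [mul_le_mul_of_nonneg_left hbyu h4])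
      (by simpa only [one_mul] using hd0) (t := t) ⟨ht.1, le_rfl⟩
    simp only [one_mul] at h1
    refine h1.trans ?_
    have hexp : 3 * (A / lam) ^ 2 * t ≤ 3 * A ^ 2 * T := by
      calc 3 * (A / lam) ^ 2 * t ≤ 3 * (A / lam) ^ 2 * (lam ^ 2 * T) :=
            mul_le_mul_of_nonneg_left ht.2 (by positivity)
        _ = 3 * A ^ 2 * T := by field_simp
    have ht2 := ht.2
    have ht1 := ht.1
    calc _ ≤ ((G / lam) ^ 3 + (3 * (A / lam) ^ 2 * (G / lam) ^ 3 + 3 * (G / lam) ^ 2 * (G / lam) ^ 3)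
            * (lam ^ 2 * T)) * Real.exp (3 * A ^ 2 * T) := by gcongr
      _ = C2 / lam ^ 3 := by rw [hC2]; field_simp
  have hhalf : ∀ x, 0 ≤ x → x ≤ C2 → lam * (x / lam ^ 3) ≤ 1 / 2 := by
    intro x hx0 hx
    have h1 : lam * (x / lam ^ 3) = x / lam ^ 2 := by field_simp
    rw [h1, div_le_iff₀ (by positivity)]
    nlinarith [pow_nonneg hG 3]
  intro t ht
  have hGC : G ^ 3 ≤ C2 := by
    have : 1 ≤ Real.exp (3 * A ^ 2 * T) := Real.one_le_exp (by positivity)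
    have h2 : 0 ≤ (3 * A ^ 2 * G ^ 3 + 3 * G ^ 5) * T := by positivity
    nlinarith [pow_nonneg hG 3]
  have hboot : ∀ u ∈ Icc 0 (lam ^ 2 * T), lam * ∑ n ∈ S, ‖d n u‖ ≤ 1 / 2 := fun u hu =>
    le_half_of_bootstrap hcont (T := lam ^ 2 * T)
      ((mul_le_mul_of_nonneg_left hd0 hlam0.le).trans (by
        rw [div_pow]; exact hhalf _ (by positivity) hGC))
      (fun v hv hv' => (mul_le_mul_of_nonneg_left (hstep v hv hv') hlam0.le).trans
        (hhalf _ hC20 le_rfl)) hu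
  have h1 := hstep t ht fun u hu => (hboot u ⟨hu.1, hu.2.trans ht.2⟩).trans (by norm_num)
  calc ∑ n ∈ S, ‖b t n - y t n‖ ≤ C2 / lam ^ 3 + (G / lam) ^ 3 := (hby t ht).trans (by linarith)
    _ = (C2 + G ^ 3) / lam ^ 3 := by rw [div_pow]; ring
    _ ≤ (1 + 2 * C2 + G ^ 3) / lam ^ 3 := by
        refine div_le_div_of_nonneg_right ?_ (by positivity)
        linarith

end Approximation

section PlaneGeometry

open Set Filter

/-- The Euclidean inner product of the rational plane. -/
def planeDot (u v : ℚ × ℚ) : ℚ := u.1 * v.1 + u.2 * v.2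

/-- Rational parametrization of the rotations of the plane. -/
def rotate (t : ℚ) (h : ℚ × ℚ) : ℚ × ℚ :=
  ((1 - t ^ 2) / (1 + t ^ 2) * h.1 - 2 * t / (1 + t ^ 2) * h.2,
    (1 - t ^ 2) / (1 + t ^ 2) * h.2 + 2 * t / (1 + t ^ 2) * h.1)

theorem planeDot_self_eq_zero {u : ℚ × ℚ} : planeDot u u = 0 ↔ u = 0 := by
  constructor
  · intro h
    simp only [planeDot] at h
    have h1 : u.1 = 0 := by nlinarith [sq_nonneg u.1, sq_nonneg u.2]
    have h2 : u.2 = 0 := by nlinarith [sq_nonneg u.1, sq_nonneg u.2]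
    exact Prod.ext h1 h2
  · rintro rfl
    simp [planeDot]

theorem planeDot_rotate_self (t : ℚ) (h : ℚ × ℚ) :
    planeDot (rotate t h) (rotate t h) = planeDot h h := by
  have : 1 + t ^ 2 ≠ 0 := by positivity
  simp only [planeDot, rotate]
  field_simp
  ring

theorem rotate_neg (t : ℚ) (h : ℚ × ℚ) : rotate t (-h) = -rotate t h := by
  ext <;> simp [rotate] <;> ring

theorem eventually_quadratic_ne {a b c : ℚ} (h : ¬ (a = 0 ∧ b = 0 ∧ c = 0)) :
    ∀ᶠ t : ℚ in cofinite, a * t ^ 2 + b * t + c ≠ 0 := by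
  set p : Polynomial ℚ := Polynomial.C a * Polynomial.X ^ 2 + Polynomial.C b * Polynomial.X
    + Polynomial.C c with hp
  have hp0 : p ≠ 0 := by
    intro h0
    refine h ⟨?_, ?_, ?_⟩
    · simpa [hp, Polynomial.coeff_X, Polynomial.coeff_C] using congrArg (Polynomial.coeff · 2) h0
    · simpa [hp, Polynomial.coeff_X, Polynomial.coeff_C, Polynomial.coeff_X_pow] using
        congrArg (Polynomial.coeff · 1) h0
    · simpa [hp, Polynomial.coeff_X, Polynomial.coeff_C, Polynomial.coeff_X_pow] using
        congrArg (Polynomial.coeff · 0) h0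
  refine (Polynomial.finite_setOfPred_isRoot hp0).subset fun t ht => ?_
  simp only [mem_compl_iff, mem_ofPred_eq, not_not] at ht
  simpa [hp, Polynomial.IsRoot] using ht

theorem eventually_planeDot_rotate_ne {h v : ℚ × ℚ} (hh : h ≠ 0) (hv : v ≠ 0) (c : ℚ) :
    ∀ᶠ t : ℚ in cofinite, planeDot (rotate t h) v ≠ c := by
  have h1 : ¬ (-planeDot h v - c = 0 ∧ 2 * (h.1 * v.2 - h.2 * v.1) = 0 ∧ planeDot h v - c = 0) := by
    rintro ⟨e1, e2, e3⟩
    have e4 : planeDot h v = 0 := by linarith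
    have e5 : planeDot h h * planeDot v v = 0 := by
      have : planeDot h h * planeDot v v = planeDot h v ^ 2 + (h.1 * v.2 - h.2 * v.1) ^ 2 := by
        simp only [planeDot]; ring
      rw [this, e4]
      nlinarith
    rcases mul_eq_zero.1 e5 with h' | h'
    · exact hh (planeDot_self_eq_zero.1 h')
    · exact hv (planeDot_self_eq_zero.1 h')
  filter_upwards [eventually_quadratic_ne h1] with t ht heq
  apply ht
  have : 1 + t ^ 2 ≠ 0 := by positivity
  rw [← heq]
  simp only [planeDot, rotate]
  field_simp
  ring

theorem exists_mem_Ioo_of_eventually_cofinite {p : ℚ → Prop} (hp : ∀ᶠ t in cofinite, p t) {a b : ℚ}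
    (hab : a < b) : ∃ t ∈ Ioo a b, p t := by
  obtain ⟨t, ht, ht'⟩ := ((Ioo_infinite hab).sdiff hp).nonempty
  exact ⟨t, ht, by simpa using ht'⟩

/-- A placement of the points of `P` in which the only right angles are those allowed by `Rel`. -/
def IsGenericOn {V : Type*} (Rel : V → V → V → Prop) (P : Finset V) (N : V → ℚ × ℚ) : Prop :=
  (∀ x ∈ P, ∀ y ∈ P, N x = N y → x = y) ∧
    ∀ x ∈ P, ∀ y ∈ P, ∀ z ∈ P, x ≠ y → z ≠ y → x ≠ z →
      planeDot (N x - N y) (N z - N y) = 0 → Rel x y z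

variable {V : Type*} {Rel : V → V → V → Prop} {P : Finset V} {N : V → ℚ × ℚ}

theorem IsGenericOn.eventually_child (hN : IsGenericOn Rel P N) {m h : ℚ × ℚ} (hh : h ≠ 0) :
    ∀ᶠ t : ℚ in cofinite, (∀ n ∈ P, N n ≠ m + rotate t h) ∧
      (∀ n ∈ P, ∀ n' ∈ P, n ≠ n' → planeDot (m + rotate t h - N n) (N n' - N n) ≠ 0) ∧
      (∀ n ∈ P, ∀ n' ∈ P, N n + N n' ≠ m + m →
        planeDot (N n - (m + rotate t h)) (N n' - (m + rotate t h)) ≠ 0) ∧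
      (∀ n ∈ P, planeDot (m - rotate t h - (m + rotate t h)) (N n - (m + rotate t h)) ≠ 0) := by
  simp only [Filter.eventually_and, Filter.eventually_all_finset, Filter.eventually_all]
  refine ⟨fun n hn => ?_, fun n hn n' hn' hne => ?_, fun n hn n' hn' hne => ?_, fun n hn => ?_⟩
  · filter_upwards [eventually_planeDot_rotate_ne hh (v := (1, 0)) (by simp) ((N n).1 - m.1)]
      with t ht heq
    apply ht
    rw [heq]
    simp [planeDot]
  · have hv : N n' - N n ≠ 0 := fun h => hne (hN.1 _ hn _ hn' (sub_eq_zero.1 h).symm)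
    filter_upwards [eventually_planeDot_rotate_ne hh hv (-planeDot (m - N n) (N n' - N n))]
      with t ht heq
    apply ht
    simp only [planeDot, Prod.fst_add, Prod.fst_sub, Prod.snd_add, Prod.snd_sub] at heq ⊢
    linarith
  · have hv : N n + N n' - (m + m) ≠ 0 := sub_ne_zero.2 hne
    filter_upwards [eventually_planeDot_rotate_ne hh hv
      (planeDot (N n - m) (N n' - m) + planeDot h h)] with t ht heq
    apply ht
    rw [← planeDot_rotate_self t h]
    simp only [planeDot, Prod.fst_add, Prod.fst_sub, Prod.snd_add, Prod.snd_sub] at heq ⊢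
    linarith
  · by_cases hv : N n - m = 0
    · refine Eventually.of_forall fun t heq => hh (planeDot_self_eq_zero.1 ?_)
      rw [← planeDot_rotate_self t h]
      rw [sub_eq_zero.1 hv] at heq
      simp only [planeDot, Prod.fst_add, Prod.fst_sub, Prod.snd_add, Prod.snd_sub] at heq ⊢
      linarith
    · filter_upwards [eventually_planeDot_rotate_ne hh hv (planeDot h h)] with t ht heq
      apply ht
      rw [← planeDot_rotate_self t h]
      simp only [planeDot, Prod.fst_add, Prod.fst_sub, Prod.snd_add, Prod.snd_sub] at heq ⊢
      linarith

variable [DecidableEq V]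

theorem IsGenericOn.eventually_insert (hN : IsGenericOn Rel P N) {c : V} (hc : c ∉ P)
    (q : ℚ × ℚ) :
    ∀ᶠ t : ℚ in cofinite, IsGenericOn Rel (insert c P)
      (Function.update N c (q + (t, t ^ 2))) := by
  have h1 : ∀ᶠ t : ℚ in cofinite, ∀ n ∈ P, N n ≠ q + (t, t ^ 2) := by
    rw [Filter.eventually_all_finset]
    intro n hn
    have := eventually_quadratic_ne (a := 0) (b := 1) (c := q.1 - (N n).1) (by simp)
    filter_upwards [this] with t ht heq
    apply ht
    rw [heq]
    simp
  have h2 : ∀ᶠ t : ℚ in cofinite, ∀ n ∈ P, ∀ m ∈ P, n ≠ m →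
      planeDot (q + (t, t ^ 2) - N n) (N m - N n) ≠ 0 := by
    simp only [Filter.eventually_all_finset, Filter.eventually_all]
    intro n hn m hm hnm
    have hv : N m - N n ≠ 0 := fun h => hnm (hN.1 _ hn _ hm (sub_eq_zero.1 h).symm)
    have := eventually_quadratic_ne (a := (N m - N n).2) (b := (N m - N n).1)
      (c := planeDot (q - N n) (N m - N n)) (fun h => hv (Prod.ext h.2.1 h.1))
    filter_upwards [this] with t ht heq
    apply ht
    rw [← heq]
    simp only [planeDot, Prod.fst_add, Prod.fst_sub, Prod.snd_add, Prod.snd_sub]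
    ring
  have h3 : ∀ᶠ t : ℚ in cofinite, ∀ n ∈ P, ∀ m ∈ P,
      planeDot (N n - (q + (t, t ^ 2))) (N m - (q + (t, t ^ 2))) ≠ 0 := by
    simp only [Filter.eventually_all_finset]
    intro n hn m hm
    set u := N n - q with hu
    set v := N m - q with hv
    set p : Polynomial ℚ := (Polynomial.C u.1 - Polynomial.X) * (Polynomial.C v.1 - Polynomial.X)
      + (Polynomial.C u.2 - Polynomial.X ^ 2) * (Polynomial.C v.2 - Polynomial.X ^ 2) with hp
    have hpm : p = Polynomial.X ^ 4 + (Polynomial.C (1 - u.2 - v.2) * Polynomial.X ^ 2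
        + Polynomial.C (-u.1 - v.1) * Polynomial.X + Polynomial.C (u.1 * v.1 + u.2 * v.2)) := by
      rw [hp]
      simp only [map_sub, map_neg, map_add, map_mul, map_one]
      ring
    have hp0 : p ≠ 0 := by
      intro h0
      have := congrArg (Polynomial.coeff · 4) h0
      rw [hpm] at this
      simp only [Polynomial.coeff_add, Polynomial.coeff_C_mul, Polynomial.coeff_X_pow,
        Polynomial.coeff_X, Polynomial.coeff_C, Polynomial.coeff_zero] at this
      norm_num at this
    refine (Polynomial.finite_setOfPred_isRoot hp0).subset fun t ht => ?_
    simp only [mem_compl_iff, mem_ofPred_eq, not_not] at ht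
    simp only [mem_ofPred_eq, Polynomial.IsRoot, hp, Polynomial.eval_add, Polynomial.eval_mul,
      Polynomial.eval_sub, Polynomial.eval_C, Polynomial.eval_X, Polynomial.eval_pow, hu, hv]
    rw [← ht]
    simp only [planeDot, Prod.fst_add, Prod.fst_sub, Prod.snd_add, Prod.snd_sub]
    ring
  filter_upwards [h1, h2, h3] with t e1 e2 e3
  have hne : ∀ {x}, x ∈ P → x ≠ c := fun hx h => hc (h ▸ hx)
  have hup : ∀ {x}, x ∈ P → Function.update N c (q + (t, t ^ 2)) x = N x := fun hx =>
    Function.update_of_ne (hne hx) _ _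
  refine ⟨fun x hx y hy hxy => ?_, fun x hx y hy z hz hxy hzy hxz h => ?_⟩
  · simp only [Finset.mem_insert] at hx hy
    rcases hx with rfl | hx <;> rcases hy with rfl | hy
    · rfl
    · rw [Function.update_self, hup hy] at hxy
      exact absurd hxy.symm (e1 y hy)
    · rw [Function.update_self, hup hx] at hxy
      exact absurd hxy (e1 x hx)
    · rw [hup hx, hup hy] at hxy
      exact hN.1 x hx y hy hxy
  · rw [Finset.mem_insert] at hy
    rcases hy with rfl | hy
    · replace hx := Finset.mem_of_mem_insert_of_ne hx hxy
      replace hz := Finset.mem_of_mem_insert_of_ne hz hzy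
      rw [Function.update_self, hup hx, hup hz] at h
      exact absurd h (e3 x hx z hz)
    · rw [Finset.mem_insert] at hx
      rcases hx with rfl | hx
      · replace hz := Finset.mem_of_mem_insert_of_ne hz hxz.symm
        rw [Function.update_self, hup hy, hup hz] at h
        exact absurd h (e2 y hy z hz hzy.symm)
      · rw [Finset.mem_insert] at hz
        rcases hz with rfl | hz
        · rw [Function.update_self, hup hy, hup hx] at h
          refine absurd ?_ (e2 y hy x hx hxy.symm)
          rw [← h]
          simp only [planeDot]
          ring
        · rw [hup hx, hup hy, hup hz] at h
          exact hN.2 x hx y hy z hz hxy hzy hxz h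

/-- Completing two placed points to a rectangle keeps the placement generic. -/
theorem IsGenericOn.eventually_insert_family (hN : IsGenericOn Rel P N) {a b c d : V}
    (ha : a ∈ P) (hb : b ∈ P) (hab : a ≠ b) (hc : c ∉ P) (hd : d ∉ P) (hcd : c ≠ d)
    (hno : ∀ n ∈ P, ¬ Rel a n b)
    (hrel : ∀ x y : V, (x = a ∨ x = b) → (y = c ∨ y = d) →
      Rel a y b ∧ Rel b y a ∧ Rel c x d ∧ Rel d x c)
    {m h : ℚ × ℚ} (hNa : N a = m + h) (hNb : N b = m - h) :
    ∀ᶠ t : ℚ in cofinite, IsGenericOn Rel (insert c (insert d P))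
      (Function.update (Function.update N d (m - rotate t h)) c (m + rotate t h)) := by
  have hh : h ≠ 0 := by
    rintro rfl
    exact hab (hN.1 a ha b hb (by rw [hNa, hNb]; simp))
  have hcirc : ∀ n ∈ P, n ≠ a → n ≠ b → planeDot (N n - m) (N n - m) ≠ planeDot h h := by
    intro n hn hna hnb heq
    refine hno n hn (hN.2 a ha n hn b hb hna.symm hnb.symm hab ?_)
    rw [hNa, hNb]
    simp only [planeDot, Prod.fst_add, Prod.fst_sub, Prod.snd_add, Prod.snd_sub] at heq ⊢
    linarith
  filter_upwards [hN.eventually_child (m := m) hh, hN.eventually_child (m := m) (neg_ne_zero.2 hh)]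
    with t hp hq
  rw [rotate_neg] at hq
  obtain ⟨p1, p2, p3, p4⟩ := hp
  obtain ⟨q1, q2, q3, q4⟩ := hq
  rw [← sub_eq_add_neg] at q1 q2 q3 q4
  rw [sub_neg_eq_add] at q4
  set k := rotate t h with hk
  have hkk : planeDot k k = planeDot h h := planeDot_rotate_self t h
  have hk0 : k ≠ 0 := fun h0 => hh (planeDot_self_eq_zero.1 (by rw [← hkk, h0]; simp [planeDot]))
  set N' := Function.update (Function.update N d (m - k)) c (m + k) with hN'
  have hNc : N' c = m + k := Function.update_self ..
  have hNd : N' d = m - k := by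
    rw [hN', Function.update_of_ne hcd.symm, Function.update_self]
  have hup : ∀ {x}, x ∈ P → N' x = N x := fun {x} hx => by
    rw [hN', Function.update_of_ne (ne_of_mem_of_not_mem hx hc),
      Function.update_of_ne (ne_of_mem_of_not_mem hx hd)]
  have hsym : ∀ u v, planeDot u v = planeDot v u := fun u v => by simp only [planeDot]; ring
  have hmid : ∀ x ∈ P, ∀ z ∈ P, x ≠ z → ∀ y, (y = c ∨ y = d) →
      N x + N z = m + m → planeDot (N x - m) (N x - m) = planeDot h h → Rel x y z := by
    intro x hx z hz hxz y hy hsum hcir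
    by_cases hxa : x = a
    · have : z = b := hN.1 z hz b hb (by
        rw [hNb]; rw [hxa, hNa] at hsum
        linear_combination (exp := 1) hsum)
      subst hxa this
      exact (hrel x y (Or.inl rfl) hy).1
    · by_cases hxb : x = b
      · have : z = a := hN.1 z hz a ha (by
          rw [hNa]; rw [hxb, hNb] at hsum
          linear_combination (exp := 1) hsum)
        subst hxb this
        exact (hrel z y (Or.inl rfl) hy).2.1
      · exact absurd hcir (hcirc x hx hxa hxb)
  have holdapex : ∀ y ∈ P, planeDot (m + k - N y) (m - k - N y) = 0 → y = a ∨ y = b := by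
    intro y hy h0
    by_contra! hcon
    refine hcirc y hy hcon.1 hcon.2 ?_
    rw [← hkk]
    simp only [planeDot, Prod.fst_add, Prod.fst_sub, Prod.snd_add, Prod.snd_sub] at h0 ⊢
    linarith
  have hcirsum : ∀ x z, N x + N z = m + m → ∀ u : ℚ × ℚ, planeDot u u = planeDot h h →
      planeDot (N x - (m + u)) (N z - (m + u)) = 0 →
      planeDot (N x - m) (N x - m) = planeDot h h := by
    intro x z hsum u hu h0
    have hz : N z = m + m - N x := by rw [← hsum]; simp
    rw [hz] at h0
    rw [← hu]
    simp only [planeDot, Prod.fst_add, Prod.fst_sub, Prod.snd_add, Prod.snd_sub] at h0 ⊢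
    linarith
  refine ⟨fun x hx y hy hxy => ?_, fun x hx y hy z hz hxy hzy hxz h0 => ?_⟩
  · simp only [Finset.mem_insert] at hx hy
    rcases hx with rfl | rfl | hx <;> rcases hy with rfl | rfl | hy
    · rfl
    · rw [hNc, hNd] at hxy
      refine absurd ?_ hk0
      have e1 := congrArg Prod.fst hxy
      have e2 := congrArg Prod.snd hxy
      simp only [Prod.fst_add, Prod.fst_sub, Prod.snd_add, Prod.snd_sub] at e1 e2
      exact Prod.ext (by simp; linarith) (by simp; linarith)
    · rw [hNc, hup hy] at hxy; exact absurd hxy.symm (p1 y hy)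
    · rw [hNc, hNd] at hxy
      refine absurd ?_ hk0
      have e1 := congrArg Prod.fst hxy
      have e2 := congrArg Prod.snd hxy
      simp only [Prod.fst_add, Prod.fst_sub, Prod.snd_add, Prod.snd_sub] at e1 e2
      exact Prod.ext (by simp; linarith) (by simp; linarith)
    · rfl
    · rw [hNd, hup hy] at hxy; exact absurd hxy.symm (q1 y hy)
    · rw [hNc, hup hx] at hxy; exact absurd hxy (p1 x hx)
    · rw [hNd, hup hx] at hxy; exact absurd hxy (q1 x hx)
    · rw [hup hx, hup hy] at hxy; exact hN.1 x hx y hy hxy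
  · simp only [Finset.mem_insert] at hx hy hz
    rcases hy with rfl | rfl | hy
    · rcases hx with rfl | rfl | hx
      · exact absurd rfl hxy
      · rcases hz with rfl | rfl | hz
        · exact absurd rfl hzy
        · exact absurd rfl hxz
        · rw [hNc, hNd, hup hz] at h0
          exact absurd h0 (p4 z hz)
      · rcases hz with rfl | rfl | hz
        · exact absurd rfl hzy
        · rw [hNc, hNd, hup hx, hsym] at h0
          exact absurd h0 (p4 x hx)
        · rw [hNc, hup hx, hup hz] at h0
          by_cases hsum : N x + N z = m + m
          · exact hmid x hx z hz hxz _ (Or.inl rfl) hsum (hcirsum x z hsum k hkk h0)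
          · exact absurd h0 (p3 x hx z hz hsum)
    · rcases hx with rfl | rfl | hx
      · rcases hz with rfl | rfl | hz
        · exact absurd rfl hxz
        · exact absurd rfl hzy
        · rw [hNc, hNd, hup hz] at h0
          exact absurd h0 (q4 z hz)
      · exact absurd rfl hxy
      · rcases hz with rfl | rfl | hz
        · rw [hNc, hNd, hup hx, hsym] at h0
          exact absurd h0 (q4 x hx)
        · exact absurd rfl hzy
        · rw [hNd, hup hx, hup hz] at h0
          by_cases hsum : N x + N z = m + m
          · refine hmid x hx z hz hxz _ (Or.inr rfl) hsum (hcirsum x z hsum (-k) ?_ ?_)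
            · rw [← hkk]; simp [planeDot]
            · rw [← sub_eq_add_neg]; exact h0
          · exact absurd h0 (q3 x hx z hz hsum)
    · rw [hup hy] at h0
      rcases hx with rfl | rfl | hx
      · rcases hz with rfl | rfl | hz
        · exact absurd rfl hxz
        · rw [hNc, hNd] at h0
          exact (hrel y _ (holdapex y hy h0) (Or.inl rfl)).2.2.1
        · rw [hNc, hup hz] at h0
          exact absurd h0 (p2 y hy z hz hzy.symm)
      · rcases hz with rfl | rfl | hz
        · rw [hNc, hNd, hsym] at h0
          exact (hrel y _ (holdapex y hy h0) (Or.inl rfl)).2.2.2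
        · exact absurd rfl hxz
        · rw [hNd, hup hz] at h0
          exact absurd h0 (q2 y hy z hz hzy.symm)
      · rcases hz with rfl | rfl | hz
        · rw [hNc, hup hx, hsym] at h0
          exact absurd h0 (p2 y hy x hx hxy.symm)
        · rw [hNd, hup hx, hsym] at h0
          exact absurd h0 (q2 y hy x hx hxy.symm)
        · rw [hup hx, hup hz] at h0
          exact hN.2 x hx y hy z hz hxy hzy hxz h0

end PlaneGeometry

section Generations

open Set Filter

/-- Two points of the plane whose coordinates differ by at most `η`. -/
def IsNear (η : ℚ) (u v : ℚ × ℚ) : Prop := |u.1 - v.1| ≤ η ∧ |u.2 - v.2| ≤ η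

theorem exists_isGenericOn_isNear {V : Type*} [DecidableEq V] (Rel : V → V → V → Prop)
    (q : V → ℚ × ℚ) {η : ℚ} (hη : 0 < η) (P : Finset V) :
    ∃ N, IsGenericOn Rel P N ∧ ∀ x ∈ P, IsNear η (N x) (q x) := by
  induction P using Finset.induction_on with
  | empty => exact ⟨q, ⟨by simp, by simp⟩, by simp⟩
  | insert c P hc ih =>
    obtain ⟨N, hN, hq⟩ := ih
    obtain ⟨t, ht, h⟩ := exists_mem_Ioo_of_eventually_cofinite (hN.eventually_insert hc (q c))
      (lt_min hη one_pos)
    have ht1 : t < η := ht.2.trans_le (min_le_left _ _)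
    have ht2 : t < 1 := ht.2.trans_le (min_le_right _ _)
    refine ⟨_, h, fun x hx => ?_⟩
    by_cases hxc : x = c
    · subst hxc
      rw [Function.update_self]
      constructor
      · simpa using abs_le.2 ⟨by linarith [ht.1], ht1.le⟩
      · simp only [Prod.snd_add, add_sub_cancel_left]
        rw [abs_of_nonneg (sq_nonneg t)]
        nlinarith [ht.1]
    · rw [Function.update_of_ne hxc]
      exact hq x (Finset.mem_of_mem_insert_of_ne hx hxc)

/-- The nodes of the family tree: a generation together with a binary label. -/
abbrev Node (M : ℕ) := Fin (M + 1) × (Fin M → Bool)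

variable {M : ℕ}

/-- Flip the bit `j` of a binary label. -/
def flipBit (j : Fin M) (ε : Fin M → Bool) : Fin M → Bool := Function.update ε j (!ε j)

@[simp] theorem flipBit_self (j : Fin M) (ε : Fin M → Bool) : flipBit j ε j = !ε j := by
  simp [flipBit]

theorem flipBit_of_ne {j k : Fin M} (h : k ≠ j) (ε : Fin M → Bool) : flipBit j ε k = ε k := by
  simp [flipBit, h]

@[simp] theorem flipBit_flipBit (j : Fin M) (ε : Fin M → Bool) : flipBit j (flipBit j ε) = ε := by
  simp [flipBit]

theorem flipBit_ne (j : Fin M) (ε : Fin M → Bool) : flipBit j ε ≠ ε := fun h => by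
  simpa using congrFun h j

theorem flipBit_inj_left {j k : Fin M} {ε : Fin M → Bool} (h : flipBit j ε = flipBit k ε) :
    j = k := by
  by_contra hjk
  have := congrFun h j
  rw [flipBit_of_ne hjk] at this
  simp at this

/-- `y` is the apex of a right angle `x y z` inside one of the families: two parents
`(j, ε), (j, flipBit j ε)` and two children `(j + 1, ε), (j + 1, flipBit j ε)`. -/
def FamilyRel (x y z : Node M) : Prop :=
  ∃ (j : Fin M) (ε : Fin M → Bool),
    (x = (j.castSucc, ε) ∧ z = (j.castSucc, flipBit j ε) ∧
      (y = (j.succ, ε) ∨ y = (j.succ, flipBit j ε))) ∨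
    (x = (j.succ, ε) ∧ z = (j.succ, flipBit j ε) ∧
      (y = (j.castSucc, ε) ∨ y = (j.castSucc, flipBit j ε)))

theorem familyRel_of_mem_family (j : Fin M) (ε : Fin M → Bool) (x y : Node M)
    (hx : x = (j.castSucc, ε) ∨ x = (j.castSucc, flipBit j ε))
    (hy : y = (j.succ, flipBit j ε) ∨ y = (j.succ, ε)) :
    FamilyRel (j.castSucc, ε) y (j.castSucc, flipBit j ε) ∧
      FamilyRel (j.castSucc, flipBit j ε) y (j.castSucc, ε) ∧
      FamilyRel (j.succ, flipBit j ε) x (j.succ, ε) ∧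
      FamilyRel (j.succ, ε) x (j.succ, flipBit j ε) := by
  refine ⟨⟨j, ε, Or.inl ⟨rfl, rfl, hy.symm⟩⟩, ⟨j, flipBit j ε, Or.inl ⟨rfl, ?_, ?_⟩⟩,
    ⟨j, flipBit j ε, Or.inr ⟨rfl, ?_, ?_⟩⟩, ⟨j, ε, Or.inr ⟨rfl, rfl, hx⟩⟩⟩
  all_goals simp only [flipBit_flipBit]
  · exact hy
  · exact hx.symm

theorem eq_child_of_familyRel {j : Fin M} {ε : Fin M → Bool} {y : Node M}
    (h : FamilyRel (j.castSucc, ε) y (j.castSucc, flipBit j ε)) :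
    y = (j.succ, ε) ∨ y = (j.succ, flipBit j ε) := by
  obtain ⟨k, ε', ⟨h1, h2, h3⟩ | ⟨h1, h2, h3⟩⟩ := h
  · obtain ⟨e1, rfl⟩ := Prod.ext_iff.1 h1
    obtain rfl := Fin.castSucc_injective _ e1
    exact h3
  · obtain ⟨e1, rfl⟩ := Prod.ext_iff.1 h1
    obtain rfl := flipBit_inj_left (Prod.ext_iff.1 h2).2
    exact absurd e1 (Fin.castSucc_lt_succ).ne

/-- The children of the family `(j, ε)` are placed on the circle whose diameter joins the parents,
at parameter `t`. -/
def IsFamilyPlaced (N : Node M → ℚ × ℚ) (j : Fin M) (ε : Fin M → Bool) (t : ℚ) : Prop :=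
  ∃ m h, N (j.castSucc, ε) = m + h ∧ N (j.castSucc, flipBit j ε) = m - h ∧
    N (j.succ, flipBit j ε) = m + rotate t h ∧ N (j.succ, ε) = m - rotate t h

theorem IsFamilyPlaced.congr {N N' : Node M → ℚ × ℚ} {j : Fin M} {ε : Fin M → Bool} {t : ℚ}
    (h : IsFamilyPlaced N j ε t) (h1 : ∀ δ, N' (j.castSucc, δ) = N (j.castSucc, δ))
    (h2 : N' (j.succ, ε) = N (j.succ, ε))
    (h3 : N' (j.succ, flipBit j ε) = N (j.succ, flipBit j ε)) : IsFamilyPlaced N' j ε t := by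
  obtain ⟨m, k, e⟩ := h
  exact ⟨m, k, by rw [h1, h1, h2, h3]; exact e⟩

theorem generation_insert {j : Fin M} {ε : Fin M → Bool} (hεj : ε j = false)
    {E : Finset (Fin M → Bool)} :
    ({x : Node M | x.1 ≤ j.castSucc ∨ x.1 = j.succ ∧ Function.update x.2 j false ∈ insert ε E} :
      Finset (Node M)) = insert (j.succ, flipBit j ε) (insert (j.succ, ε)
        ({x : Node M | x.1 ≤ j.castSucc ∨ x.1 = j.succ ∧ Function.update x.2 j false ∈ E} :
          Finset (Node M))) := by
  ext ⟨i, δ⟩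
  simp only [Finset.mem_insert, Finset.mem_filter, Finset.mem_univ, true_and, Prod.mk.injEq]
  have key : Function.update δ j false = ε ↔ δ = flipBit j ε ∨ δ = ε := by
    constructor
    · rintro rfl
      cases hδ : δ j with
      | false => right; rw [← hδ]; simp
      | true => left; simp [flipBit, ← hδ]
    · rintro (rfl | rfl)
      · rw [flipBit, Function.update_idem, ← hεj]; simp
      · rw [← hεj]; simp
  rw [key]
  tauto

theorem exists_place_generation (j : Fin M) {N : Node M → ℚ × ℚ}
    (hN : IsGenericOn FamilyRel {x : Node M | x.1 ≤ j.castSucc} N) {τ : ℚ} (hτ : 0 < τ)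
    (E : Finset (Fin M → Bool)) (hE : ∀ ε ∈ E, ε j = false) :
    ∃ N', IsGenericOn FamilyRel
        {x : Node M | x.1 ≤ j.castSucc ∨ x.1 = j.succ ∧ Function.update x.2 j false ∈ E} N' ∧
      (∀ x : Node M, x.1 ≤ j.castSucc → N' x = N x) ∧
      ∀ ε ∈ E, ∃ t ∈ Ioo 1 (1 + τ), IsFamilyPlaced N' j ε t := by
  induction E using Finset.induction_on with
  | empty => exact ⟨N, by simpa using hN, fun _ _ => rfl, by simp⟩
  | insert ε E hε ih =>
    obtain ⟨N', h1, h2, h3⟩ := ih fun δ hδ => hE δ (Finset.mem_insert_of_mem hδ)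
    have hεj := hE ε (Finset.mem_insert_self _ _)
    have hup : Function.update ε j false = ε := by rw [← hεj]; simp
    have hup' : Function.update (flipBit j ε) j false = ε := by
      rw [flipBit, Function.update_idem, hup]
    have hlt : ¬ j.succ ≤ j.castSucc := not_le.2 Fin.castSucc_lt_succ
    have hmem : ∀ δ, (j.castSucc, δ) ∈ ({x : Node M | x.1 ≤ j.castSucc ∨
        x.1 = j.succ ∧ Function.update x.2 j false ∈ E} : Finset (Node M)) := by simp
    have hd : (j.succ, ε) ∉ ({x : Node M | x.1 ≤ j.castSucc ∨
        x.1 = j.succ ∧ Function.update x.2 j false ∈ E} : Finset (Node M)) := by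
      simp [hup, hε, hlt]
    have hc : (j.succ, flipBit j ε) ∉ ({x : Node M | x.1 ≤ j.castSucc ∨
        x.1 = j.succ ∧ Function.update x.2 j false ∈ E} : Finset (Node M)) := by
      simp [hup', hε, hlt]
    set m : ℚ × ℚ := (1 / 2 : ℚ) • (N' (j.castSucc, ε) + N' (j.castSucc, flipBit j ε)) with hm
    set h : ℚ × ℚ := (1 / 2 : ℚ) • (N' (j.castSucc, ε) - N' (j.castSucc, flipBit j ε)) with hh
    have hNa : N' (j.castSucc, ε) = m + h := by
      ext <;> simp [hm, hh] <;> ring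
    have hNb : N' (j.castSucc, flipBit j ε) = m - h := by
      ext <;> simp [hm, hh] <;> ring
    have hcd : ((j.succ, flipBit j ε) : Node M) ≠ (j.succ, ε) := fun e =>
      flipBit_ne j ε (Prod.ext_iff.1 e).2
    obtain ⟨t, ht, hg⟩ := exists_mem_Ioo_of_eventually_cofinite
      (h1.eventually_insert_family (hmem ε) (hmem (flipBit j ε))
        (fun e => flipBit_ne j ε (Prod.ext_iff.1 e).2.symm) hc hd hcd
        (fun n hn hrel => by
          rcases eq_child_of_familyRel hrel with rfl | rfl
          · exact hd hn
          · exact hc hn)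
        (familyRel_of_mem_family j ε) hNa hNb) (show (1 : ℚ) < 1 + τ by linarith)
    set N'' := Function.update (Function.update N' (j.succ, ε) (m - rotate t h))
      (j.succ, flipBit j ε) (m + rotate t h) with hN''
    have hold : ∀ x : Node M, x ≠ (j.succ, ε) → x ≠ (j.succ, flipBit j ε) → N'' x = N' x := by
      intro x hx hx'
      rw [hN'', Function.update_of_ne hx', Function.update_of_ne hx]
    have holdgen : ∀ x : Node M, x.1 ≤ j.castSucc → N'' x = N' x := by
      intro x hx
      refine hold x ?_ ?_ <;>
      · rintro rfl
        exact hlt hx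
    refine ⟨N'', ?_, fun x hx => (holdgen x hx).trans (h2 x hx), fun δ hδ => ?_⟩
    · rw [generation_insert hεj]
      exact hg
    · by_cases hδε : δ = ε
      · subst hδε
        refine ⟨t, ht, m, h, ?_, ?_, ?_, ?_⟩
        · rw [holdgen _ le_rfl, hNa]
        · rw [holdgen _ le_rfl, hNb]
        · rw [hN'', Function.update_self]
        · rw [hN'', Function.update_of_ne hcd.symm, Function.update_self]
      · have hδE := Finset.mem_of_mem_insert_of_ne hδ hδε
        obtain ⟨t', ht', hp⟩ := h3 δ hδE
        have hδj := hE δ hδ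
        have hne : δ ≠ flipBit j ε := fun e => by
          rw [e] at hδj; simp [hεj] at hδj
        refine ⟨t', ht', hp.congr (fun _ => holdgen _ le_rfl) (hold _ ?_ ?_) (hold _ ?_ ?_)⟩
        · simpa using hδε
        · simpa using hne
        · simp only [ne_eq, Prod.mk.injEq, true_and]
          intro e
          exact hne (by rw [← e, flipBit_flipBit])
        · simp only [ne_eq, Prod.mk.injEq, true_and]
          intro e
          exact hδε (by rw [← flipBit_flipBit j δ, e, flipBit_flipBit])

end Generations

section Prototype

open Set Filter

variable {M : ℕ}

/-- The factors of the prototype placement. -/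
def protoFactor (j : Fin (M + 1)) (k : Fin M) (b : Bool) : GaussianInt :=
  if k.castSucc < j then (if b then ⟨1, 1⟩ else 0) else (if b then ⟨0, 1⟩ else 1)

/-- The prototype placement, which has the required Sobolev growth but is degenerate. -/
def proto (x : Node M) : GaussianInt := ∏ k, protoFactor x.1 k (x.2 k)

theorem norm_protoFactor_le (j : Fin (M + 1)) (k : Fin M) (b : Bool) :
    0 ≤ (protoFactor j k b).norm ∧ (protoFactor j k b).norm ≤ 2 := by
  unfold protoFactor
  split_ifs <;> simp [Zsqrtd.norm]

theorem norm_proto (x : Node M) : (proto x).norm = ∏ k, (protoFactor x.1 k (x.2 k)).norm :=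
  map_prod Zsqrtd.normMonoidHom _ _

theorem norm_proto_le (x : Node M) : (proto x).norm ≤ 2 ^ M := by
  rw [norm_proto]
  calc _ ≤ ∏ _k : Fin M, (2 : ℤ) := Finset.prod_le_prod
          (fun k _ => (norm_protoFactor_le _ _ _).1) (fun k _ => (norm_protoFactor_le _ _ _).2)
    _ = 2 ^ M := by simp

theorem norm_proto_zero (ε : Fin M → Bool) : (proto ((0, ε) : Node M)).norm = 1 := by
  rw [norm_proto]
  refine Finset.prod_eq_one fun k _ => ?_
  simp only [protoFactor, Fin.not_lt_zero, if_false]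
  split_ifs <;> simp [Zsqrtd.norm]

theorem norm_proto_last : (proto ((Fin.last M, fun _ => true) : Node M)).norm = 2 ^ M := by
  rw [norm_proto]
  simp [protoFactor, Fin.castSucc_lt_last, Zsqrtd.norm]

theorem protoFactor_succ {j k : Fin M} (h : k ≠ j) (b : Bool) :
    protoFactor j.succ k b = protoFactor j.castSucc k b := by
  have : k.castSucc < j.succ ↔ k.castSucc < j.castSucc := by
    rw [Fin.castSucc_lt_succ_iff, Fin.castSucc_lt_castSucc_iff]
    exact ⟨fun h' => lt_of_le_of_ne h' h, le_of_lt⟩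
  simp only [protoFactor, this]

theorem proto_family {j : Fin M} {ε : Fin M → Bool} (hε : ε j = false) :
    proto (j.castSucc, flipBit j ε) = proto (j.castSucc, ε) * ⟨0, 1⟩ ∧
      proto (j.succ, ε) = 0 ∧
      proto (j.succ, flipBit j ε) = proto (j.castSucc, ε) * ⟨1, 1⟩ := by
  have key : ∀ x : Node M, proto x = protoFactor x.1 j (x.2 j) *
      ∏ k ∈ Finset.univ.erase j, protoFactor x.1 k (x.2 k) := fun x =>
    (Finset.mul_prod_erase _ _ (Finset.mem_univ j)).symm
  have hA : ∀ b, protoFactor j.castSucc j b = if b then ⟨0, 1⟩ else 1 := by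
    simp [protoFactor]
  have hB : ∀ b, protoFactor j.succ j b = if b then ⟨1, 1⟩ else 0 := by
    simp [protoFactor]
  have h1 : ∀ k ∈ Finset.univ.erase j, protoFactor j.castSucc k (flipBit j ε k)
      = protoFactor j.castSucc k (ε k) := fun k hk => by
    rw [flipBit_of_ne (Finset.ne_of_mem_erase hk)]
  have h2 : ∀ k ∈ Finset.univ.erase j, protoFactor j.succ k (flipBit j ε k)
      = protoFactor j.castSucc k (ε k) := fun k hk => by
    rw [flipBit_of_ne (Finset.ne_of_mem_erase hk), protoFactor_succ (Finset.ne_of_mem_erase hk)]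
  refine ⟨?_, ?_, ?_⟩
  · rw [key, key (j.castSucc, ε)]
    simp only [Finset.prod_congr rfl h1, hA, flipBit_self, hε]
    simp [mul_comm]
  · rw [key]
    simp [hB, hε]
  · rw [key, key (j.castSucc, ε)]
    simp only [Finset.prod_congr rfl h2, hA, hB, flipBit_self, hε]
    simp [mul_comm]

theorem rotate_isNear {t τ B : ℚ} {h : ℚ × ℚ} (ht : t ∈ Ioo 1 (1 + τ)) (h1 : |h.1| ≤ B)
    (h2 : |h.2| ≤ B) : IsNear (2 * τ * B) (rotate t h) (-h.2, h.1) := by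
  have hpos : 0 < 1 + t ^ 2 := by positivity
  have hτ : 0 ≤ τ := by linarith [ht.1, ht.2]
  have w1 : |(1 - t ^ 2) / (1 + t ^ 2)| ≤ τ := by
    rw [abs_div, abs_of_pos hpos, div_le_iff₀ hpos, abs_le]
    constructor <;> nlinarith [ht.1, ht.2, mul_nonneg hτ (sq_nonneg t)]
  have w2 : |2 * t / (1 + t ^ 2) - 1| ≤ τ := by
    have : 2 * t / (1 + t ^ 2) - 1 = -((t - 1) ^ 2 / (1 + t ^ 2)) := by
      field_simp; ring
    rw [this, abs_neg, abs_of_nonneg (by positivity), div_le_iff₀ hpos]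
    nlinarith [ht.1, ht.2, mul_nonneg hτ (sq_nonneg t)]
  constructor
  · have : (rotate t h).1 - (-h.2, h.1).1
        = (1 - t ^ 2) / (1 + t ^ 2) * h.1 - (2 * t / (1 + t ^ 2) - 1) * h.2 := by
      simp only [rotate]; ring
    rw [this]
    refine (abs_sub _ _).trans ?_
    rw [abs_mul, abs_mul]
    nlinarith [mul_le_mul w1 h1 (abs_nonneg _) hτ, mul_le_mul w2 h2 (abs_nonneg _) hτ]
  · have : (rotate t h).2 - (-h.2, h.1).2
        = (1 - t ^ 2) / (1 + t ^ 2) * h.2 + (2 * t / (1 + t ^ 2) - 1) * h.1 := by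
      simp only [rotate]; ring
    rw [this]
    refine (abs_add_le _ _).trans ?_
    rw [abs_mul, abs_mul]
    nlinarith [mul_le_mul w1 h2 (abs_nonneg _) hτ, mul_le_mul w2 h1 (abs_nonneg _) hτ]

/-- The point of the rational plane given by a Gaussian integer. -/
def gaussPoint (z : GaussianInt) : ℚ × ℚ := (z.re, z.im)

theorem abs_le_of_norm_le {z : GaussianInt} {B : ℤ} (h : z.norm ≤ B) :
    |(z.re : ℚ)| ≤ B ∧ |(z.im : ℚ)| ≤ B := by
  have h' : z.re * z.re + z.im * z.im ≤ B := by
    simpa [Zsqrtd.norm] using h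
  have key : ∀ x y : ℤ, x * x + y * y ≤ B → |x| ≤ B := fun x y hxy => by
    rw [abs_le]
    constructor
    · nlinarith [Int.le_self_sq (-x), sq_nonneg y]
    · nlinarith [Int.le_self_sq x, sq_nonneg y]
  exact ⟨by exact_mod_cast key _ _ h', by exact_mod_cast key _ _ (by rw [add_comm]; exact h')⟩

theorem IsFamilyPlaced.isNear {N : Node M → ℚ × ℚ} {j : Fin M} {ε : Fin M → Bool} {t η : ℚ}
    (hη : 0 < η) (ht : t ∈ Ioo 1 (1 + η / (4 * (2 ^ M + 1)))) (h : IsFamilyPlaced N j ε t)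
    (hε : ε j = false)
    (hN : ∀ δ, IsNear (min η 1 / 4) (N (j.castSucc, δ)) (gaussPoint (proto (j.castSucc, δ)))) :
    IsNear η (N (j.succ, ε)) (gaussPoint (proto (j.succ, ε))) ∧
      IsNear η (N (j.succ, flipBit j ε)) (gaussPoint (proto (j.succ, flipBit j ε))) := by
  obtain ⟨m, k, ha, hb, hc, hd⟩ := h
  obtain ⟨e1, e2, e3⟩ := proto_family hε
  obtain ⟨b1, b2⟩ := abs_le_of_norm_le (norm_proto_le ((j.castSucc, ε) : Node M))
  have na := hN ε
  have nb := hN (flipBit j ε)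
  rw [e1] at nb
  rw [e2, e3, hc, hd]
  rw [ha] at na
  rw [hb] at nb
  set A := proto ((j.castSucc, ε) : Node M)
  have hη1 : min η 1 / 4 ≤ η / 4 := by
    have := min_le_left η 1; linarith
  have hη2 : min η 1 / 4 ≤ 1 / 4 := by
    have := min_le_right η 1; linarith
  simp only [IsNear, gaussPoint, Prod.fst_add, Prod.snd_add, Prod.fst_sub, Prod.snd_sub,
    Zsqrtd.re_mul, Zsqrtd.im_mul, abs_le] at na nb b1 b2 ⊢
  push_cast at na nb b1 b2 ⊢
  have hB : |k.1| ≤ 2 ^ M + 1 ∧ |k.2| ≤ 2 ^ M + 1 := by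
    rw [abs_le, abs_le]
    refine ⟨⟨?_, ?_⟩, ?_, ?_⟩ <;> linarith [na.1.1, na.1.2, na.2.1, na.2.2, nb.1.1, nb.1.2,
      nb.2.1, nb.2.2]
  have hr := rotate_isNear ht hB.1 hB.2
  have : 2 * (η / (4 * (2 ^ M + 1))) * (2 ^ M + 1) = η / 2 := by
    field_simp; norm_num
  rw [this] at hr
  simp only [IsNear, abs_le] at hr
  simp only [Zsqrtd.re_zero, Zsqrtd.im_zero, Int.cast_zero]
  refine ⟨⟨⟨?_, ?_⟩, ?_, ?_⟩, ⟨?_, ?_⟩, ?_, ?_⟩ <;>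
    linarith [na.1.1, na.1.2, na.2.1, na.2.2, nb.1.1, nb.1.2, nb.2.1, nb.2.2, hr.1.1, hr.1.2,
      hr.2.1, hr.2.2]

theorem exists_generic_placement (j : Fin (M + 1)) : ∀ η : ℚ, 0 < η →
    ∃ N : Node M → ℚ × ℚ, IsGenericOn FamilyRel {x : Node M | x.1 ≤ j} N ∧
      (∀ x : Node M, x.1 ≤ j → IsNear η (N x) (gaussPoint (proto x))) ∧
      ∀ i : Fin M, i.succ ≤ j → ∀ ε : Fin M → Bool, ε i = false →
        ∃ t ∈ Ioo (1 : ℚ) 2, IsFamilyPlaced N i ε t := by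
  induction j using Fin.induction with
  | zero =>
    intro η hη
    obtain ⟨N, h1, h2⟩ := exists_isGenericOn_isNear FamilyRel (fun x => gaussPoint (proto x)) hη
      {x : Node M | x.1 ≤ 0}
    exact ⟨N, h1, fun x hx => h2 x (by simpa using hx),
      fun i hi => absurd hi (not_le.2 (Fin.succ_pos i))⟩
  | succ j ih =>
    intro η hη
    obtain ⟨N, h1, h2, h3⟩ := ih (min η 1 / 4) (by positivity)
    have hτ : 0 < min (η / (4 * (2 ^ M + 1))) 1 := by positivity
    obtain ⟨N', g1, g2, g3⟩ := exists_place_generation j h1 hτ {ε : Fin M → Bool | ε j = false}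
      (by simp)
    have hle : ∀ i : Fin (M + 1), i ≤ j.succ ↔ i ≤ j.castSucc ∨ i = j.succ := fun i => by
      rw [Fin.le_def, Fin.le_def, Fin.ext_iff]
      simp only [Fin.val_succ, Fin.val_castSucc]
      omega
    have hplaced : ∀ ε : Fin M → Bool, ε j = false → ∃ t ∈ Ioo 1 (1 + η / (4 * (2 ^ M + 1))),
        t < 2 ∧ IsFamilyPlaced N' j ε t := by
      intro ε hε
      obtain ⟨t, ht, hp⟩ := g3 ε (by simpa using hε)
      refine ⟨t, ⟨ht.1, ht.2.trans_le ?_⟩, ht.2.trans_le ?_, hp⟩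
      · linarith [min_le_left (η / (4 * (2 ^ M + 1))) 1]
      · linarith [min_le_right (η / (4 * (2 ^ M + 1))) 1]
    have hnear : ∀ ε : Fin M → Bool, ε j = false →
        IsNear η (N' (j.succ, ε)) (gaussPoint (proto (j.succ, ε))) ∧
        IsNear η (N' (j.succ, flipBit j ε)) (gaussPoint (proto (j.succ, flipBit j ε))) := by
      intro ε hε
      obtain ⟨t, ht, -, hp⟩ := hplaced ε hε
      refine hp.isNear hη ht hε fun δ => ?_
      rw [g2 _ le_rfl]
      exact h2 _ le_rfl
    refine ⟨N', ?_, fun x hx => ?_, fun i hi ε hε => ?_⟩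
    · convert g1 using 2
      simp [hle]
    · rcases (hle _).1 hx with hx | hx
      · rw [g2 x hx]
        obtain ⟨n1, n2⟩ := h2 x hx
        have : min η 1 / 4 ≤ η := by
          have := min_le_left η 1; linarith
        exact ⟨n1.trans this, n2.trans this⟩
      · obtain ⟨i, δ⟩ := x
        obtain rfl : i = j.succ := hx
        cases hδ : δ j with
        | false => exact (hnear δ hδ).1
        | true =>
          have := (hnear (flipBit j δ) (by simp [hδ])).2
          rwa [flipBit_flipBit] at this
    · rcases (hle _).1 hi with hi' | hi'
      · obtain ⟨t, ht, hp⟩ := h3 i hi' ε hε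
        exact ⟨t, ht, hp.congr (fun δ => g2 _ ((Fin.castSucc_lt_succ).le.trans hi'))
          (g2 _ hi') (g2 _ hi')⟩
      · obtain rfl := Fin.succ_injective _ hi'
        obtain ⟨t, ht, ht2, hp⟩ := hplaced ε hε
        exact ⟨t, ⟨ht.1, ht2⟩, hp⟩

end Prototype

section Configuration

open Set Filter

variable {M : ℕ}

/-- A placement of the nodes in the plane in which every family is a rectangle with sides of
comparable length, and in which there are no other right angles. -/
structure IsConfiguration (N : Node M → ℚ × ℚ) : Prop where
  injective : Function.Injective N
  familyRel : ∀ x y z, x ≠ y → z ≠ y → x ≠ z → planeDot (N x - N y) (N z - N y) = 0 →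
    FamilyRel x y z
  sum_eq : ∀ j ε, N (j.castSucc, ε) + N (j.castSucc, flipBit j ε)
    = N (j.succ, ε) + N (j.succ, flipBit j ε)
  perp : ∀ x y z, FamilyRel x y z → planeDot (N x - N y) (N z - N y) = 0
  ratio : ∀ x y z, FamilyRel x y z →
    planeDot (N z - N y) (N z - N y) < 4 * planeDot (N x - N y) (N x - N y)

theorem planeDot_rotate_lt {t : ℚ} (ht : t ∈ Ioo (1 : ℚ) 2) {h : ℚ × ℚ} (hh : h ≠ 0) :
    |planeDot h (rotate t h)| < 3 / 5 * planeDot h h := by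
  have h0 : 0 < planeDot h h := lt_of_le_of_ne
    (add_nonneg (mul_self_nonneg _) (mul_self_nonneg _)) fun e => hh (planeDot_self_eq_zero.1 e.symm)
  have h1 : planeDot h (rotate t h) = (1 - t ^ 2) / (1 + t ^ 2) * planeDot h h := by
    simp only [planeDot, rotate]; ring
  rw [h1, abs_mul, abs_of_pos h0]
  refine mul_lt_mul_of_pos_right ?_ h0
  have hpos : 0 < 1 + t ^ 2 := by positivity
  rw [abs_div, abs_of_pos hpos, div_lt_iff₀ hpos, abs_lt]
  constructor <;> nlinarith [ht.1, ht.2]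

theorem IsFamilyPlaced.exists_rectangle {N : Node M → ℚ × ℚ} (hN : Function.Injective N)
    (hp : ∀ (i : Fin M) (ε : Fin M → Bool), ε i = false → ∃ t ∈ Ioo (1 : ℚ) 2,
      IsFamilyPlaced N i ε t) (j : Fin M) (ε : Fin M → Bool) :
    ∃ m h k, N (j.castSucc, ε) = m + h ∧ N (j.castSucc, flipBit j ε) = m - h ∧
      N (j.succ, flipBit j ε) = m + k ∧ N (j.succ, ε) = m - k ∧ planeDot k k = planeDot h h ∧
      |planeDot h k| < 3 / 5 * planeDot h h := by
  have key : ∀ ε : Fin M → Bool, ε j = false →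
    ∃ m h k, N (j.castSucc, ε) = m + h ∧ N (j.castSucc, flipBit j ε) = m - h ∧
      N (j.succ, flipBit j ε) = m + k ∧ N (j.succ, ε) = m - k ∧ planeDot k k = planeDot h h ∧
      |planeDot h k| < 3 / 5 * planeDot h h := by
    intro ε hε
    obtain ⟨t, ht, m, h, e1, e2, e3, e4⟩ := hp j ε hε
    have hh : h ≠ 0 := by
      rintro rfl
      have := hN (e1.trans (by rw [e2]; simp))
      exact flipBit_ne j ε (Prod.ext_iff.1 this).2.symm
    exact ⟨m, h, rotate t h, e1, e2, e3, e4, planeDot_rotate_self t h, planeDot_rotate_lt ht hh⟩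
  cases hε : ε j with
  | false => exact key ε hε
  | true =>
    obtain ⟨m, h, k, e1, e2, e3, e4, e5, e6⟩ := key (flipBit j ε) (by simp [hε])
    rw [flipBit_flipBit] at e2 e3
    refine ⟨m, -h, -k, by rw [e2, sub_eq_add_neg], by rw [e1, sub_neg_eq_add],
      by rw [e4, sub_eq_add_neg], by rw [e3, sub_neg_eq_add], ?_, ?_⟩
    · simpa [planeDot] using e5
    · simpa [planeDot] using e6

theorem exists_isConfiguration (M : ℕ) : ∃ N : Node M → ℚ × ℚ, IsConfiguration N ∧
    (∀ ε, planeDot (N (0, ε)) (N (0, ε)) ≤ 3) ∧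
    (2 : ℚ) ^ M / 4 ≤ planeDot (N (Fin.last M, fun _ => true)) (N (Fin.last M, fun _ => true)) := by
  obtain ⟨N, ⟨h1, h2⟩, h3, h4⟩ := exists_generic_placement (Fin.last M) (1 / 4) (by norm_num)
  simp only [Finset.mem_filter, Finset.mem_univ, true_and, Fin.le_last, forall_const] at h1 h2 h3 h4
  have hinj : Function.Injective N := fun x y h => h1 x y h
  have hrect := IsFamilyPlaced.exists_rectangle hinj h4
  refine ⟨N, ⟨hinj, h2, fun j ε => ?_, fun x y z h => ?_, fun x y z h => ?_⟩, fun ε => ?_, ?_⟩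
  · obtain ⟨m, h, k, e1, e2, e3, e4, -, -⟩ := hrect j ε
    rw [e1, e2, e3, e4]
    abel
  · obtain ⟨j, ε, hr⟩ := h
    obtain ⟨m, h, k, e1, e2, e3, e4, e5, e6⟩ := hrect j ε
    rcases hr with ⟨rfl, rfl, rfl | rfl⟩ | ⟨rfl, rfl, rfl | rfl⟩ <;>
    · simp only [e1, e2, e3, e4]
      simp only [planeDot, Prod.fst_add, Prod.fst_sub, Prod.snd_add, Prod.snd_sub] at e5 ⊢
      linarith
  · obtain ⟨j, ε, hr⟩ := h
    obtain ⟨m, h, k, e1, e2, e3, e4, e5, e6⟩ := hrect j ε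
    rw [abs_lt] at e6
    rcases hr with ⟨rfl, rfl, rfl | rfl⟩ | ⟨rfl, rfl, rfl | rfl⟩ <;>
    · simp only [e1, e2, e3, e4]
      simp only [planeDot, Prod.fst_add, Prod.fst_sub, Prod.snd_add, Prod.snd_sub] at e5 e6 ⊢
      linarith [e6.1, e6.2]
  · obtain ⟨n1, n2⟩ := h3 (0, ε)
    have hn := norm_proto_zero ε
    simp only [gaussPoint] at n1 n2
    set z := proto ((0, ε) : Node M)
    have hn' : (z.re : ℚ) ^ 2 + (z.im : ℚ) ^ 2 = 1 := by
      have : z.re * z.re + z.im * z.im = 1 := by simpa [Zsqrtd.norm] using hn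
      exact_mod_cast (by linarith : z.re ^ 2 + z.im ^ 2 = 1)
    have s1 := sq_le_sq' (abs_le.1 n1).1 (abs_le.1 n1).2
    have s2 := sq_le_sq' (abs_le.1 n2).1 (abs_le.1 n2).2
    simp only [planeDot]
    nlinarith [sq_nonneg ((N (0, ε)).1 - 2 * z.re), sq_nonneg ((N (0, ε)).2 - 2 * z.im)]
  · obtain ⟨n1, n2⟩ := h3 (Fin.last M, fun _ => true)
    have hn := norm_proto_last (M := M)
    simp only [gaussPoint] at n1 n2
    set z := proto ((Fin.last M, fun _ => true) : Node M)
    set u := N (Fin.last M, fun _ => true)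
    have hn' : (z.re : ℚ) ^ 2 + (z.im : ℚ) ^ 2 = 2 ^ M := by
      have : z.re * z.re + z.im * z.im = 2 ^ M := by simpa [Zsqrtd.norm] using hn
      exact_mod_cast (by linarith : z.re ^ 2 + z.im ^ 2 = 2 ^ M)
    have s1 := sq_le_sq' (abs_le.1 n1).1 (abs_le.1 n1).2
    have s2 := sq_le_sq' (abs_le.1 n2).1 (abs_le.1 n2).2
    have hM : (1 : ℚ) ≤ 2 ^ M := one_le_pow₀ (by norm_num)
    simp only [planeDot]
    nlinarith [sq_nonneg (2 * u.1 - z.re), sq_nonneg (2 * u.2 - z.im)]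

/-- Multiplication by the complex number `1 + i T`. -/
def twist (T : ℚ) (u : ℚ × ℚ) : ℚ × ℚ := (u.1 - T * u.2, u.2 + T * u.1)

theorem planeDot_twist (T : ℚ) (u v : ℚ × ℚ) :
    planeDot (twist T u) (twist T v) = (1 + T ^ 2) * planeDot u v := by
  simp only [planeDot, twist]; ring

theorem twist_sub (T : ℚ) (u v : ℚ × ℚ) : twist T u - twist T v = twist T (u - v) := by
  ext <;> simp [twist] <;> ring

theorem twist_add (T : ℚ) (u v : ℚ × ℚ) : twist T u + twist T v = twist T (u + v) := by
  ext <;> simp [twist] <;> ring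

theorem IsConfiguration.twist {N : Node M → ℚ × ℚ} (h : IsConfiguration N) (T : ℚ) :
    IsConfiguration fun x => twist T (N x) := by
  have hT : 0 < 1 + T ^ 2 := by positivity
  refine ⟨fun x y hxy => ?_, fun x y z h1 h2 h3 h4 => ?_, fun j ε => ?_, fun x y z hr => ?_,
    fun x y z hr => ?_⟩
  · have h0 := sub_eq_zero.2 hxy
    simp only [twist_sub] at h0
    have := planeDot_twist T (N x - N y) (N x - N y)
    rw [h0] at this
    have h1 : planeDot (N x - N y) (N x - N y) = 0 := by
      rcases mul_eq_zero.1 (this.symm.trans (by simp [planeDot])) with h' | h'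
      · exact absurd h' hT.ne'
      · exact h'
    exact h.injective (sub_eq_zero.1 (planeDot_self_eq_zero.1 h1))
  · rw [twist_sub, twist_sub, planeDot_twist] at h4
    exact h.familyRel x y z h1 h2 h3 ((mul_eq_zero.1 h4).resolve_left hT.ne')
  · simp only [twist_add, h.sum_eq]
  · rw [twist_sub, twist_sub, planeDot_twist, h.perp x y z hr, mul_zero]
  · rw [twist_sub, twist_sub, planeDot_twist, planeDot_twist]
    nlinarith [h.ratio x y z hr]

theorem IsConfiguration.exists_twist {N : Node M → ℚ × ℚ} (h : IsConfiguration N)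
    (Δ : Finset (ℚ × ℚ)) (hΔ : (0 : ℚ × ℚ) ∉ Δ) :
    ∃ T ∈ Ioo (0 : ℚ) 1, ∀ x y, x ≠ y → ∀ δ ∈ Δ,
      planeDot (_root_.twist T (N x) - _root_.twist T (N y)) δ ≠ 0 := by
  refine exists_mem_Ioo_of_eventually_cofinite ?_ one_pos
  simp only [Filter.eventually_all_finset, Filter.eventually_all]
  intro x y hxy δ hδ
  have hu : N x - N y ≠ 0 := fun e => hxy (h.injective (sub_eq_zero.1 e))
  have hδ0 : δ ≠ 0 := fun e => hΔ (e ▸ hδ)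
  set u := N x - N y with hudef
  have hne : ¬ ((0 : ℚ) = 0 ∧ u.1 * δ.2 - u.2 * δ.1 = 0 ∧ planeDot u δ = 0) := by
    rintro ⟨-, e1, e2⟩
    have : planeDot u u * planeDot δ δ = 0 := by
      have : planeDot u u * planeDot δ δ = planeDot u δ ^ 2 + (u.1 * δ.2 - u.2 * δ.1) ^ 2 := by
        simp only [planeDot]; ring
      rw [this, e1, e2]; norm_num
    rcases mul_eq_zero.1 this with h' | h'
    · exact hu (planeDot_self_eq_zero.1 h')
    · exact hδ0 (planeDot_self_eq_zero.1 h')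
  filter_upwards [eventually_quadratic_ne hne] with T hT heq
  apply hT
  rw [twist_sub, ← hudef] at heq
  refine Eq.trans ?_ heq
  simp only [planeDot, _root_.twist]
  ring

end Configuration

section Modes

open Set Filter

variable {M : ℕ}

/-- The modes: every node carries a cluster of six modes. -/
abbrev ModeIdx (M : ℕ) := Node M × (Fin 2 × Fin 3)

/-- The positions of the modes of a cluster relative to their node. -/
def offset (g : Fin 2 × Fin 3) : ℤ × ℤ := ((g.1 : ℕ), 2 * (g.2 : ℕ))

/-- Labels of the rectangles having a given vertex: rectangles inside the cluster, inside the family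
in which the node is a parent, and inside the family in which it is a child. The boolean orders the
two neighbouring vertices. -/
abbrev RectLabel (M : ℕ) := (Fin 3 × Bool) ⊕ (Fin M × Bool) ⊕ (Fin M × Bool)

/-- The label describes a rectangle at the mode `i`. -/
def IsRectLabel (i : ModeIdx M) : RectLabel M → Prop
  | .inl (b, _) => b ≠ i.2.2
  | .inr (.inl (j, _)) => j.castSucc = i.1.1
  | .inr (.inr (j, _)) => j.succ = i.1.1

instance (i : ModeIdx M) : DecidablePred (IsRectLabel i) := fun c => by
  rcases c with ⟨b, s⟩ | ⟨j, s⟩ | ⟨j, s⟩ <;> unfold IsRectLabel <;> infer_instance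

/-- The remaining vertices `i₁, i₂, i₃` of a rectangle at the mode `i`, where `i₂` is opposite to
`i`. -/
def rectVertices (i : ModeIdx M) : RectLabel M → ModeIdx M × ModeIdx M × ModeIdx M
  | .inl (b, true) => ((i.1, (i.2.1, b)), (i.1, (i.2.1 + 1, b)), (i.1, (i.2.1 + 1, i.2.2)))
  | .inl (b, false) => ((i.1, (i.2.1 + 1, i.2.2)), (i.1, (i.2.1 + 1, b)), (i.1, (i.2.1, b)))
  | .inr (.inl (j, true)) => (((j.succ, i.1.2), i.2), ((j.castSucc, flipBit j i.1.2), i.2),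
      ((j.succ, flipBit j i.1.2), i.2))
  | .inr (.inl (j, false)) => (((j.succ, flipBit j i.1.2), i.2),
      ((j.castSucc, flipBit j i.1.2), i.2), ((j.succ, i.1.2), i.2))
  | .inr (.inr (j, true)) => (((j.castSucc, i.1.2), i.2), ((j.succ, flipBit j i.1.2), i.2),
      ((j.castSucc, flipBit j i.1.2), i.2))
  | .inr (.inr (j, false)) => (((j.castSucc, flipBit j i.1.2), i.2),
      ((j.succ, flipBit j i.1.2), i.2), ((j.castSucc, i.1.2), i.2))

theorem exists_rectLabel_of_cluster (x : Node M) : ∀ g₁ g₂ g₃ : Fin 2 × Fin 3,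
    ((offset g₁ - offset g₂).1 * (offset g₃ - offset g₂).1
      + (offset g₁ - offset g₂).2 * (offset g₃ - offset g₂).2 = 0) → g₁ ≠ g₂ → g₃ ≠ g₂ →
    ∃ i c, IsRectLabel i c ∧ rectVertices i c = ((x, g₁), (x, g₂), (x, g₃)) := by
  have key : ∀ g₁ g₂ g₃ : Fin 2 × Fin 3,
      ((offset g₁ - offset g₂).1 * (offset g₃ - offset g₂).1
        + (offset g₁ - offset g₂).2 * (offset g₃ - offset g₂).2 = 0) → g₁ ≠ g₂ → g₃ ≠ g₂ →
      ∃ (g : Fin 2 × Fin 3) (b : Fin 3), b ≠ g.2 ∧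
        ((g₁ = (g.1, b) ∧ g₂ = (g.1 + 1, b) ∧ g₃ = (g.1 + 1, g.2)) ∨
        (g₁ = (g.1 + 1, g.2) ∧ g₂ = (g.1 + 1, b) ∧ g₃ = (g.1, b))) := by
    decide
  intro g₁ g₂ g₃ h h1 h3
  obtain ⟨g, b, hb, ⟨rfl, rfl, rfl⟩ | ⟨rfl, rfl, rfl⟩⟩ := key g₁ g₂ g₃ h h1 h3
  · exact ⟨(x, g), .inl (b, true), hb, rfl⟩
  · exact ⟨(x, g), .inl (b, false), hb, rfl⟩

theorem exists_rectLabel_of_familyRel {x y z : Node M} (h : FamilyRel x y z) (g : Fin 2 × Fin 3) :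
    ∃ i c, IsRectLabel i c ∧ rectVertices i c = ((x, g), (y, g), (z, g)) := by
  obtain ⟨j, ε, ⟨rfl, rfl, rfl | rfl⟩ | ⟨rfl, rfl, rfl | rfl⟩⟩ := h
  · exact ⟨((j.succ, flipBit j ε), g), .inr (.inr (j, false)), rfl, by simp [rectVertices]⟩
  · exact ⟨((j.succ, ε), g), .inr (.inr (j, true)), rfl, by simp [rectVertices]⟩
  · exact ⟨((j.castSucc, flipBit j ε), g), .inr (.inl (j, false)), rfl, by simp [rectVertices]⟩
  · exact ⟨((j.castSucc, ε), g), .inr (.inl (j, true)), rfl, by simp [rectVertices]⟩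

theorem rectVertices_injOn (i : ModeIdx M) : InjOn (rectVertices i) {c | IsRectLabel i c} := by
  obtain ⟨⟨e, ε⟩, a, b⟩ := i
  have ha : a + 1 ≠ a := by revert a; decide
  have hf : ∀ j, flipBit j ε ≠ ε := fun j => flipBit_ne j ε
  rintro (⟨b₁, _ | _⟩ | ⟨j₁, _ | _⟩ | ⟨j₁, _ | _⟩) h₁ (⟨b₂, _ | _⟩ | ⟨j₂, _ | _⟩ | ⟨j₂, _ | _⟩) h₂ h <;>
  simp only [rectVertices, Prod.mk.injEq, IsRectLabel, mem_ofPred_eq, Fin.succ_inj,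
    Fin.castSucc_inj, hf, (hf _).symm, ha, ha.symm, and_true, true_and, and_false, false_and] at h h₁ h₂ ⊢
  all_goals try (obtain ⟨h, -⟩ := h; subst h; rfl)
  all_goals first
    | rw [h.2.2]
    | (simp only [Fin.ext_iff, Fin.val_succ, Fin.val_castSucc] at h h₁ h₂; omega)

/-- The displacement between two modes of a cluster. -/
def offsetDiff (g g' : Fin 2 × Fin 3) : ℚ × ℚ :=
  (((offset g - offset g').1 : ℤ), ((offset g - offset g').2 : ℤ))

theorem offsetDiff_eq_zero {g g' : Fin 2 × Fin 3} : offsetDiff g g' = 0 ↔ g = g' := by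
  constructor
  · intro h
    have h1 : (offset g - offset g').1 = 0 := Int.cast_eq_zero.1 (congrArg Prod.fst h)
    have h2 : (offset g - offset g').2 = 0 := Int.cast_eq_zero.1 (congrArg Prod.snd h)
    revert h1 h2
    revert g g'
    decide
  · rintro rfl
    simp [offsetDiff]

set_option synthInstance.maxHeartbeats 400000 in
set_option synthInstance.maxSize 1000 in
theorem offsetDiff_perp : ∀ g₁ g₂ g₃ : Fin 2 × Fin 3,
    planeDot (offsetDiff g₁ g₂) (offsetDiff g₃ g₂) = 0 → g₁ ≠ g₂ → g₃ ≠ g₂ →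
    ((offsetDiff g₁ g₂).1 = 0 ∧ (offsetDiff g₃ g₂).2 = 0 ∧ (offsetDiff g₃ g₂).1 ^ 2 = 1 ∧
      4 ≤ (offsetDiff g₁ g₂).2 ^ 2) ∨
    ((offsetDiff g₁ g₂).2 = 0 ∧ (offsetDiff g₃ g₂).1 = 0 ∧ (offsetDiff g₁ g₂).1 ^ 2 = 1 ∧
      4 ≤ (offsetDiff g₃ g₂).2 ^ 2) := by
  have key : ∀ g₁ g₂ g₃ : Fin 2 × Fin 3,
    (offset g₁ - offset g₂).1 * (offset g₃ - offset g₂).1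
      + (offset g₁ - offset g₂).2 * (offset g₃ - offset g₂).2 = 0 → g₁ ≠ g₂ → g₃ ≠ g₂ →
    ((offset g₁ - offset g₂).1 = 0 ∧ (offset g₃ - offset g₂).2 = 0 ∧
      (offset g₃ - offset g₂).1 ^ 2 = 1 ∧ 4 ≤ (offset g₁ - offset g₂).2 ^ 2) ∨
    ((offset g₁ - offset g₂).2 = 0 ∧ (offset g₃ - offset g₂).1 = 0 ∧
      (offset g₁ - offset g₂).1 ^ 2 = 1 ∧ 4 ≤ (offset g₃ - offset g₂).2 ^ 2) := by
    decide
  intro g₁ g₂ g₃ h h1 h3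
  have := key g₁ g₂ g₃ (by simp only [planeDot, offsetDiff] at h; exact_mod_cast h) h1 h3
  simp only [offsetDiff]
  exact_mod_cast this

/-- Perpendicular vectors of comparable length cannot be balanced by cluster displacements. -/
theorem cross_ne_zero_of_ratio {u v : ℚ × ℚ} (huv : planeDot u v = 0)
    (hr : planeDot v v < 4 * planeDot u u) (hu : u.2 ≠ 0) {α β : ℚ} (hα : α ^ 2 = 1)
    (hβ : 4 ≤ β ^ 2) : u.2 * β + v.1 * α ≠ 0 := by
  intro h
  have h1 : v.1 ^ 2 = β ^ 2 * u.2 ^ 2 := by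
    have : v.1 * α = -(u.2 * β) := by linarith
    calc v.1 ^ 2 = (v.1 * α) ^ 2 := by rw [mul_pow, hα, mul_one]
      _ = β ^ 2 * u.2 ^ 2 := by rw [this]; ring
  have hu2 : 0 < u.2 ^ 2 := by positivity
  have h2 : u.2 ^ 2 * v.2 ^ 2 = u.2 ^ 2 * (β ^ 2 * u.1 ^ 2) := by
    have : u.2 * v.2 = -(u.1 * v.1) := by simp only [planeDot] at huv; linarith
    calc u.2 ^ 2 * v.2 ^ 2 = (u.2 * v.2) ^ 2 := by ring
      _ = u.1 ^ 2 * v.1 ^ 2 := by rw [this]; ring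
      _ = _ := by rw [h1]; ring
  have h3 := mul_left_cancel₀ hu2.ne' h2
  simp only [planeDot] at hr
  nlinarith [sq_nonneg u.1]

theorem FamilyRel.symm {x y z : Node M} (h : FamilyRel x y z) : FamilyRel z y x := by
  obtain ⟨j, ε, ⟨rfl, rfl, hy⟩ | ⟨rfl, rfl, hy⟩⟩ := h
  · exact ⟨j, flipBit j ε, Or.inl ⟨rfl, by simp, by simpa using hy.symm⟩⟩
  · exact ⟨j, flipBit j ε, Or.inr ⟨rfl, by simp, by simpa using hy.symm⟩⟩

theorem planeDot_comm (u v : ℚ × ℚ) : planeDot u v = planeDot v u := by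
  simp only [planeDot]; ring

/-- If all coefficients of the resonance function vanish, the modes span a rectangle. -/
theorem IsConfiguration.exists_rectLabel {N : Node M → ℚ × ℚ} (hN : IsConfiguration N)
    (ha : ∀ x y, x ≠ y → ∀ g g', g ≠ g' → planeDot (N x - N y) (offsetDiff g g') ≠ 0)
    {i₁ i₂ i₃ : ModeIdx M} (h₁ : i₁ ≠ i₂) (h₃ : i₃ ≠ i₂)
    (e2 : planeDot (N i₁.1 - N i₂.1) (N i₃.1 - N i₂.1) = 0)
    (e1 : planeDot (N i₁.1 - N i₂.1) (offsetDiff i₃.2 i₂.2)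
      + planeDot (N i₃.1 - N i₂.1) (offsetDiff i₁.2 i₂.2) = 0)
    (e0 : planeDot (offsetDiff i₁.2 i₂.2) (offsetDiff i₃.2 i₂.2) = 0) :
    ∃ i c, IsRectLabel i c ∧ rectVertices i c = (i₁, i₂, i₃) := by
  obtain ⟨x, g₁⟩ := i₁
  obtain ⟨y, g₂⟩ := i₂
  obtain ⟨z, g₃⟩ := i₃
  simp only at e0 e1 e2
  have hz0 : ∀ w, planeDot 0 w = 0 := fun w => by simp [planeDot]
  by_cases hxy : x = y
  · subst hxy
    rw [sub_self, hz0, zero_add] at e1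
    have hg1 : g₁ ≠ g₂ := fun e => h₁ (by rw [e])
    by_cases hzx : z = x
    · subst hzx
      refine exists_rectLabel_of_cluster z g₁ g₂ g₃ ?_ hg1 fun e => h₃ (by rw [e])
      simp only [planeDot, offsetDiff] at e0
      exact_mod_cast e0
    · exact absurd e1 (ha z x hzx _ _ hg1)
  by_cases hzy : z = y
  · subst hzy
    rw [sub_self, hz0, add_zero] at e1
    exact absurd e1 (ha x z hxy _ _ fun e => h₃ (by rw [e]))
  by_cases hxz : x = z
  · subst hxz
    exact absurd (hN.injective (sub_eq_zero.1 (planeDot_self_eq_zero.1 e2))) hxy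
  have hrel := hN.familyRel x y z hxy hzy hxz e2
  by_cases hg1 : g₁ = g₂
  · subst hg1
    rw [offsetDiff_eq_zero.2 rfl, planeDot_comm _ 0, hz0, add_zero] at e1
    by_cases hg3 : g₃ = g₁
    · subst hg3
      exact exists_rectLabel_of_familyRel hrel g₃
    · exact absurd e1 (ha x y hxy _ _ hg3)
  by_cases hg3 : g₃ = g₂
  · subst hg3
    rw [offsetDiff_eq_zero.2 rfl, planeDot_comm _ 0, hz0, zero_add] at e1
    exact absurd e1 (ha z y hzy _ _ hg1)
  exfalso
  rcases offsetDiff_perp g₁ g₂ g₃ e0 hg1 hg3 with ⟨f1, f2, f3, f4⟩ | ⟨f1, f2, f3, f4⟩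
  · refine cross_ne_zero_of_ratio (u := N z - N y) (v := N x - N y) (by rw [planeDot_comm]; exact e2)
      (hN.ratio z y x hrel.symm) (fun e => ha z y hzy _ _ hg1 ?_) f3 f4 ?_
    · simp only [planeDot]
      rw [e, f1]; ring
    · simp only [planeDot] at e1
      rw [f1, f2] at e1
      linarith
  · refine cross_ne_zero_of_ratio (u := N x - N y) (v := N z - N y) e2
      (hN.ratio x y z hrel) (fun e => ha x y hxy _ _ hg3 ?_) f3 f4 ?_
    · simp only [planeDot]
      rw [e, f2]; ring
    · simp only [planeDot] at e1
      rw [f1, f2] at e1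
      linarith

theorem IsConfiguration.rectVertices_coeff {N : Node M → ℚ × ℚ} (hN : IsConfiguration N)
    {i : ModeIdx M} {c : RectLabel M} (hc : IsRectLabel i c) {i₁ i₂ i₃ : ModeIdx M}
    (h : rectVertices i c = (i₁, i₂, i₃)) :
    (N i₁.1 - N i₂.1 + N i₃.1 = N i.1 ∧ offset i₁.2 - offset i₂.2 + offset i₃.2 = offset i.2) ∧
      planeDot (N i₁.1 - N i₂.1) (N i₃.1 - N i₂.1) = 0 ∧
      planeDot (N i₁.1 - N i₂.1) (offsetDiff i₃.2 i₂.2)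
        + planeDot (N i₃.1 - N i₂.1) (offsetDiff i₁.2 i₂.2) = 0 ∧
      planeDot (offsetDiff i₁.2 i₂.2) (offsetDiff i₃.2 i₂.2) = 0 := by
  have hz0 : ∀ w, planeDot 0 w = 0 := fun w => by simp [planeDot]
  have hz0' : ∀ w, planeDot w 0 = 0 := fun w => by simp [planeDot]
  have hoff : ∀ g, offsetDiff g g = 0 := fun g => offsetDiff_eq_zero.2 rfl
  have hclus : ∀ (a : Fin 2) (b b' : Fin 3),
      offset (a, b) - offset (a + 1, b) + offset (a + 1, b') = offset (a, b') ∧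
      offset (a + 1, b') - offset (a + 1, b) + offset (a, b) = offset (a, b') := by decide
  have hclus' : ∀ (a : Fin 2) (b b' : Fin 3),
      planeDot (offsetDiff (a, b) (a + 1, b)) (offsetDiff (a + 1, b') (a + 1, b)) = 0 ∧
      planeDot (offsetDiff (a + 1, b') (a + 1, b)) (offsetDiff (a, b) (a + 1, b)) = 0 := by
    intro a b b'
    simp [planeDot, offsetDiff, offset]
  obtain ⟨⟨e, ε⟩, a, b'⟩ := i
  rcases c with ⟨b, _ | _⟩ | ⟨j, _ | _⟩ | ⟨j, _ | _⟩ <;>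
    simp only [rectVertices, Prod.mk.injEq] at h <;> obtain ⟨rfl, rfl, rfl⟩ := h
  · simp [hz0, hclus, hclus']
  · simp [hz0, hclus, hclus']
  all_goals
    obtain rfl : _ = e := hc
    have hs := hN.sum_eq j ε
    simp only [hoff, hz0', add_zero, and_true, sub_add_cancel]
  · exact ⟨by rw [sub_add_eq_add_sub, sub_eq_iff_eq_add, hs, add_comm],
      hN.perp _ _ _ (FamilyRel.symm ⟨j, ε, Or.inr ⟨rfl, rfl, Or.inr rfl⟩⟩)⟩
  · exact ⟨by rw [sub_add_eq_add_sub, sub_eq_iff_eq_add, hs],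
      hN.perp _ _ _ ⟨j, ε, Or.inr ⟨rfl, rfl, Or.inr rfl⟩⟩⟩
  · exact ⟨by rw [sub_add_eq_add_sub, sub_eq_iff_eq_add, ← hs, add_comm],
      hN.perp _ _ _ (FamilyRel.symm ⟨j, ε, Or.inl ⟨rfl, rfl, Or.inr rfl⟩⟩)⟩
  · exact ⟨by rw [sub_add_eq_add_sub, sub_eq_iff_eq_add, ← hs],
      hN.perp _ _ _ ⟨j, ε, Or.inl ⟨rfl, rfl, Or.inr rfl⟩⟩⟩

end Modes

section ModePositions

open Set Filter

variable {M : ℕ}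

/-- Positions of the modes in the frequency lattice whose only resonant rectangles are those of
`rectVertices`. -/
structure IsModePlacement (p : ModeIdx M → Z2) : Prop where
  injective : Function.Injective p
  exists_rectLabel : ∀ i₁ i₂ i₃, resonance (p i₁, p i₂, p i₃) = 0 → i₁ ≠ i₂ → i₃ ≠ i₂ →
    ∃ i c, IsRectLabel i c ∧ rectVertices i c = (i₁, i₂, i₃)
  resonance_eq_zero : ∀ i c, IsRectLabel i c →
    resonance (p (rectVertices i c).1, p (rectVertices i c).2.1, p (rectVertices i c).2.2) = 0
  sum_eq : ∀ i c, IsRectLabel i c →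
    p (rectVertices i c).1 - p (rectVertices i c).2.1 + p (rectVertices i c).2.2 = p i

theorem exists_common_denominator {ι : Type*} [Fintype ι] (f : ι → ℚ) :
    ∃ D : ℕ, 0 < D ∧ ∀ i, ∃ z : ℤ, (z : ℚ) = D * f i := by
  classical
  refine ⟨∏ i, (f i).den, Finset.prod_pos fun i _ => (f i).den_pos, fun i => ?_⟩
  refine ⟨(∏ k ∈ Finset.univ.erase i, (f k).den : ℕ) * (f i).num, ?_⟩
  rw [← Finset.mul_prod_erase _ _ (Finset.mem_univ i)]
  have : (f i).den * f i = (f i).num := Rat.den_mul_eq_num (f i)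
  push_cast
  rw [← this]
  ring

theorem exists_isModePlacement (M : ℕ) : ∃ (p : ModeIdx M → Z2) (Q : ℝ), IsModePlacement p ∧ 0 < Q ∧
    (∀ ε g, 1 + nsq (p ((0, ε), g)) ≤ 13 * Q) ∧
    ∃ i : ModeIdx M, i.1.1 = Fin.last M ∧ 2 ^ M / 4 * Q ≤ nsq (p i) := by
  obtain ⟨N₀, hN₀, hlow, hhigh⟩ := exists_isConfiguration M
  obtain ⟨T, hT, hΔ⟩ := hN₀.exists_twist
    ((Finset.univ.image fun q : (Fin 2 × Fin 3) × (Fin 2 × Fin 3) => offsetDiff q.1 q.2).erase 0)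
    (by simp)
  have hN := hN₀.twist T
  have hlow' : ∀ ε, planeDot (twist T (N₀ (0, ε))) (twist T (N₀ (0, ε))) ≤ 6 := fun ε => by
    rw [planeDot_twist]
    nlinarith [hlow ε, hT.1, hT.2, mul_nonneg (sub_nonneg.2 (hlow ε)) (sq_nonneg T)]
  have hhigh' : (2 : ℚ) ^ M / 4 ≤ planeDot (twist T (N₀ (Fin.last M, fun _ => true)))
      (twist T (N₀ (Fin.last M, fun _ => true))) := by
    rw [planeDot_twist]
    have : (0 : ℚ) < 2 ^ M / 4 := by positivity
    nlinarith [mul_nonneg (this.le.trans hhigh) (sq_nonneg T)]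
  set N : Node M → ℚ × ℚ := fun x => twist T (N₀ x) with hNdef
  have ha : ∀ x y, x ≠ y → ∀ g g', g ≠ g' → planeDot (N x - N y) (offsetDiff g g') ≠ 0 :=
    fun x y hxy g g' hg => hΔ x y hxy _ (Finset.mem_erase.2
      ⟨fun e => hg (offsetDiff_eq_zero.1 e), Finset.mem_image.2 ⟨(g, g'), Finset.mem_univ _, rfl⟩⟩)
  have hgood : ∀ᶠ K : ℚ in cofinite, ∀ i₁ i₂ i₃ : ModeIdx M,
      ¬ (planeDot (N i₁.1 - N i₂.1) (N i₃.1 - N i₂.1) = 0 ∧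
        planeDot (N i₁.1 - N i₂.1) (offsetDiff i₃.2 i₂.2)
          + planeDot (N i₃.1 - N i₂.1) (offsetDiff i₁.2 i₂.2) = 0 ∧
        planeDot (offsetDiff i₁.2 i₂.2) (offsetDiff i₃.2 i₂.2) = 0) →
      planeDot (N i₁.1 - N i₂.1) (N i₃.1 - N i₂.1) * K ^ 2
        + (planeDot (N i₁.1 - N i₂.1) (offsetDiff i₃.2 i₂.2)
          + planeDot (N i₃.1 - N i₂.1) (offsetDiff i₁.2 i₂.2)) * K
        + planeDot (offsetDiff i₁.2 i₂.2) (offsetDiff i₃.2 i₂.2) ≠ 0 := by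
    simp only [Filter.eventually_all]
    intro i₁ i₂ i₃ h
    exact eventually_quadratic_ne h
  obtain ⟨D, hD, hDN⟩ := exists_common_denominator
    (fun q : Node M × Bool => if q.2 then (N q.1).1 else (N q.1).2)
  have hDinj : Function.Injective fun L : ℕ => ((D : ℚ) * L) := fun a b hab => by
    have : (D : ℚ) ≠ 0 := by exact_mod_cast hD.ne'
    exact_mod_cast mul_left_cancel₀ this hab
  have hev := hDinj.tendsto_cofinite.eventually hgood
  rw [Nat.cofinite_eq_atTop] at hev
  obtain ⟨L, hL, hL6⟩ := (hev.and (eventually_ge_atTop 6)).exists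
  set K : ℚ := (D : ℚ) * L with hK
  have hK6 : 6 ≤ K := by
    have h1 : (6 : ℚ) ≤ L := by exact_mod_cast hL6
    have h2 : (1 : ℚ) ≤ D := by exact_mod_cast hD
    nlinarith
  choose z hz using hDN
  have hz1 : ∀ x, ((L * z (x, true) : ℤ) : ℚ) = K * (N x).1 := fun x => by
    have := hz (x, true)
    simp only [if_true] at this
    push_cast
    rw [this, hK]; ring
  have hz2 : ∀ x, ((L * z (x, false) : ℤ) : ℚ) = K * (N x).2 := fun x => by
    have := hz (x, false)
    simp only [Bool.false_eq_true, if_false] at this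
    push_cast
    rw [this, hK]; ring
  set p : ModeIdx M → Z2 := fun i =>
    (L * z (i.1, true) + (offset i.2).1, L * z (i.1, false) + (offset i.2).2) with hp
  have hp1 : ∀ i, ((p i).1 : ℚ) = K * (N i.1).1 + (offset i.2).1 := fun i => by
    rw [← hz1]; simp [hp]
  have hp2 : ∀ i, ((p i).2 : ℚ) = K * (N i.1).2 + (offset i.2).2 := fun i => by
    rw [← hz2]; simp [hp]
  have hres : ∀ i₁ i₂ i₃, (resonance (p i₁, p i₂, p i₃) : ℚ)
      = planeDot (N i₁.1 - N i₂.1) (N i₃.1 - N i₂.1) * K ^ 2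
        + (planeDot (N i₁.1 - N i₂.1) (offsetDiff i₃.2 i₂.2)
          + planeDot (N i₃.1 - N i₂.1) (offsetDiff i₁.2 i₂.2)) * K
        + planeDot (offsetDiff i₁.2 i₂.2) (offsetDiff i₃.2 i₂.2) := fun i₁ i₂ i₃ => by
    simp only [resonance]
    push_cast
    rw [hp1, hp1, hp1, hp2, hp2, hp2]
    simp only [planeDot, offsetDiff, Prod.fst_sub, Prod.snd_sub]
    push_cast
    ring
  have hclass : ∀ i₁ i₂ i₃, resonance (p i₁, p i₂, p i₃) = 0 → i₁ ≠ i₂ → i₃ ≠ i₂ →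
      ∃ i c, IsRectLabel i c ∧ rectVertices i c = (i₁, i₂, i₃) := by
    intro i₁ i₂ i₃ h h₁ h₃
    have h0 : (resonance (p i₁, p i₂, p i₃) : ℚ) = 0 := by exact_mod_cast h
    rw [hres] at h0
    have := not_not.1 fun hne => hL i₁ i₂ i₃ hne h0
    exact hN.exists_rectLabel ha h₁ h₃ this.1 this.2.1 this.2.2
  have hinj : Function.Injective p := by
    intro i i' h
    by_contra hne
    obtain ⟨k, c, hc, hcv⟩ := hclass i i' i (by simp [resonance, h]) hne hne
    have hcoef := hN.rectVertices_coeff hc hcv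
    by_cases hx : i.1 = i'.1
    · refine hne (Prod.ext hx (offsetDiff_eq_zero.1 (planeDot_self_eq_zero.1 hcoef.2.2.2)))
    · exact hx (hN.injective (sub_eq_zero.1 (planeDot_self_eq_zero.1 hcoef.2.1)))
  refine ⟨p, (K : ℝ) ^ 2, ⟨hinj, hclass, fun i c hc => ?_, fun i c hc => ?_⟩, ?_, fun ε g => ?_,
    ((Fin.last M, fun _ => true), (0, 0)), rfl, ?_⟩
  · obtain ⟨-, c2, c1, c0⟩ := hN.rectVertices_coeff hc (show rectVertices i c =
      ((rectVertices i c).1, (rectVertices i c).2.1, (rectVertices i c).2.2) from rfl)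
    have : (resonance (p (rectVertices i c).1, p (rectVertices i c).2.1,
        p (rectVertices i c).2.2) : ℚ) = 0 := by
      rw [hres, c2, c1, c0]; ring
    exact_mod_cast this
  · obtain ⟨⟨s1, s2⟩, -⟩ := hN.rectVertices_coeff hc (show rectVertices i c =
      ((rectVertices i c).1, (rectVertices i c).2.1, (rectVertices i c).2.2) from rfl)
    have s1a := congrArg Prod.fst s1
    have s1b := congrArg Prod.snd s1
    have s2a := congrArg (fun q : ℤ × ℤ => (q.1 : ℚ)) s2
    have s2b := congrArg (fun q : ℤ × ℤ => (q.2 : ℚ)) s2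
    simp only [Prod.fst_add, Prod.fst_sub, Prod.snd_add, Prod.snd_sub, Int.cast_add,
      Int.cast_sub] at s1a s1b s2a s2b
    refine Prod.ext ?_ ?_
    · have : (((p (rectVertices i c).1 - p (rectVertices i c).2.1 + p (rectVertices i c).2.2).1 : ℤ) : ℚ)
          = (p i).1 := by
        simp only [Prod.fst_add, Prod.fst_sub, Int.cast_add, Int.cast_sub]
        rw [hp1, hp1, hp1, hp1, ← s1a, ← s2a]
        ring
      exact_mod_cast this
    · have : (((p (rectVertices i c).1 - p (rectVertices i c).2.1 + p (rectVertices i c).2.2).2 : ℤ) : ℚ)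
          = (p i).2 := by
        simp only [Prod.snd_add, Prod.snd_sub, Int.cast_add, Int.cast_sub]
        rw [hp2, hp2, hp2, hp2, ← s1b, ← s2b]
        ring
      exact_mod_cast this
  · have : (0 : ℝ) < K := by exact_mod_cast (by linarith : (0 : ℚ) < K)
    positivity
  · have hoff : ∀ g : Fin 2 × Fin 3, (offset g).1 ^ 2 + (offset g).2 ^ 2 ≤ 17 := by decide
    have hoff' : ((offset g).1 : ℚ) ^ 2 + ((offset g).2 : ℚ) ^ 2 ≤ 17 := by exact_mod_cast hoff g
    have key : 1 + (((p ((0, ε), g)).1 : ℚ) ^ 2 + ((p ((0, ε), g)).2 : ℚ) ^ 2) ≤ 13 * K ^ 2 := by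
      rw [hp1, hp2]
      have h6 := hlow' ε
      simp only [planeDot] at h6
      have : ((twist T (N₀ (0, ε))).1 ^ 2 + (twist T (N₀ (0, ε))).2 ^ 2) * K ^ 2 ≤ 6 * K ^ 2 :=
        mul_le_mul_of_nonneg_right (by nlinarith) (sq_nonneg K)
      simp only [hNdef]
      nlinarith [sq_nonneg (K * (twist T (N₀ (0, ε))).1 - (offset g).1),
        sq_nonneg (K * (twist T (N₀ (0, ε))).2 - (offset g).2)]
    have key' : ((1 + (((p ((0, ε), g)).1 : ℚ) ^ 2 + ((p ((0, ε), g)).2 : ℚ) ^ 2) : ℚ) : ℝ)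
        ≤ ((13 * K ^ 2 : ℚ) : ℝ) := by exact_mod_cast key
    simp only [nsq]
    push_cast at key' ⊢
    exact key'
  · have key : (2 : ℚ) ^ M / 4 * K ^ 2 ≤ ((p ((Fin.last M, fun _ => true), (0, 0))).1 : ℚ) ^ 2
        + ((p ((Fin.last M, fun _ => true), (0, 0))).2 : ℚ) ^ 2 := by
      rw [hp1, hp2]
      have h6 := mul_le_mul_of_nonneg_right hhigh' (sq_nonneg K)
      simp only [planeDot] at h6
      have o1 : offset (0, 0) = (0, 0) := by decide
      simp only [hNdef, o1, Int.cast_zero, add_zero]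
      linarith
    have key' : (((2 : ℚ) ^ M / 4 * K ^ 2 : ℚ) : ℝ)
        ≤ ((((p ((Fin.last M, fun _ => true), (0, 0))).1 : ℚ) ^ 2
        + ((p ((Fin.last M, fun _ => true), (0, 0))).2 : ℚ) ^ 2 : ℚ) : ℝ) := by exact_mod_cast key
    simp only [nsq]
    push_cast at key' ⊢
    exact key'

end ModePositions

section ModeSystem

open Set Filter

variable {M : ℕ}

theorem resonantSum_image_eq {ι : Type*} [Fintype ι] [DecidableEq ι] {p : ι → Z2}
    (hp : Function.Injective p) (a : Z2 → ℂ) (n : Z2) :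
    resonantSum (Finset.univ.image p) a n = ∑ q : ι × ι × ι,
      if p q.1 - p q.2.1 + p q.2.2 = n ∧ resonance (p q.1, p q.2.1, p q.2.2) = 0
        then a (p q.1) * (starRingEnd ℂ) (a (p q.2.1)) * a (p q.2.2) else 0 := by
  have hf : Function.Injective fun q : ι × ι × ι => ((p q.1, p q.2.1, p q.2.2) : Triple) :=
    fun q q' h => by
      simp only [Prod.mk.injEq] at h
      exact Prod.ext (hp h.1) (Prod.ext (hp h.2.1) (hp h.2.2))
  have himg : Finset.univ.image p ×ˢ Finset.univ.image p ×ˢ Finset.univ.image p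
      = Finset.univ.image fun q : ι × ι × ι => ((p q.1, p q.2.1, p q.2.2) : Triple) := by
    ext ⟨x, y, z⟩
    simp only [Finset.mem_product, Finset.mem_image, Finset.mem_univ, true_and, Prod.mk.injEq,
      Prod.exists]
    constructor
    · rintro ⟨⟨i, rfl⟩, ⟨j, rfl⟩, ⟨k, rfl⟩⟩
      exact ⟨i, j, k, rfl, rfl, rfl⟩
    · rintro ⟨i, j, k, rfl, rfl, rfl⟩
      exact ⟨⟨i, rfl⟩, ⟨j, rfl⟩, ⟨k, rfl⟩⟩
  rw [resonantSum, himg, Finset.sum_filter, Finset.sum_image fun x _ y _ h => hf h]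
  refine Finset.sum_congr rfl fun q _ => ?_
  rw [ite_and]
  rfl

theorem rectVertices_ne {i : ModeIdx M} {c : RectLabel M} (hc : IsRectLabel i c) :
    (rectVertices i c).1 ≠ (rectVertices i c).2.1 ∧
      (rectVertices i c).2.2 ≠ (rectVertices i c).2.1 := by
  have hα : ∀ α : Fin 2, α + 1 ≠ α := by decide
  have hs : ∀ j : Fin M, j.succ ≠ j.castSucc := fun j h => by
    simp [Fin.ext_iff] at h
  rcases c with ⟨b, _ | _⟩ | ⟨j, _ | _⟩ | ⟨j, _ | _⟩
  · exact ⟨by simpa [rectVertices] using Ne.symm hc, by simp [rectVertices, (hα _).symm]⟩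
  · exact ⟨by simp [rectVertices, (hα _).symm], by simpa [rectVertices] using Ne.symm hc⟩
  all_goals simp [rectVertices, hs, (hs _).symm]

/-- The resonant interactions of a placement are the trivial ones and the rectangles. -/
theorem IsModePlacement.resonantSum_apply {p : ModeIdx M → Z2} (hp : IsModePlacement p)
    (a : Z2 → ℂ) (i : ModeIdx M) :
    resonantSum (Finset.univ.image p) a (p i) =
      2 * (∑ k, (‖a (p k)‖ : ℂ) ^ 2) * a (p i) - (‖a (p i)‖ : ℂ) ^ 2 * a (p i)
        + ∑ c with IsRectLabel i c, a (p (rectVertices i c).1) *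
          (starRingEnd ℂ) (a (p (rectVertices i c).2.1)) * a (p (rectVertices i c).2.2) := by
  classical
  rw [resonantSum_image_eq hp.injective]
  set F : ModeIdx M × ModeIdx M × ModeIdx M → ℂ := fun q =>
    a (p q.1) * (starRingEnd ℂ) (a (p q.2.1)) * a (p q.2.2) with hF
  have hmem : ∀ q : ModeIdx M × ModeIdx M × ModeIdx M,
      (p q.1 - p q.2.1 + p q.2.2 = p i ∧ resonance (p q.1, p q.2.1, p q.2.2) = 0) ↔
        ((q.1 = q.2.1 ∧ q.2.2 = i) ∨ (q.2.2 = q.2.1 ∧ q.1 = i)) ∨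
          q ∈ (Finset.univ.filter (IsRectLabel i)).image (rectVertices i) := by
    rintro ⟨x, y, z⟩
    constructor
    · rintro ⟨h1, h2⟩
      dsimp only at h1 h2 ⊢
      by_cases hxy : x = y
      · subst hxy
        exact Or.inl (Or.inl ⟨rfl, hp.injective (by simpa using h1)⟩)
      by_cases hzy : z = y
      · subst hzy
        exact Or.inl (Or.inr ⟨rfl, hp.injective (by simpa using h1)⟩)
      obtain ⟨k, c, hc, hv⟩ := hp.exists_rectLabel x y z h2 hxy hzy
      have hs := hp.sum_eq k c hc
      rw [hv] at hs
      have : k = i := hp.injective (hs.symm.trans h1)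
      subst this
      exact Or.inr (Finset.mem_image.2 ⟨c, by simpa using hc, hv⟩)
    · rintro ((⟨h, h'⟩ | ⟨h, h'⟩) | h)
      · dsimp only at h h' ⊢
        subst h h'
        simp [resonance]
      · dsimp only at h h' ⊢
        subst h h'
        simp [resonance]
      · obtain ⟨c, hc, hv⟩ := Finset.mem_image.1 h
        have hc' : IsRectLabel i c := by simpa using hc
        have h1 := hp.sum_eq i c hc'
        have h2 := hp.resonance_eq_zero i c hc'
        rw [hv] at h1 h2
        exact ⟨h1, h2⟩
  have hsplit : ∀ q : ModeIdx M × ModeIdx M × ModeIdx M,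
      (if p q.1 - p q.2.1 + p q.2.2 = p i ∧ resonance (p q.1, p q.2.1, p q.2.2) = 0
        then F q else 0) =
      (((if q.1 = q.2.1 ∧ q.2.2 = i then F q else 0)
        + (if q.2.2 = q.2.1 ∧ q.1 = i then F q else 0))
        - (if q = (i, i, i) then F q else 0))
        + (if q ∈ (Finset.univ.filter (IsRectLabel i)).image (rectVertices i) then F q else 0) := by
    intro q
    rw [if_congr (hmem q) rfl rfl]
    by_cases h3 : q ∈ (Finset.univ.filter (IsRectLabel i)).image (rectVertices i)
    · obtain ⟨c, hc, rfl⟩ := Finset.mem_image.1 h3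
      obtain ⟨n1, n2⟩ := rectVertices_ne (i := i) (c := c) (by simpa using hc)
      have n3 : rectVertices i c ≠ (i, i, i) := fun h => n1 (by rw [h])
      rw [if_pos (Or.inr h3), if_neg fun h => n1 h.1, if_neg fun h => n2 h.1, if_neg n3, if_pos h3]
      ring
    · rw [if_neg h3]
      obtain ⟨x, y, z⟩ := q
      by_cases h1 : x = y ∧ z = i
      · by_cases h2 : z = y ∧ x = i
        · have : ((x, y, z) : ModeIdx M × ModeIdx M × ModeIdx M) = (i, i, i) := by
            rw [← h1.1, h2.2, h1.2]
          rw [if_pos (Or.inl (Or.inl h1)), if_pos h1, if_pos h2, if_pos this]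
          ring
        · have : ((x, y, z) : ModeIdx M × ModeIdx M × ModeIdx M) ≠ (i, i, i) := fun h => by
            simp only [Prod.mk.injEq] at h
            exact h2 ⟨h.2.2.trans h.2.1.symm, h.1⟩
          rw [if_pos (Or.inl (Or.inl h1)), if_pos h1, if_neg h2, if_neg this]
          ring
      · have : ((x, y, z) : ModeIdx M × ModeIdx M × ModeIdx M) ≠ (i, i, i) := fun h => by
          simp only [Prod.mk.injEq] at h
          exact h1 ⟨h.1.trans h.2.1.symm, h.2.2⟩
        by_cases h2 : z = y ∧ x = i
        · rw [if_pos (Or.inl (Or.inr h2)), if_neg h1, if_pos h2, if_neg this]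
          ring
        · rw [if_neg (by tauto), if_neg h1, if_neg h2, if_neg this]
          ring
  rw [Finset.sum_congr rfl fun q _ => hsplit q, Finset.sum_add_distrib, Finset.sum_sub_distrib,
    Finset.sum_add_distrib]
  congr 1
  · have e1 : ∑ q : ModeIdx M × ModeIdx M × ModeIdx M, (if q.1 = q.2.1 ∧ q.2.2 = i then F q else 0)
        = (∑ k, (‖a (p k)‖ : ℂ) ^ 2) * a (p i) := by
      rw [Fintype.sum_prod_type, Finset.sum_mul]
      refine Finset.sum_congr rfl fun k _ => ?_
      rw [Fintype.sum_eq_single (k, i) fun q hq => if_neg fun h => hq (Prod.ext h.1.symm h.2)]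
      rw [if_pos ⟨rfl, rfl⟩, hF]
      dsimp only
      rw [Complex.mul_conj']
    have e2 : ∑ q : ModeIdx M × ModeIdx M × ModeIdx M, (if q.2.2 = q.2.1 ∧ q.1 = i then F q else 0)
        = (∑ k, (‖a (p k)‖ : ℂ) ^ 2) * a (p i) := by
      rw [Fintype.sum_prod_type, Fintype.sum_eq_single i fun k hk =>
        Finset.sum_eq_zero fun q _ => if_neg fun h => hk h.2, Fintype.sum_prod_type, Finset.sum_mul]
      refine Finset.sum_congr rfl fun k _ => ?_
      rw [Fintype.sum_eq_single k fun q hq => if_neg fun h => hq h.1]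
      rw [if_pos ⟨rfl, rfl⟩, hF]
      dsimp only
      rw [mul_assoc, Complex.conj_mul', mul_comm]
    have e3 : ∑ q : ModeIdx M × ModeIdx M × ModeIdx M, (if q = (i, i, i) then F q else 0)
        = F (i, i, i) :=
      (Fintype.sum_eq_single (i, i, i) fun q hq => if_neg hq).trans (if_pos rfl)
    rw [e1, e2, e3, hF]
    dsimp only
    rw [Complex.mul_conj']
    ring
  · rw [← Finset.sum_filter, Finset.filter_mem_eq_inter, Finset.univ_inter, Finset.sum_image]
    intro c hc c' hc' h
    exact rectVertices_injOn i (by simpa using hc) (by simpa using hc') h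

theorem IsModePlacement.resonantSum_eq_zero {p : ModeIdx M → Z2} (hp : IsModePlacement p)
    (a : Z2 → ℂ) {n : Z2} (hn : n ∉ Finset.univ.image p) :
    resonantSum (Finset.univ.image p) a n = 0 := by
  have hn' : ∀ i, p i ≠ n := fun i h => hn (Finset.mem_image.2 ⟨i, Finset.mem_univ _, h⟩)
  rw [resonantSum_image_eq hp.injective]
  refine Finset.sum_eq_zero fun q _ => if_neg ?_
  rintro ⟨h1, h2⟩
  obtain ⟨x, y, z⟩ := q
  dsimp only at h1 h2
  by_cases hxy : x = y
  · exact hn' z (by simpa [hxy] using h1)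
  by_cases hzy : z = y
  · exact hn' x (by simpa [hzy] using h1)
  obtain ⟨k, c, hc, hv⟩ := hp.exists_rectLabel x y z h2 hxy hzy
  have hs := hp.sum_eq k c hc
  rw [hv] at hs
  exact hn' k (hs.symm.trans h1)

/-- Dilations preserve placements. -/
theorem IsModePlacement.dilate {p : ModeIdx M → Z2} (hp : IsModePlacement p) {R : ℤ} (hR : R ≠ 0) :
    IsModePlacement fun i => R • p i := by
  have hres : ∀ x y z : Z2, resonance (R • x, R • y, R • z) = R ^ 2 * resonance (x, y, z) :=
    fun x y z => by
      simp only [resonance, Prod.smul_fst, Prod.smul_snd, smul_eq_mul]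
      ring
  have hR2 : R ^ 2 ≠ 0 := pow_ne_zero 2 hR
  refine ⟨fun i j h => hp.injective (smul_right_injective Z2 hR h), fun i₁ i₂ i₃ h => ?_,
    fun i c hc => ?_, fun i c hc => ?_⟩
  · rw [hres] at h
    exact hp.exists_rectLabel i₁ i₂ i₃ ((mul_eq_zero.1 h).resolve_left hR2)
  · rw [hres, hp.resonance_eq_zero i c hc, mul_zero]
  · rw [← smul_sub, ← smul_add, hp.sum_eq i c hc]

end ModeSystem

section ModeSolution

open Set Filter

variable {M : ℕ}

/-- The parity of a node label. -/
def nodeSign (ε : Fin M → Bool) : ℤ := ∏ k, if ε k then -1 else 1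

theorem nodeSign_eq (ε : Fin M → Bool) : nodeSign ε = 1 ∨ nodeSign ε = -1 := by
  rw [← Int.isUnit_iff]
  refine (IsUnit.prod_iff).2 fun k _ => ?_
  split_ifs <;> simp

theorem nodeSign_flipBit (j : Fin M) (ε : Fin M → Bool) :
    nodeSign (flipBit j ε) = -nodeSign ε := by
  rw [nodeSign, nodeSign, ← Finset.mul_prod_erase _ _ (Finset.mem_univ j),
    ← Finset.mul_prod_erase _ (fun k => if ε k then (-1 : ℤ) else 1) (Finset.mem_univ j),
    ← neg_mul]
  congr 1
  · cases h : ε j <;> simp [h]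
  · refine Finset.prod_congr rfl fun k hk => ?_
    rw [flipBit_of_ne (Finset.ne_of_mem_erase hk)]

/-- The phases of the modes of a cluster, for the two kinds of nodes. -/
def clusterPhase (σ : ℤ) (g : Fin 2 × Fin 3) : ℂ :=
  if σ = 1 then 1 else if g.1 = 0 then 1 else Complex.exp (2 * Real.pi * Complex.I / 3) ^ (g.2 : ℕ)

theorem norm_cube_root : ‖Complex.exp (2 * Real.pi * Complex.I / 3)‖ = 1 := by
  have : (2 * Real.pi * Complex.I / 3 : ℂ) = ((2 * Real.pi / 3 : ℝ) : ℂ) * Complex.I := by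
    push_cast; ring
  rw [this, Complex.norm_exp_ofReal_mul_I]

theorem norm_clusterPhase (σ : ℤ) (g : Fin 2 × Fin 3) : ‖clusterPhase σ g‖ = 1 := by
  unfold clusterPhase
  split_ifs <;> simp [norm_cube_root]

theorem clusterPhase_mul_conj (σ : ℤ) (g : Fin 2 × Fin 3) :
    clusterPhase σ g * (starRingEnd ℂ) (clusterPhase σ g) = 1 := by
  rw [Complex.mul_conj', norm_clusterPhase]; simp

/-- The interaction inside a cluster shifts the frequency by `±3`. -/
theorem sum_clusterPhase {σ : ℤ} (hσ : σ = 1 ∨ σ = -1) (a : Fin 2) (b : Fin 3) :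
    2 * (∑ b', if b' ≠ b then clusterPhase σ (a, b') * (starRingEnd ℂ) (clusterPhase σ (a + 1, b'))
        * clusterPhase σ (a + 1, b) else 0) - clusterPhase σ (a, b)
      = 3 * σ * clusterPhase σ (a, b) := by
  have h3 : IsPrimitiveRoot (Complex.exp (2 * Real.pi * Complex.I / 3)) 3 :=
    mod_cast Complex.isPrimitiveRoot_exp 3 (by norm_num)
  set ω := Complex.exp (2 * Real.pi * Complex.I / 3) with hω
  have hsum : 1 + ω + ω ^ 2 = 0 := by
    have := h3.geom_sum_eq_zero (by norm_num)
    simpa [Finset.sum_range_succ] using this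
  have hcube : ω ^ 3 = 1 := h3.pow_eq_one
  have hconj : (starRingEnd ℂ) ω = ω ^ 2 := by
    have h1 : ω * (starRingEnd ℂ) ω = 1 := by
      rw [Complex.mul_conj', hω, norm_cube_root]; simp
    have h0 : ω ≠ 0 := h3.ne_zero (by norm_num)
    refine mul_left_cancel₀ h0 ?_
    rw [h1, ← hcube]; ring
  rcases hσ with rfl | rfl
  · fin_cases b <;> simp [clusterPhase, Fin.sum_univ_three] <;> norm_num
  · fin_cases a <;> fin_cases b <;>
      simp [clusterPhase, Fin.sum_univ_three, ← hω, hconj, ← pow_mul]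
    · linear_combination 2 * hsum + 2 * ω * hcube
    · linear_combination 2 * hsum + 2 * ω ^ 2 * hcube
    · linear_combination 2 * hsum + 2 * ω * hcube
    all_goals linear_combination 2 * hsum

/-- The phase of the modes of a node. -/
def nodePhase (m : ℝ) (Θ : ℕ → ℝ → ℝ) (x : Node M) (t : ℝ) : ℝ :=
  2 * m * t + (x.1 : ℕ) * (Real.pi / 4) + 3 * nodeSign x.2 * Θ x.1 t

/-- The solution of the resonant system attached to a solution of the Volterra chain. -/
def modeSolution (m : ℝ) (r Θ : ℕ → ℝ → ℝ) (t : ℝ) (i : ModeIdx M) : ℂ :=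
  r (i.1.1 + 1) t * Complex.exp (nodePhase m Θ i.1 t * Complex.I) *
    clusterPhase (nodeSign i.1.2) i.2

theorem norm_modeSolution (m : ℝ) (r Θ : ℕ → ℝ → ℝ) (t : ℝ) (i : ModeIdx M) :
    ‖modeSolution m r Θ t i‖ = |r (i.1.1 + 1) t| := by
  rw [modeSolution, norm_mul, norm_mul, norm_clusterPhase, Complex.norm_exp_ofReal_mul_I]
  simp

theorem exp_mul_conj_mul (x y z : ℝ) : Complex.exp (x * Complex.I) *
    (starRingEnd ℂ) (Complex.exp (y * Complex.I)) * Complex.exp (z * Complex.I)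
      = Complex.exp ((x - y + z : ℝ) * Complex.I) := by
  rw [← Complex.exp_conj, ← Complex.exp_add, ← Complex.exp_add]
  congr 1
  simp
  ring

theorem exp_add_pi_div_two (x : ℝ) : Complex.exp ((x + Real.pi / 2 : ℝ) * Complex.I)
    = Complex.I * Complex.exp (x * Complex.I) := by
  push_cast
  rw [add_mul, Complex.exp_add, Complex.exp_pi_div_two_mul_I, mul_comm]

theorem exp_sub_pi_div_two (x : ℝ) : Complex.exp ((x - Real.pi / 2 : ℝ) * Complex.I)
    = -(Complex.I * Complex.exp (x * Complex.I)) := by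
  have h := exp_add_pi_div_two (x - Real.pi / 2)
  rw [sub_add_cancel] at h
  rw [h, ← mul_assoc, Complex.I_mul_I]
  ring

variable (m : ℝ) (r Θ : ℕ → ℝ → ℝ) (t : ℝ)

theorem modeSolution_mul (i₁ i₂ i₃ : ModeIdx M) : modeSolution m r Θ t i₁ *
    (starRingEnd ℂ) (modeSolution m r Θ t i₂) * modeSolution m r Θ t i₃ =
    (r (i₁.1.1 + 1) t * r (i₂.1.1 + 1) t * r (i₃.1.1 + 1) t : ℝ) *
      Complex.exp ((nodePhase m Θ i₁.1 t - nodePhase m Θ i₂.1 t + nodePhase m Θ i₃.1 t : ℝ)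
        * Complex.I) *
      (clusterPhase (nodeSign i₁.1.2) i₁.2 * (starRingEnd ℂ) (clusterPhase (nodeSign i₂.1.2) i₂.2) *
        clusterPhase (nodeSign i₃.1.2) i₃.2) := by
  rw [← exp_mul_conj_mul]
  simp only [modeSolution, map_mul, Complex.conj_ofReal, Complex.ofReal_mul]
  ring

/-- The contribution of the rectangle with label `c`. -/
def rectTerm (i : ModeIdx M) (c : RectLabel M) : ℂ :=
  modeSolution m r Θ t (rectVertices i c).1 *
    (starRingEnd ℂ) (modeSolution m r Θ t (rectVertices i c).2.1) *
      modeSolution m r Θ t (rectVertices i c).2.2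

theorem sum_rectTerm_cluster (i : ModeIdx M) :
    ∑ q : Fin 3 × Bool, (if IsRectLabel i (.inl q) then rectTerm m r Θ t i (.inl q) else 0)
      = (3 * nodeSign i.1.2 + 1) * (r (i.1.1 + 1) t : ℂ) ^ 2 * modeSolution m r Θ t i := by
  have key := sum_clusterPhase (nodeSign_eq i.1.2) i.2.1 i.2.2
  have hterm : ∀ (b : Fin 3) (s : Bool), (if IsRectLabel i (.inl (b, s)) then
      rectTerm m r Θ t i (.inl (b, s)) else 0) =
      (r (i.1.1 + 1) t : ℂ) ^ 3 * Complex.exp (nodePhase m Θ i.1 t * Complex.I) *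
        (if b ≠ i.2.2 then clusterPhase (nodeSign i.1.2) (i.2.1, b) *
          (starRingEnd ℂ) (clusterPhase (nodeSign i.1.2) (i.2.1 + 1, b)) *
          clusterPhase (nodeSign i.1.2) (i.2.1 + 1, i.2.2) else 0) := by
    intro b s
    by_cases hb : b ≠ i.2.2
    · rw [if_pos hb, if_pos (by simpa [IsRectLabel] using hb)]
      cases s <;> rw [rectTerm, modeSolution_mul] <;> simp only [rectVertices] <;> push_cast <;>
        rw [sub_self, zero_add] <;> ring
    · rw [if_neg hb, if_neg (by simpa [IsRectLabel] using hb), mul_zero]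
  rw [Fintype.sum_prod_type]
  simp only [Fintype.sum_bool, hterm, ← two_mul]
  rw [← Finset.mul_sum, ← Finset.mul_sum, modeSolution]
  linear_combination (r (i.1.1 + 1) t : ℂ) ^ 3 * Complex.exp (nodePhase m Θ i.1 t * Complex.I) * key

theorem rectTerm_parent (i : ModeIdx M) (j : Fin M) (s : Bool)
    (h : IsRectLabel i (.inr (.inl (j, s)))) :
    rectTerm m r Θ t i (.inr (.inl (j, s)))
      = Complex.I * (r (i.1.1 + 2) t : ℂ) ^ 2 * modeSolution m r Θ t i := by
  obtain ⟨⟨e, ε⟩, g⟩ := i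
  obtain rfl : j.castSucc = e := h
  have hphase : nodePhase m Θ (j.succ, ε) t - nodePhase m Θ (j.castSucc, flipBit j ε) t
      + nodePhase m Θ (j.succ, flipBit j ε) t = nodePhase m Θ (j.castSucc, ε) t + Real.pi / 2 := by
    simp only [nodePhase, nodeSign_flipBit, Fin.val_succ, Fin.val_castSucc]
    push_cast
    ring
  have hphase' : nodePhase m Θ (j.succ, flipBit j ε) t - nodePhase m Θ (j.castSucc, flipBit j ε) t
      + nodePhase m Θ (j.succ, ε) t = nodePhase m Θ (j.castSucc, ε) t + Real.pi / 2 := by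
    rw [← hphase]; ring
  have h1 := clusterPhase_mul_conj (nodeSign (flipBit j ε)) g
  cases s <;> rw [rectTerm, modeSolution_mul, modeSolution] <;>
    simp only [rectVertices, hphase, hphase', exp_add_pi_div_two, Fin.val_succ, Fin.val_castSucc] <;>
    push_cast <;>
    linear_combination (r (j + 2) t ^ 2 * r (j + 1) t * Complex.I *
      Complex.exp (nodePhase m Θ (j.castSucc, ε) t * Complex.I) * clusterPhase (nodeSign ε) g) * h1

theorem rectTerm_child (i : ModeIdx M) (j : Fin M) (s : Bool)
    (h : IsRectLabel i (.inr (.inr (j, s)))) :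
    rectTerm m r Θ t i (.inr (.inr (j, s)))
      = -(Complex.I * (r i.1.1 t : ℂ) ^ 2 * modeSolution m r Θ t i) := by
  obtain ⟨⟨e, ε⟩, g⟩ := i
  obtain rfl : j.succ = e := h
  have hphase : nodePhase m Θ (j.castSucc, ε) t - nodePhase m Θ (j.succ, flipBit j ε) t
      + nodePhase m Θ (j.castSucc, flipBit j ε) t = nodePhase m Θ (j.succ, ε) t - Real.pi / 2 := by
    simp only [nodePhase, nodeSign_flipBit, Fin.val_succ, Fin.val_castSucc]
    push_cast
    ring
  have hphase' : nodePhase m Θ (j.castSucc, flipBit j ε) t - nodePhase m Θ (j.succ, flipBit j ε) t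
      + nodePhase m Θ (j.castSucc, ε) t = nodePhase m Θ (j.succ, ε) t - Real.pi / 2 := by
    rw [← hphase]; ring
  have h1 := clusterPhase_mul_conj (nodeSign (flipBit j ε)) g
  cases s <;> rw [rectTerm, modeSolution_mul, modeSolution] <;>
    simp only [rectVertices, hphase, hphase', exp_sub_pi_div_two, Fin.val_succ, Fin.val_castSucc] <;>
    push_cast <;>
    linear_combination (-(r (j + 1) t ^ 2 * r (j + 2) t * Complex.I *
      Complex.exp (nodePhase m Θ (j.succ, ε) t * Complex.I) * clusterPhase (nodeSign ε) g)) * h1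

theorem sum_rectTerm_parent (hr : r (M + 2) t = 0) (i : ModeIdx M) :
    ∑ q : Fin M × Bool, (if IsRectLabel i (.inr (.inl q)) then
      rectTerm m r Θ t i (.inr (.inl q)) else 0)
      = 2 * Complex.I * (r (i.1.1 + 2) t : ℂ) ^ 2 * modeSolution m r Θ t i := by
  have hterm : ∀ (j : Fin M) (s : Bool), (if IsRectLabel i (.inr (.inl (j, s))) then
      rectTerm m r Θ t i (.inr (.inl (j, s))) else 0) = if j.castSucc = i.1.1 then
      Complex.I * (r (i.1.1 + 2) t : ℂ) ^ 2 * modeSolution m r Θ t i else 0 := fun j s => by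
    have hiff : IsRectLabel i (.inr (.inl (j, s))) ↔ j.castSucc = i.1.1 := Iff.rfl
    by_cases h : j.castSucc = i.1.1
    · rw [if_pos (hiff.2 h), if_pos h, rectTerm_parent m r Θ t i j s h]
    · rw [if_neg (mt hiff.1 h), if_neg h]
  rw [Fintype.sum_prod_type]
  simp only [Fintype.sum_bool, hterm, ← two_mul]
  rw [← Finset.mul_sum]
  generalize hE : i.1.1 = e
  induction e using Fin.lastCases with
  | last => simp [hr]
  | cast k =>
    simp only [Fin.castSucc_inj, Finset.sum_ite_eq', Finset.mem_univ, if_true]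
    ring

theorem sum_rectTerm_child (hr : r 0 t = 0) (i : ModeIdx M) :
    ∑ q : Fin M × Bool, (if IsRectLabel i (.inr (.inr q)) then
      rectTerm m r Θ t i (.inr (.inr q)) else 0)
      = -(2 * Complex.I * (r i.1.1 t : ℂ) ^ 2 * modeSolution m r Θ t i) := by
  have hterm : ∀ (j : Fin M) (s : Bool), (if IsRectLabel i (.inr (.inr (j, s))) then
      rectTerm m r Θ t i (.inr (.inr (j, s))) else 0) = if j.succ = i.1.1 then
      -(Complex.I * (r i.1.1 t : ℂ) ^ 2 * modeSolution m r Θ t i) else 0 := fun j s => by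
    have hiff : IsRectLabel i (.inr (.inr (j, s))) ↔ j.succ = i.1.1 := Iff.rfl
    by_cases h : j.succ = i.1.1
    · rw [if_pos (hiff.2 h), if_pos h, rectTerm_child m r Θ t i j s h]
    · rw [if_neg (mt hiff.1 h), if_neg h]
  rw [Fintype.sum_prod_type]
  simp only [Fintype.sum_bool, hterm, ← two_mul]
  rw [← Finset.mul_sum]
  generalize hE : i.1.1 = e
  induction e using Fin.cases with
  | zero => simp [hr, Fin.succ_ne_zero]
  | succ k =>
    simp only [Fin.succ_inj, Finset.sum_ite_eq', Finset.mem_univ, if_true]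
    ring

theorem sum_rectTerm (hr0 : r 0 t = 0) (hr : r (M + 2) t = 0) (i : ModeIdx M) :
    ∑ c with IsRectLabel i c, rectTerm m r Θ t i c =
      ((3 * nodeSign i.1.2 + 1) * (r (i.1.1 + 1) t : ℂ) ^ 2 + 2 * Complex.I * (r (i.1.1 + 2) t : ℂ) ^ 2
        - 2 * Complex.I * (r i.1.1 t : ℂ) ^ 2) * modeSolution m r Θ t i := by
  rw [Finset.sum_filter, Fintype.sum_sum_type, Fintype.sum_sum_type, sum_rectTerm_cluster,
    sum_rectTerm_parent m r Θ t hr, sum_rectTerm_child m r Θ t hr0]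
  ring

theorem sum_sq_norm_modeSolution :
    ∑ k : ModeIdx M, ‖modeSolution m r Θ t k‖ ^ 2
      = 6 * 2 ^ M * ∑ k ∈ Finset.range (M + 1), r (k + 1) t ^ 2 := by
  rw [Fintype.sum_prod_type, Fintype.sum_prod_type, Finset.sum_range, Finset.mul_sum]
  refine Finset.sum_congr rfl fun e _ => ?_
  simp only [norm_modeSolution, sq_abs, Finset.sum_const, Finset.card_univ, Fintype.card_pi,
    Fintype.card_prod, Fintype.card_fin, Fintype.card_bool, Finset.prod_const, nsmul_eq_mul]
  push_cast
  ring

theorem hasDerivAt_modeSolution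
    (hr : ∀ k, HasDerivAt (r (k + 1)) (2 * r (k + 1) t * (r k t ^ 2 - r (k + 2) t ^ 2)) t)
    (hΘ : ∀ k, HasDerivAt (Θ k) (r (k + 1) t ^ 2) t) (i : ModeIdx M) :
    HasDerivAt (fun τ => modeSolution m r Θ τ i)
      ((2 * ((r i.1.1 t : ℂ) ^ 2 - (r (i.1.1 + 2) t : ℂ) ^ 2) + Complex.I *
        (2 * m + 3 * nodeSign i.1.2 * (r (i.1.1 + 1) t : ℂ) ^ 2)) * modeSolution m r Θ t i) t := by
  have h1 : HasDerivAt (nodePhase m Θ i.1) (2 * m + 3 * nodeSign i.1.2 * r (i.1.1 + 1) t ^ 2) t := by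
    refine ((((hasDerivAt_id t).const_mul (2 * m)).add_const _).add
      ((hΘ i.1.1).const_mul (3 * (nodeSign i.1.2 : ℝ)))).congr_deriv ?_
    ring
  have h2 := (h1.ofReal_comp.mul_const Complex.I).cexp
  refine (((hr i.1.1).ofReal_comp.fun_mul h2).mul_const
    (clusterPhase (nodeSign i.1.2) i.2)).congr_deriv ?_
  simp only [modeSolution]
  push_cast
  ring

/-- Every placement carries a solution of the resonant system whose amplitudes follow the Volterra
chain. -/
theorem IsModePlacement.exists_resonant_solution {p : ModeIdx M → Z2} (hp : IsModePlacement p)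
    {r : ℕ → ℝ → ℝ} (hr0 : ∀ t, r 0 t = 0) (hrM : ∀ t, r (M + 2) t = 0)
    (hr : ∀ k t, HasDerivAt (r (k + 1)) (2 * r (k + 1) t * (r k t ^ 2 - r (k + 2) t ^ 2)) t)
    (hsum : ∀ t, ∑ k ∈ Finset.range (M + 1), r (k + 1) t ^ 2 = 1) :
    ∃ γ : ℝ → Z2 → ℂ, (∀ t n, n ∉ Finset.univ.image p → γ t n = 0) ∧
      (∀ t n, HasDerivAt (fun τ => γ τ n)
        (Complex.I * resonantSum (Finset.univ.image p) (γ t) n) t) ∧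
      ∀ t i, ‖γ t (p i)‖ = |r (i.1.1 + 1) t| := by
  set Θ : ℕ → ℝ → ℝ := fun k t => ∫ τ in (0 : ℝ)..t, r (k + 1) τ ^ 2 with hΘdef
  have hΘ : ∀ k t, HasDerivAt (Θ k) (r (k + 1) t ^ 2) t := fun k t => by
    have hc : Continuous fun τ => r (k + 1) τ ^ 2 :=
      (continuous_iff_continuousAt.2 fun τ => (hr k τ).continuousAt).pow 2
    exact (hc.integral_hasStrictDerivAt 0 t).hasDerivAt
  set m : ℝ := 6 * 2 ^ M with hm
  set γ : ℝ → Z2 → ℂ := fun t => Function.extend p (modeSolution m r Θ t) 0 with hγ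
  have hγp : ∀ t i, γ t (p i) = modeSolution m r Θ t i := fun t i => by
    rw [hγ]; exact hp.injective.extend_apply _ _ _
  have hγ0 : ∀ t n, n ∉ Finset.univ.image p → γ t n = 0 := fun t n hn => by
    rw [hγ]
    exact Function.extend_apply' _ _ _ fun ⟨i, hi⟩ => hn (Finset.mem_image.2 ⟨i, Finset.mem_univ _, hi⟩)
  refine ⟨γ, hγ0, fun t n => ?_, fun t i => by rw [hγp, norm_modeSolution]⟩
  by_cases hn : n ∈ Finset.univ.image p
  · obtain ⟨i, -, rfl⟩ := Finset.mem_image.1 hn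
    simp only [hγp]
    refine (hasDerivAt_modeSolution m r Θ t (fun k => hr k t) (fun k => hΘ k t) i).congr_deriv ?_
    have hmass : ∑ k : ModeIdx M, (‖modeSolution m r Θ t k‖ : ℂ) ^ 2 = m := by
      have := sum_sq_norm_modeSolution (M := M) m r Θ t
      rw [hsum, mul_one, ← hm] at this
      exact_mod_cast this
    have hrect := sum_rectTerm m r Θ t (hr0 t) (hrM t) i
    have hnorm : (‖modeSolution m r Θ t i‖ : ℂ) ^ 2 = (r (i.1.1 + 1) t : ℂ) ^ 2 := by
      rw [norm_modeSolution]
      exact_mod_cast sq_abs (r (i.1.1 + 1) t)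
    simp only [rectTerm] at hrect
    rw [hp.resonantSum_apply]
    simp only [hγp]
    rw [hmass, hnorm, hrect]
    linear_combination (-2 * ((r (i.1.1 + 2) t : ℂ) ^ 2 - (r i.1.1 t : ℂ) ^ 2) *
      modeSolution m r Θ t i) * Complex.I_mul_I
  · rw [hp.resonantSum_eq_zero _ hn, mul_zero]
    simp only [hγ0 _ n hn]
    exact hasDerivAt_const _ _

end ModeSolution

section Growth

open Set Filter Topology

theorem nsq_smul (R : ℤ) (n : Z2) : nsq (R • n) = (R : ℝ) ^ 2 * nsq n := by
  simp only [nsq, Prod.smul_fst, Prod.smul_snd, smul_eq_mul]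
  push_cast
  ring

theorem HsNorm_le_of_sq_le {s μ : ℝ} {a : Z2 → ℂ} (hμ : 0 ≤ μ) (h : HsNormSq s a ≤ μ ^ 2) :
    HsNorm s a ≤ μ := by
  rw [HsNorm, ← Real.sqrt_eq_rpow]
  exact Real.sqrt_le_iff.2 ⟨hμ, h⟩

theorem le_HsNorm_of_sq_le {s C : ℝ} {a : Z2 → ℂ} (ha : HsFinite s a) (n : Z2)
    (h : C ^ 2 ≤ (1 + nsq n) ^ s * ‖a n‖ ^ 2) : C ≤ HsNorm s a := by
  rw [HsNorm, ← Real.sqrt_eq_rpow]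
  refine Real.le_sqrt_of_sq_le (h.trans ?_)
  exact ha.le_tsum n fun k _ => mul_nonneg
    (Real.rpow_nonneg (by linarith [nsq_nonneg k]) s) (sq_nonneg _)

theorem exists_subset_box (Λ : Finset Z2) : ∃ K, Λ ⊆ box K := by
  refine ⟨Λ.sup fun n => n.1.natAbs + n.2.natAbs, fun n hn => mem_box.2 ?_⟩
  have := Finset.le_sup (f := fun n : Z2 => n.1.natAbs + n.2.natAbs) hn
  omega

/-- If the transfer starts close enough to the first generation, only this generation matters
initially. -/
theorem sum_weight_le {M : ℕ} {p : ModeIdx M → Z2} {s Q δ : ℝ} (hs : 0 ≤ s) (hQ : 0 < Q)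
    (hlow : ∀ ε g, 1 + nsq (p ((0, ε), g)) ≤ 13 * Q)
    (hδ : δ * ∑ i, (1 + nsq (p i)) ^ s ≤ (13 * Q) ^ s) {r : ℕ → ℝ} (hr1 : ∀ k ≤ M, r (k + 1) ^ 2 ≤ 1)
    (hr : ∀ k, 1 ≤ k → r (k + 1) ^ 2 ≤ δ) :
    ∑ i : ModeIdx M, (1 + nsq (p i)) ^ s * r (i.1.1 + 1) ^ 2 ≤ 7 * 2 ^ M * (13 * Q) ^ s := by
  have hw : ∀ i, 0 ≤ (1 + nsq (p i)) ^ s := fun i => Real.rpow_nonneg (by linarith [nsq_nonneg (p i)]) s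
  have hQs : 0 ≤ (13 * Q) ^ s := Real.rpow_nonneg (by positivity) s
  have hδ0 : 0 ≤ δ := (sq_nonneg _).trans (hr 1 le_rfl)
  have hterm : ∀ i : ModeIdx M, (1 + nsq (p i)) ^ s * r (i.1.1 + 1) ^ 2 ≤
      δ * (1 + nsq (p i)) ^ s + if i.1.1 = 0 then (13 * Q) ^ s else 0 := by
    intro i
    split_ifs with h
    · have hp : 1 + nsq (p i) ≤ 13 * Q := by
        obtain ⟨⟨e, ε⟩, g⟩ := i
        obtain rfl : e = 0 := h
        exact hlow ε g
      have h1 : (1 + nsq (p i)) ^ s ≤ (13 * Q) ^ s :=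
        Real.rpow_le_rpow (by linarith [nsq_nonneg (p i)]) hp hs
      have h2 := mul_le_mul_of_nonneg_left (hr1 _ (Fin.is_le i.1.1)) (hw i)
      nlinarith [mul_nonneg hδ0 (hw i)]
    · have h1 : 1 ≤ (i.1.1 : ℕ) := Nat.one_le_iff_ne_zero.2 fun e => h (Fin.ext e)
      have := mul_le_mul_of_nonneg_left (hr _ h1) (hw i)
      linarith
  have hcount : ∑ i : ModeIdx M, (if i.1.1 = 0 then (13 * Q) ^ s else 0) = 6 * 2 ^ M * (13 * Q) ^ s := by
    rw [Fintype.sum_prod_type, Fintype.sum_prod_type, Fintype.sum_eq_single 0 fun e he => by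
      simp [he]]
    simp only [if_true, Finset.sum_const, Finset.card_univ, Fintype.card_pi,
      Fintype.card_prod, Fintype.card_fin, Fintype.card_bool, Finset.prod_const, nsmul_eq_mul]
    push_cast
    ring
  calc _ ≤ ∑ i : ModeIdx M, (δ * (1 + nsq (p i)) ^ s + if i.1.1 = 0 then (13 * Q) ^ s else 0) :=
        Finset.sum_le_sum fun i _ => hterm i
    _ = δ * ∑ i, (1 + nsq (p i)) ^ s + 6 * 2 ^ M * (13 * Q) ^ s := by
        rw [Finset.sum_add_distrib, ← Finset.mul_sum, hcount]
    _ ≤ 7 * 2 ^ M * (13 * Q) ^ s := by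
        have : (1 : ℝ) ≤ 2 ^ M := one_le_pow₀ (by norm_num)
        nlinarith

/-- Dilated initial data are small in the Sobolev norm. -/
theorem HsNormSq_dilate_le {ι : Type*} [Fintype ι] {p : ι → Z2} {R : ℤ} (hR : 1 ≤ R)
    (hp : Function.Injective fun i => R • p i) {s : ℝ} (hs : 0 ≤ s) {γ : Z2 → ℂ} {ρ : ι → ℝ}
    (hsupp : ∀ n, n ∉ Finset.univ.image (fun i => R • p i) → γ n = 0)
    (hγ : ∀ i, ‖γ (R • p i)‖ = |ρ i|) {lam : ℝ} :
    HsNormSq s (fun n => lam⁻¹ * γ n) ≤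
      ((R : ℝ) ^ s) ^ 2 * (lam⁻¹) ^ 2 * ∑ i, (1 + nsq (p i)) ^ s * ρ i ^ 2 := by
  have hR1 : (1 : ℝ) ≤ R := by exact_mod_cast hR
  have hR0 : (0 : ℝ) ≤ R := by linarith
  rw [HsNormSq, tsum_eq_sum fun n hn => by rw [hsupp n hn]; simp,
    Finset.sum_image fun x _ y _ h => hp h, Finset.mul_sum]
  refine Finset.sum_le_sum fun i _ => ?_
  have h1 : (1 + nsq (R • p i)) ^ s ≤ ((R : ℝ) ^ s) ^ 2 * (1 + nsq (p i)) ^ s := by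
    have hn := nsq_nonneg (p i)
    have e : ((R : ℝ) ^ s) ^ 2 = ((R : ℝ) ^ 2) ^ s := by
      rw [← Real.rpow_mul_natCast hR0, ← Real.rpow_natCast_mul hR0, mul_comm]
    rw [e, ← Real.mul_rpow (sq_nonneg _) (by linarith)]
    refine Real.rpow_le_rpow ?_ ?_ hs
    · linarith [nsq_nonneg (R • p i)]
    · rw [nsq_smul]; nlinarith
  have h2 : ‖((lam⁻¹ : ℝ) : ℂ) * γ (R • p i)‖ ^ 2 = (lam⁻¹) ^ 2 * ρ i ^ 2 := by
    rw [norm_mul, hγ, Complex.norm_real, mul_pow, Real.norm_eq_abs, sq_abs, sq_abs]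
  calc (1 + nsq (R • p i)) ^ s * ‖((lam⁻¹ : ℝ) : ℂ) * γ (R • p i)‖ ^ 2
      ≤ (((R : ℝ) ^ s) ^ 2 * (1 + nsq (p i)) ^ s) * ((lam⁻¹) ^ 2 * ρ i ^ 2) := by
        rw [h2]
        exact mul_le_mul_of_nonneg_right h1 (by positivity)
    _ = _ := by ring

theorem le_norm_of_approximation {θ lam C : ℝ} {z w : ℂ} (hC : 1 ≤ C) (hlam : 5 * C ≤ lam)
    (hw : 1 / 2 ≤ ‖w‖ ^ 2) (h : ‖Complex.exp (-(θ : ℝ) * Complex.I) * z - (lam⁻¹ : ℝ) * w‖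
      ≤ C / lam ^ 3) :
    lam⁻¹ / 2 ≤ ‖z‖ := by
  have hlam0 : 0 < lam := by linarith
  have hexp : ‖Complex.exp (-(θ : ℝ) * Complex.I)‖ = 1 := by
    have : (-(θ : ℝ) * Complex.I : ℂ) = ((-θ : ℝ) : ℂ) * Complex.I := by push_cast; ring
    rw [this, Complex.norm_exp_ofReal_mul_I]
  have h1 := norm_sub_norm_le (((lam⁻¹ : ℝ) : ℂ) * w) (Complex.exp (-(θ : ℝ) * Complex.I) * z)
  rw [norm_sub_rev, norm_mul, norm_mul, hexp, one_mul, Complex.norm_real,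
    Real.norm_eq_abs, abs_of_pos (inv_pos.2 hlam0)] at h1
  have h2 : C / lam ^ 3 ≤ lam⁻¹ * (1 / 5) := by
    rw [div_le_iff₀ (by positivity)]
    have : lam⁻¹ * (1 / 5) * lam ^ 3 = lam ^ 2 / 5 := by field_simp
    rw [this]
    nlinarith
  have h3 : 7 / 10 ≤ ‖w‖ := by nlinarith [norm_nonneg w]
  have h4 : lam⁻¹ * (7 / 10) ≤ lam⁻¹ * ‖w‖ := mul_le_mul_of_nonneg_left h3 (by positivity)
  linarith

theorem exists_generation_count {s : ℝ} (hs : 1 < s) (L : ℝ) : ∃ M : ℕ, L * 2 ^ M ≤ ((2 : ℝ) ^ M) ^ s := by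
  have h1 : (1 : ℝ) < 2 ^ (s - 1) := Real.one_lt_rpow (by norm_num) (by linarith)
  obtain ⟨M, hM⟩ := pow_unbounded_of_one_lt L h1
  refine ⟨M, ?_⟩
  have e : ((2 : ℝ) ^ M) ^ s = (2 ^ (s - 1)) ^ M * 2 ^ M := by
    rw [← mul_pow, ← Real.rpow_add_one (by norm_num), sub_add_cancel,
      ← Real.rpow_mul_natCast (by norm_num), ← Real.rpow_natCast_mul (by norm_num), mul_comm]
  rw [e]
  exact mul_le_mul_of_nonneg_right hM.le (by positivity)

end Growth

/-- **Theorem 1.1 (Colliander–Keel–Staffilani–Takaoka–Tao).** Fix `s > 1`. For every `μ > 0`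
and `𝒞 > 0` there exist a global Fourier-side solution of the cubic defocusing NLS (the case
`v ≡ 0`), with finite `H^s` norms, and a time `T > 0` such that `‖a(0)‖_{H^s} ≤ μ` and
`‖a(T)‖_{H^s} ≥ 𝒞`. -/
theorem growth_of_sobolev_norms_NLS_CKSTT
    (s : ℝ) (hs : 1 < s) :
    ∀ μ > (0 : ℝ), ∀ C > (0 : ℝ),
      ∃ (a : ℝ → Z2 → ℂ) (T : ℝ),
        IsSolutionV (fun _ => 0) a ∧
        (∀ t : ℝ, HsFinite s (a t)) ∧
        0 < T ∧
        HsNorm s (a 0) ≤ μ ∧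
        C ≤ HsNorm s (a T) := by
  intro μ hμ C hC
  have hs0 : 0 ≤ s := by linarith
  obtain ⟨M, hM⟩ := exists_generation_count hs (28 * 52 ^ s * C ^ 2 / μ ^ 2)
  obtain ⟨p, Q, hp, hQ, hlow, ι, hι, hhigh⟩ := exists_isModePlacement M
  have hW0 : 0 ≤ ∑ i, (1 + nsq (p i)) ^ s := Finset.sum_nonneg fun i _ =>
    Real.rpow_nonneg (by linarith [nsq_nonneg (p i)]) s
  set W : ℝ := ∑ i, (1 + nsq (p i)) ^ s with hW
  have hQs : 0 < (13 * Q) ^ s := Real.rpow_pos_of_pos (by positivity) s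
  obtain ⟨r, T, hT, hr0, hrM, hr, hsum, hδ, hrT⟩ := exists_volterra_transfer M
    (δ := min (1 / 8) ((13 * Q) ^ s / (W + 1))) (lt_min (by norm_num) (by positivity))
    (min_le_left _ _)
  have hr1 : ∀ t, ∀ k ≤ M, r (k + 1) t ^ 2 ≤ 1 := fun t k hk => by
    rw [← hsum t]
    exact Finset.single_le_sum (f := fun k => r (k + 1) t ^ 2) (fun i _ => sq_nonneg _)
      (Finset.mem_range.2 (by omega))
  have hδW : min (1 / 8) ((13 * Q) ^ s / (W + 1)) * W ≤ (13 * Q) ^ s := by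
    refine (mul_le_mul_of_nonneg_right (min_le_right _ _) hW0).trans ?_
    rw [div_mul_eq_mul_div, div_le_iff₀ (by positivity)]
    nlinarith
  have hinit := sum_weight_le (r := fun k => r k 0) hs0 hQ hlow hδW (hr1 0) hδ
  set B : ℝ := 7 * 2 ^ M * (13 * Q) ^ s with hB
  have hB0 : 0 < B := by positivity
  obtain ⟨C₁, hC₁, happrox⟩ := exists_approximation_constant
    (G := Fintype.card (ModeIdx M)) (Nat.cast_nonneg _) hT.le
  obtain ⟨R, hR⟩ := exists_nat_ge (max 1 (5 * C₁ * μ / √B))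
  have hR1 : (1 : ℝ) ≤ R := (le_max_left _ _).trans hR
  have hRℤ : (1 : ℤ) ≤ R := by exact_mod_cast hR1
  have hRs : (R : ℝ) ≤ (R : ℝ) ^ s := Real.self_le_rpow_of_one_le hR1 hs.le
  set lam : ℝ := (R : ℝ) ^ s * √B / μ with hlam
  have hsB : 0 < √B := Real.sqrt_pos.2 hB0
  have hlam5 : 5 * C₁ ≤ lam := by
    rw [hlam, le_div_iff₀ hμ, ← div_le_iff₀ hsB]
    exact ((le_max_right _ _).trans hR).trans hRs
  have hlam0 : 0 < lam := by linarith
  have hscale : ((R : ℝ) ^ s) ^ 2 * lam⁻¹ ^ 2 * B = μ ^ 2 := by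
    have hRs0 : (0 : ℝ) < (R : ℝ) ^ s := by linarith
    have hB2 : √B ^ 2 = B := Real.sq_sqrt hB0.le
    rw [hlam]
    field_simp
    rw [hB2]
  have hpR := hp.dilate (R := (R : ℤ)) (by omega)
  obtain ⟨γ, hsupp, hγ, hγn⟩ := hpR.exists_resonant_solution hr0 (hrM _ (by omega)) hr hsum
  obtain ⟨K, hK⟩ := exists_subset_box (Finset.univ.image fun i => (R : ℤ) • p i)
  obtain ⟨a, A, ha, hfin, ha0, hA, hlim⟩ := exists_isSolution hs.le (fun n => (lam⁻¹ : ℝ) * γ 0 n) K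
    fun n hn => by rw [hsupp 0 n fun h => hn (hK h), mul_zero]
  refine ⟨a, lam ^ 2 * T, ha, hfin, by positivity, HsNorm_le_of_sq_le hμ.le ?_,
    le_HsNorm_of_sq_le (hfin _) ((R : ℤ) • p ι) ?_⟩
  · rw [ha0]
    refine (HsNormSq_dilate_le hRℤ hpR.injective hs0 (hsupp 0) (hγn 0)).trans ?_
    refine (mul_le_mul_of_nonneg_left hinit (by positivity)).trans ?_
    rw [Int.cast_natCast, hscale]
  · have hnorm : lam⁻¹ / 2 ≤ ‖a (lam ^ 2 * T) ((R : ℤ) • p ι)‖ := by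
      refine ge_of_tendsto (hlim (lam ^ 2 * T) ((R : ℤ) • p ι)).norm (.of_forall fun k => ?_)
      have hsub : (Finset.univ.image fun i => (R : ℤ) • p i) ⊆ box (K + k + 1) := fun n hn => by
        have := mem_box.1 (hK hn)
        exact mem_box.2 (by omega)
      have hmem : (R : ℤ) • p ι ∈ Finset.univ.image fun i => (R : ℤ) • p i :=
        Finset.mem_image.2 ⟨ι, Finset.mem_univ _, rfl⟩
      have hG : ∀ t ∈ Set.Icc 0 T, ∑ n ∈ Finset.univ.image fun i => (R : ℤ) • p i, ‖γ t n‖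
          ≤ Fintype.card (ModeIdx M) := fun t _ => by
        rw [Finset.sum_image fun x _ y _ h => hpR.injective h]
        refine (Finset.sum_le_card_nsmul _ _ 1 fun i _ => ?_).trans (by simp)
        rw [hγn]
        exact (sq_le_one_iff_abs_le_one _).1 (hr1 t _ (Fin.is_le i.1.1))
      have h := happrox lam (by linarith) _ _ γ (A k) hsub hsupp hγ hG (hA k).1
        (fun n => by rw [(hA k).2]) (lam ^ 2 * T) ⟨by positivity, le_rfl⟩
      have h1 := (Finset.single_le_sum (fun _ _ => norm_nonneg _) (hsub hmem)).trans h
      refine le_norm_of_approximation hC₁ hlam5 ?_ h1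
      rw [mul_div_cancel_left₀ _ (by positivity), hγn, sq_abs, hι]
      exact hrT
    have hweight : ((R : ℝ) ^ s) ^ 2 * (2 ^ M / 4 * Q) ^ s ≤ (1 + nsq ((R : ℤ) • p ι)) ^ s := by
      have e : ((R : ℝ) ^ s) ^ 2 = ((R : ℝ) ^ 2) ^ s := by
        rw [← Real.rpow_mul_natCast (by positivity), ← Real.rpow_natCast_mul (by positivity),
          mul_comm]
      rw [e, ← Real.mul_rpow (by positivity) (by positivity)]
      refine Real.rpow_le_rpow (by positivity) ?_ hs0
      rw [nsq_smul, Int.cast_natCast]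
      nlinarith [mul_le_mul_of_nonneg_left hhigh (sq_nonneg (R : ℝ))]
    have hgain : C ^ 2 ≤ ((R : ℝ) ^ s) ^ 2 * (2 ^ M / 4 * Q) ^ s * (lam⁻¹ / 2) ^ 2 := by
      have e1 : ((2 : ℝ) ^ M / 4 * Q) ^ s * 52 ^ s = (2 ^ M) ^ s * (13 * Q) ^ s := by
        rw [← Real.mul_rpow (by positivity) (by positivity),
          ← Real.mul_rpow (by positivity) (by positivity)]
        congr 1
        ring
      have e2 : ((R : ℝ) ^ s) ^ 2 * (2 ^ M / 4 * Q) ^ s * (lam⁻¹ / 2) ^ 2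
          = (2 ^ M / 4 * Q) ^ s * μ ^ 2 / (4 * B) := by
        rw [eq_div_iff (by positivity)]
        linear_combination (2 ^ M / 4 * Q) ^ s * hscale
      have h52 : (0 : ℝ) < 52 ^ s := by positivity
      have hM' : 28 * 52 ^ s * C ^ 2 * 2 ^ M ≤ (2 ^ M) ^ s * μ ^ 2 := by
        rw [div_mul_eq_mul_div, div_le_iff₀ (by positivity)] at hM
        exact hM
      rw [e2, le_div_iff₀ (by positivity), hB]
      refine le_of_mul_le_mul_right ?_ h52
      calc C ^ 2 * (4 * (7 * 2 ^ M * (13 * Q) ^ s)) * 52 ^ s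
          = 28 * 52 ^ s * C ^ 2 * 2 ^ M * (13 * Q) ^ s := by ring
        _ ≤ (2 ^ M) ^ s * μ ^ 2 * (13 * Q) ^ s := mul_le_mul_of_nonneg_right hM' hQs.le
        _ = (2 ^ M / 4 * Q) ^ s * μ ^ 2 * 52 ^ s := by linear_combination (-μ ^ 2) * e1
    exact hgain.trans (mul_le_mul hweight (pow_le_pow_left₀ (by positivity) hnorm 2) (by positivity)
      (Real.rpow_nonneg (by linarith [nsq_nonneg ((R : ℤ) • p ι)]) s))
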